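/- Let n ≥ 1, d ≥ 3 and r ≥ 1. Then there exist nonzero isotropic linear forms ℓ_1,…,ℓ_r in ℂ[x_0,…,x_n] such that the ℂ-vector subspace of homogeneous degree-d polynomials spanned by all products ℓ_j^{d−1}·m, where 1 ≤ j ≤ r and m ranges over the linear forms orthogonal to ℓ_j, has dimension exactly min( r·n, C(n+d,n) − C(n+d−2,n) ). -/

import Mathlib

open MvPolynomial

/-- The linear form with coefficient vector `a`. -/
noncomputable def lin {n : ℕ} (a : Fin n → ℂ) : MvPolynomial (Fin n) ℂ :=
  ∑ i, MvPolynomial.C (a i) * MvPolynomial.X i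

/-- The Laplace operator `Δ = ∑ ∂²/∂xᵢ²`. -/
noncomputable def lap {n : ℕ} (p : MvPolynomial (Fin n) ℂ) : MvPolynomial (Fin n) ℂ :=
  ∑ i, MvPolynomial.pderiv i (MvPolynomial.pderiv i p)

/-- A coefficient vector (linear form) is isotropic if `∑ aᵢ² = 0`. -/
def Isotropic {n : ℕ} (a : Fin n → ℂ) : Prop :=
  ∑ i, (a i) ^ 2 = 0

/-- Isotropic rank: least `r` such that `h` is a sum of `r` `d`-th powers of
isotropic linear forms. -/
noncomputable def irk {n : ℕ} (d : ℕ) (h : MvPolynomial (Fin n) ℂ) : ℕ :=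
  sInf {r : ℕ | ∃ ℓ : Fin r → (Fin n → ℂ),
    (∀ j, Isotropic (ℓ j)) ∧ h = ∑ j, (lin (ℓ j)) ^ d}

/-- Waring rank: least `r` such that `h` is a sum of `r` `d`-th powers of
linear forms. -/
noncomputable def wrk {n : ℕ} (d : ℕ) (h : MvPolynomial (Fin n) ℂ) : ℕ :=
  sInf {r : ℕ | ∃ ℓ : Fin r → (Fin n → ℂ), h = ∑ j, (lin (ℓ j)) ^ d}

namespace AH
open MvPolynomial

/-- the set `s` contains `k` linearly independent vectors -/
def RankGE (K : Type*) {V : Type*} [Field K] [AddCommGroup V] [Module K V] (k : ℕ) (s : Set V) :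
    Prop := ∃ w : Fin k → V, (∀ i, w i ∈ s) ∧ LinearIndependent K w

section rank
variable {K V V' : Type*} [Field K] [AddCommGroup V] [Module K V] [AddCommGroup V'] [Module K V']

theorem RankGE.le_finrank {k : ℕ} {s : Set V} (h : RankGE K k s) (W : Submodule K V)
    [FiniteDimensional K W] (hs : s ⊆ W) : k ≤ Module.finrank K W := by
  obtain ⟨w, hw, hi⟩ := h
  have : LinearIndependent K (fun i => (⟨w i, hs (hw i)⟩ : W)) := by
    apply LinearIndependent.of_comp W.subtype
    exact hi
  simpa using this.fintype_card_le_finrank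

theorem RankGE.of_span {k : ℕ} {s t : Set V} (h : RankGE K k s)
    (hst : s ⊆ Submodule.span K t) : RankGE K k t := by
  obtain ⟨w, hw, hi⟩ := h
  obtain ⟨b, hbt, hbs, hbi⟩ := exists_linearIndependent K t
  by_cases hk : ∃ f : Fin k ↪ b, True
  · obtain ⟨f, -⟩ := hk
    exact ⟨fun i => (f i : V), fun i => hbt (f i).2, hbi.comp f f.injective⟩
  · exfalso
    have hfin : Finite b := by
      by_contra hinf
      rw [not_finite_iff_infinite] at hinf
      exact hk ⟨Fin.valEmbedding.trans (Infinite.natEmbedding b), trivial⟩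
    have := Fintype.ofFinite b
    have hlt : Fintype.card b < k := by
      by_contra hge
      push Not at hge
      exact hk ⟨(Fin.castLEEmb hge).trans (Fintype.equivFin b).symm.toEmbedding, trivial⟩
    have hsub : Set.range w ⊆ Submodule.span K b := by
      rintro _ ⟨i, rfl⟩
      rw [hbs]; exact hst (hw i)
    have : FiniteDimensional K (Submodule.span K b) := FiniteDimensional.span_of_finite K hfin
    have h1 := RankGE.le_finrank (s := Set.range w) ⟨w, fun i => ⟨i, rfl⟩, hi⟩ _ hsub
    have h2 := finrank_span_eq_card hbi
    rw [Subtype.range_coe] at h2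
    exact absurd (h1.trans h2.le) (not_le.2 hlt)

theorem RankGE.mono {k : ℕ} {s t : Set V} (h : RankGE K k s) (hst : s ⊆ t) : RankGE K k t :=
  h.of_span (hst.trans Submodule.subset_span)

theorem RankGE.le {k l : ℕ} {s : Set V} (h : RankGE K k s) (hl : l ≤ k) : RankGE K l s := by
  obtain ⟨w, hw, hi⟩ := h
  exact ⟨w ∘ Fin.castLE hl, fun i => hw _, hi.comp _ (Fin.castLE_injective hl)⟩

theorem RankGE.zero (s : Set V) : RankGE K 0 s :=
  ⟨Fin.elim0, fun i => i.elim0, linearIndependent_empty_type⟩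

theorem rankGE_of_le_finrank {k : ℕ} {s : Set V} 
    (h : k ≤ Module.finrank K (Submodule.span K s)) : RankGE K k s := by
  obtain ⟨f, hf⟩ := exists_linearIndependent_of_le_finrank h
  refine RankGE.of_span (s := Set.range (fun i => (f i : V))) ⟨fun i => f i, fun i => ⟨i, rfl⟩, ?_⟩ ?_
  · exact hf.map' (Submodule.subtype _) (Submodule.ker_subtype _)
  · rintro _ ⟨i, rfl⟩; exact (f i).2

theorem RankGE.of_map {k : ℕ} {s : Set V} (f : V →ₗ[K] V') (h : RankGE K k (f '' s)) :
    RankGE K k s := by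
  obtain ⟨w, hw, hi⟩ := h
  choose v hv hfv using hw
  refine ⟨v, hv, LinearIndependent.of_comp f ?_⟩
  convert hi using 1
  ext i; exact hfv i

theorem RankGE.map {k : ℕ} {s : Set V} (f : V →ₗ[K] V') (hf : Function.Injective f)
    (h : RankGE K k s) : RankGE K k (f '' s) := by
  obtain ⟨w, hw, hi⟩ := h
  exact ⟨fun i => f (w i), fun i => ⟨_, hw i, rfl⟩, hi.map' f (LinearMap.ker_eq_bot.2 hf)⟩

/-- kernel part plus image part -/
theorem RankGE.add {a b : ℕ} {s : Set V} (f : V →ₗ[K] V') {u : Set V}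
    (hu : u ⊆ Submodule.span K s) (hk : ∀ x ∈ u, f x = 0) (ha : RankGE K a u)
    (hb : RankGE K b (f '' s)) : RankGE K (a + b) s := by
  obtain ⟨w, hw, hi⟩ := ha
  obtain ⟨w', hw', hi'⟩ := hb
  choose v hv hfv using hw'
  have hli : LinearIndependent K (Sum.elim w v) := by
    rw [linearIndependent_sum]
    refine ⟨hi, ?_, ?_⟩
    · refine LinearIndependent.of_comp f ?_
      have : (f ∘ (Sum.elim w v ∘ Sum.inr)) = w' := funext hfv
      rw [this]; exact hi'
    · rw [Submodule.disjoint_def]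
      intro x hx hx'
      have h1 : f x = 0 := by
        have : Submodule.span K (Set.range w) ≤ LinearMap.ker f := by
          rw [Submodule.span_le]; rintro _ ⟨i, rfl⟩; exact hk _ (hw i)
        exact this hx
      rw [Sum.elim_comp_inr, Finsupp.mem_span_range_iff_exists_finsupp] at hx'
      obtain ⟨c, rfl⟩ := hx'
      have : c = 0 := by
        rw [linearIndependent_iff] at hi'
        apply hi'
        rw [Finsupp.linearCombination_apply, ← h1, map_finsuppSum]
        apply Finsupp.sum_congr
        intro i _
        rw [map_smul, hfv]
      simp [this]
  refine RankGE.of_span (s := Set.range (Sum.elim w v ∘ finSumFinEquiv.symm)) 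
    ⟨_, fun i => ⟨i, rfl⟩, hli.comp _ finSumFinEquiv.symm.injective⟩ ?_
  rintro _ ⟨i, rfl⟩
  rcases h : finSumFinEquiv.symm i with j | j
  · simp only [Function.comp, h, Sum.elim_inl]; exact hu (hw j)
  · simp only [Function.comp, h, Sum.elim_inr]; exact Submodule.subset_span (hv j)

/-- greedy addition of `k` elements of `t`. -/
theorem RankGE.greedy {a b : ℕ} {s t : Set V} (ha : RankGE K a s) (hb : RankGE K b (s ∪ t))
    (k : ℕ) (hk : a + k ≤ b) (ht : t.Nonempty) :
    ∃ w : Fin k → V, (∀ i, w i ∈ t) ∧ RankGE K (a + k) (s ∪ Set.range w) := by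
  induction k with
  | zero => exact ⟨Fin.elim0, fun i => i.elim0, ha.mono Set.subset_union_left⟩
  | succ k ih =>
    obtain ⟨w, hw, hr⟩ := ih (by omega)
    by_cases hx : ∃ x ∈ t, RankGE K (a + (k+1)) (s ∪ Set.range (Fin.cons (α := fun _ => V) x w))
    · obtain ⟨x, hx, h⟩ := hx
      refine ⟨Fin.cons x w, ?_, h⟩
      intro i
      refine Fin.cases ?_ ?_ i
      · simpa using hx
      · simpa using hw
    · exfalso
      push Not at hx
      obtain ⟨u, hu, hi⟩ := hr
      have key : s ∪ t ⊆ Submodule.span K (Set.range u) := by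
        intro y hy
        by_contra hy'
        have hli : LinearIndependent K (Fin.cons (α := fun _ => V) y u) := by
          rw [linearIndependent_finCons]; exact ⟨hi, hy'⟩
        have hmem : ∃ x ∈ t, y ∈ s ∪ Set.range (Fin.cons (α := fun _ => V) x w) := by
          rcases hy with hy | hy
          · obtain ⟨x, hx⟩ := ht
            exact ⟨x, hx, Or.inl hy⟩
          · exact ⟨y, hy, Or.inr ⟨0, rfl⟩⟩
        obtain ⟨x, hxt, hys⟩ := hmem
        apply hx x hxt
        refine ⟨Fin.cons y u, ?_, hli⟩
        intro i
        refine Fin.cases ?_ ?_ i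
        · simpa using hys
        · intro j
          rcases hu j with h | ⟨l, h⟩
          · left; simpa using h
          · right; exact ⟨l.succ, by simpa using h⟩
      have : FiniteDimensional K (Submodule.span K (Set.range u)) :=
        FiniteDimensional.span_of_finite K (Set.finite_range u)
      have := hb.le_finrank (Submodule.span K (Set.range u)) key
      have h2 := finrank_range_le_card (R := K) u
      simp only [Fintype.card_fin, Set.finrank] at h2
      omega

/-- if the rank is maximal in a finite-dimensional space, we get everything -/
theorem RankGE.span_eq {k : ℕ} {s : Set V} (h : RankGE K k s) (W : Submodule K V)
    [FiniteDimensional K W] (hs : s ⊆ W) (hk : Module.finrank K W ≤ k) :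
    Submodule.span K s = W := by
  have hle : Submodule.span K s ≤ W := Submodule.span_le.2 hs
  have : FiniteDimensional K (Submodule.span K s) := Submodule.finiteDimensional_of_le hle
  apply Submodule.eq_of_le_of_finrank_le hle
  exact hk.trans (h.le_finrank _ Submodule.subset_span)

end rank

end AH

set_option linter.unusedSectionVars false
set_option linter.style.haveILetI false

namespace AH
open MvPolynomial

def PC {A : Type*} [CommRing A] [Algebra ℂ A] (f : ℂ → A) : Prop :=
  ∃ P : Polynomial A, ∀ t, f t = P.eval (algebraMap ℂ A t)

section PC
variable {A A' : Type*} [CommRing A] [Algebra ℂ A] [CommRing A'] [Algebra ℂ A']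

theorem PC.const (a : A) : PC (fun _ => a) := ⟨Polynomial.C a, fun t => by simp⟩
theorem PC.add {f g : ℂ → A} (hf : PC f) (hg : PC g) : PC (fun t => f t + g t) := by
  obtain ⟨P, hP⟩ := hf; obtain ⟨Q, hQ⟩ := hg
  exact ⟨P + Q, fun t => by beta_reduce; rw [Polynomial.eval_add, hP, hQ]⟩
theorem PC.sub {f g : ℂ → A} (hf : PC f) (hg : PC g) : PC (fun t => f t - g t) := by
  obtain ⟨P, hP⟩ := hf; obtain ⟨Q, hQ⟩ := hg
  exact ⟨P - Q, fun t => by beta_reduce; rw [Polynomial.eval_sub, hP, hQ]⟩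
theorem PC.mul {f g : ℂ → A} (hf : PC f) (hg : PC g) : PC (fun t => f t * g t) := by
  obtain ⟨P, hP⟩ := hf; obtain ⟨Q, hQ⟩ := hg
  exact ⟨P * Q, fun t => by beta_reduce; rw [Polynomial.eval_mul, hP, hQ]⟩
theorem PC.pow {f : ℂ → A} (hf : PC f) (n : ℕ) : PC (fun t => f t ^ n) := by
  obtain ⟨P, hP⟩ := hf
  exact ⟨P ^ n, fun t => by beta_reduce; rw [Polynomial.eval_pow, hP]⟩
theorem PC.sum {I : Type*} (s : Finset I) {f : I → ℂ → A} (hf : ∀ i, PC (f i)) :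
    PC (fun t => ∑ i ∈ s, f i t) := by
  choose P hP using hf
  exact ⟨∑ i ∈ s, P i, fun t => by
    rw [Polynomial.eval_finsetSum]; exact Finset.sum_congr rfl fun i _ => hP i t⟩
theorem PC.prod {I : Type*} (s : Finset I) {f : I → ℂ → A} (hf : ∀ i, PC (f i)) :
    PC (fun t => ∏ i ∈ s, f i t) := by
  choose P hP using hf
  exact ⟨∏ i ∈ s, P i, fun t => by
    rw [Polynomial.eval_prod]; exact Finset.prod_congr rfl fun i _ => hP i t⟩
theorem PC.id : PC (fun t : ℂ => t) := ⟨Polynomial.X, fun t => by simp⟩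

theorem PC.map {f : ℂ → A} (hf : PC f) (φ : A →ₗ[ℂ] A') : PC (fun t => φ (f t)) := by
  obtain ⟨P, hP⟩ := hf
  refine ⟨∑ k ∈ Finset.range (P.natDegree + 1), Polynomial.monomial k (φ (P.coeff k)), ?_⟩
  intro t
  beta_reduce
  rw [hP, Polynomial.eval_eq_sum_range, map_sum, Polynomial.eval_finsetSum]
  refine Finset.sum_congr rfl fun k _ => ?_
  rw [Polynomial.eval_monomial, ← map_pow, ← map_pow, mul_comm, ← Algebra.smul_def, map_smul,
    mul_comm, ← Algebra.smul_def]

theorem PC.finite {f : ℂ → ℂ} (hf : PC f) {t0 : ℂ} (h : f t0 ≠ 0) : {t | f t = 0}.Finite := by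
  obtain ⟨P, hP⟩ := hf
  have : P ≠ 0 := by rintro rfl; apply h; simp [hP]
  refine (Polynomial.finite_setOfPred_isRoot this).subset ?_
  intro t ht
  simpa [hP] using ht

theorem PC.det {k : ℕ} {M : ℂ → Matrix (Fin k) (Fin k) ℂ} (hM : ∀ i j, PC (fun t => M t i j)) :
    PC (fun t => (M t).det) := by
  simp only [Matrix.det_apply']
  refine PC.sum _ fun σ => ?_
  exact (PC.const _).mul (PC.prod _ fun i => hM _ _)

theorem PC.linInd {k : ℕ} {v : Fin k → ℂ → A} (hv : ∀ i, PC (v i)) {t0 : ℂ}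
    (h : LinearIndependent ℂ (fun i => v i t0)) :
    {t | ¬ LinearIndependent ℂ (fun i => v i t)}.Finite := by
  have hinj := h.fintypeLinearCombination_injective
  obtain ⟨g, hg⟩ := LinearMap.exists_leftInverse_of_injective _ (LinearMap.ker_eq_bot.2 hinj)
  have hM : ∀ i j, PC (fun t => (Matrix.of (fun i j => g (v i t) j)) i j) := by
    intro i j
    exact (hv i).map ((LinearMap.proj j).comp g)
  have hg' : ∀ i, g (v i t0) = Pi.single i 1 := by
    intro i
    have := LinearMap.congr_fun hg (Pi.single i 1)
    simpa [Fintype.linearCombination_apply_single] using this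
  have hdet := PC.det hM
  have h0 : (Matrix.of (fun i j => g (v i t0) j)).det ≠ 0 := by
    have : (Matrix.of (fun i j => g (v i t0) j)) = 1 := by
      ext i j
      simp [hg', Matrix.one_apply, Pi.single_apply, eq_comm]
    rw [this]; simp
  refine (hdet.finite h0).subset ?_
  intro t ht
  by_contra hne
  apply ht
  have : IsUnit (Matrix.of (fun i j => g (v i t) j)) := by
    rw [Matrix.isUnit_iff_isUnit_det]; exact isUnit_iff_ne_zero.2 hne
  have := Matrix.linearIndependent_rows_iff_isUnit.2 this
  exact LinearIndependent.of_comp g this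
end PC

section lf
variable {ι : Type} [Fintype ι]

/-- linear form -/
noncomputable def lf (a : ι → ℂ) : MvPolynomial ι ℂ := ∑ i, C (a i) * X i

theorem lf_add (a b : ι → ℂ) : lf (a + b) = lf a + lf b := by
  simp [lf, add_mul, Finset.sum_add_distrib]
theorem lf_smul (c : ℂ) (a : ι → ℂ) : lf (c • a) = c • lf a := by
  simp [lf, Finset.smul_sum, MvPolynomial.smul_eq_C_mul, mul_assoc]
/-- linear form, as linear map -/
noncomputable def lfL : (ι → ℂ) →ₗ[ℂ] MvPolynomial ι ℂ where
  toFun := lf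
  map_add' := lf_add
  map_smul' := lf_smul
theorem lf_zero : lf (0 : ι → ℂ) = 0 := map_zero lfL
theorem lf_sub (a b : ι → ℂ) : lf (a - b) = lf a - lf b := map_sub lfL a b
theorem lf_sum {I : Type*} (s : Finset I) (a : I → ι → ℂ) : lf (∑ i ∈ s, a i) = ∑ i ∈ s, lf (a i) :=
  map_sum lfL a s
theorem lf_single [DecidableEq ι] (i : ι) : lf (Pi.single i 1) = X i := by
  rw [lf, Finset.sum_eq_single i]
  · simp
  · intro j _ hj; simp [hj]
  · simp

theorem pderiv_lf [DecidableEq ι] (i : ι) (a : ι → ℂ) : pderiv i (lf a) = C (a i) := by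
  simp [lf, Derivation.leibniz, pderiv_X, Pi.single_apply]

abbrev BF (ι : Type) := LinearMap.BilinForm ℂ (ι → ℂ)

/-- nondegenerate on a subspace -/
def NDW (B : BF ι) (W : Submodule ℂ (ι → ℂ)) : Prop :=
  ∀ p ∈ W, (∀ w ∈ W, B p w = 0) → p = 0

def TanW (B : BF ι) (W : Submodule ℂ (ι → ℂ)) (d : ℕ) (p : ι → ℂ) : Set (MvPolynomial ι ℂ) :=
  {f | ∃ m ∈ W, B p m = 0 ∧ f = lf p ^ (d - 1) * lf m}

theorem lf_PC {c : ℂ → ι → ℂ} (hc : ∀ i, PC (fun t => c t i)) : PC (fun t => lf (c t)) := by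
  unfold lf
  refine PC.sum _ fun i => ?_
  exact ((hc i).map (Algebra.linearMap ℂ (MvPolynomial ι ℂ))).mul (PC.const _)

theorem lin_PC {c : ℂ → ι → ℂ} (hc : ∀ i, PC (fun t => c t i)) (φ : (ι → ℂ) →ₗ[ℂ] ℂ) :
    PC (fun t => φ (c t)) := by
  classical
  have h : ∀ t, φ (c t) = ∑ i, c t i * φ (Pi.single i 1) := by
    intro t
    have := LinearMap.pi_apply_eq_sum_univ φ (c t)
    rw [this]
    refine Finset.sum_congr rfl fun i _ => ?_
    rw [smul_eq_mul]
    congr 2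
    ext j; simp [Pi.single_apply, eq_comm]
  simp only [h]
  refine PC.sum _ fun i => ?_
  exact (hc i).mul (PC.const _)

variable {J : Type}
/-- polynomial curve of tuples -/
def PCT (c : ℂ → J → ι → ℂ) : Prop := ∀ j i, PC (fun t => c t j i)
/-- polynomial functions of tuples -/
def PF {A : Type*} [CommRing A] [Algebra ℂ A] (F : (J → ι → ℂ) → A) : Prop :=
  ∀ c : ℂ → J → ι → ℂ, PCT c → PC (fun t => F (c t))

def OpenC (X : Set (J → ι → ℂ)) (P : (J → ι → ℂ) → Prop) : Prop :=
  ∀ c : ℂ → J → ι → ℂ, PCT c → (∀ t, c t ∈ X) → ∀ t0, P (c t0) → {t | ¬ P (c t)}.Finite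

theorem OpenC.and {X : Set (J → ι → ℂ)} {P Q : (J → ι → ℂ) → Prop} (hP : OpenC X P)
    (hQ : OpenC X Q) : OpenC X (fun p => P p ∧ Q p) := by
  intro c hc hX t0 h0
  refine ((hP c hc hX t0 h0.1).union (hQ c hc hX t0 h0.2)).subset ?_
  intro t ht
  simp only [Set.mem_ofPred_eq, not_and_or] at ht
  exact ht

theorem OpenC.forall {K : Type*} [Finite K] {X : Set (J → ι → ℂ)} {P : K → (J → ι → ℂ) → Prop}
    (hP : ∀ k, OpenC X (P k)) : OpenC X (fun p => ∀ k, P k p) := by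
  intro c hc hX t0 h0
  refine (Set.finite_iUnion fun k => hP k c hc hX t0 (h0 k)).subset ?_
  intro t ht
  simpa using ht

theorem OpenC.ne {X : Set (J → ι → ℂ)} {F : (J → ι → ℂ) → ℂ} (hF : PF F) :
    OpenC X (fun p => F p ≠ 0) := by
  intro c hc _ t0 h0
  simpa using (hF c hc).finite h0

section PGen
variable {A A' : Type} [CommRing A] [Algebra ℂ A] [CommRing A'] [Algebra ℂ A']

def PGen (X : Set (J → ι → ℂ)) (S : (J → ι → ℂ) → Set A) : Prop :=
  ∃ (I : Type) (F : I → (J → ι → ℂ) → A), (∀ i, PF (F i)) ∧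
    ∀ p ∈ X, Submodule.span ℂ (S p) = Submodule.span ℂ (Set.range fun i => F i p)

theorem PGen.openC {X : Set (J → ι → ℂ)} {S : (J → ι → ℂ) → Set A} (h : PGen X S) (k : ℕ) :
    OpenC X (fun p => RankGE ℂ k (S p)) := by
  obtain ⟨I, F, hF, hS⟩ := h
  intro c hc hX t0 h0
  have h1 : RankGE ℂ k (Set.range fun i => F i (c t0)) := by
    refine h0.of_span ?_
    rw [← hS _ (hX t0)]; exact Submodule.subset_span
  obtain ⟨w, hw, hi⟩ := h1
  choose u hu using hw
  have h2 : LinearIndependent ℂ (fun i => F (u i) (c t0)) := by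
    have e : (fun i => F (u i) (c t0)) = w := funext hu
    rw [e]; exact hi
  refine (PC.linInd (fun i => hF (u i) c hc) h2).subset ?_
  intro t ht hli
  apply ht
  refine RankGE.of_span (s := Set.range fun i => F i (c t)) ⟨_, fun i => ⟨u i, rfl⟩, hli⟩ ?_
  rw [hS _ (hX t)]; exact Submodule.subset_span

theorem PGen.single (X : Set (J → ι → ℂ)) {F : (J → ι → ℂ) → A} (hF : PF F) :
    PGen X (fun p => {F p}) :=
  ⟨Unit, fun _ => F, fun _ => hF, fun p _ => by simp⟩

theorem PGen.iUnion {K : Type} {X : Set (J → ι → ℂ)} {S : K → (J → ι → ℂ) → Set A}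
    (h : ∀ k, PGen X (S k)) : PGen X (fun p => ⋃ k, S k p) := by
  choose I F hF hS using h
  refine ⟨Σ k, I k, fun i p => F i.1 i.2 p, fun i => hF _ _, ?_⟩
  intro p hp
  rw [Submodule.span_iUnion, Set.range_sigma_eq_iUnion_range, Submodule.span_iUnion]
  simp only [hS _ p hp]

theorem PGen.union {X : Set (J → ι → ℂ)} {S T : (J → ι → ℂ) → Set A}
    (h : PGen X S) (h' : PGen X T) : PGen X (fun p => S p ∪ T p) := by
  obtain ⟨I, F, hF, hS⟩ := h
  obtain ⟨I', F', hF', hS'⟩ := h'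
  refine ⟨I ⊕ I', Sum.elim F F', ?_, ?_⟩
  · rintro (i | i)
    · exact hF i
    · exact hF' i
  · intro p hp
    rw [Submodule.span_union, hS p hp, hS' p hp, ← Submodule.span_union]
    congr 1
    ext x; simp

theorem PGen.map {X : Set (J → ι → ℂ)} {S : (J → ι → ℂ) → Set A} (h : PGen X S)
    (φ : A →ₗ[ℂ] A') : PGen X (fun p => φ '' S p) := by
  obtain ⟨I, F, hF, hS⟩ := h
  refine ⟨I, fun i p => φ (F i p), fun i c hc => (hF i c hc).map φ, ?_⟩
  intro p hp
  rw [Submodule.span_image, hS p hp, ← Submodule.span_image]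
  congr 1
  ext x; simp

end PGen

theorem span_TanW (B : BF ι) (W : Submodule ℂ (ι → ℂ)) (hW : NDW B W) (d : ℕ) (hd : 2 ≤ d)
    (p : ι → ℂ) (hp : p ∈ W) :
    Submodule.span ℂ (TanW B W d p) = Submodule.span ℂ (Set.range fun w : W × W =>
      lf p ^ (d-1) * lf (B p w.1 • (w.2 : ι → ℂ) - B p w.2 • (w.1 : ι → ℂ))) := by
  apply le_antisymm
  · rw [Submodule.span_le]
    rintro _ ⟨m, hm, hpm, rfl⟩
    by_cases h : ∀ w ∈ W, B p w = 0
    · have := hW p hp h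
      subst this
      rw [lf_zero, zero_pow (by omega), zero_mul]
      exact Submodule.zero_mem _
    · push Not at h
      obtain ⟨w, hw, hne⟩ := h
      have : lf p ^ (d-1) * lf m = (B p w)⁻¹ • 
          (lf p ^ (d-1) * lf (B p w • m - B p m • w)) := by
        rw [hpm, zero_smul, sub_zero, lf_smul, mul_smul_comm, smul_smul, inv_mul_cancel₀ hne,
          one_smul]
      rw [this]
      apply Submodule.smul_mem
      exact Submodule.subset_span ⟨(⟨w, hw⟩, ⟨m, hm⟩), rfl⟩
  · rw [Submodule.span_le]
    rintro _ ⟨⟨w, w'⟩, rfl⟩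
    refine Submodule.subset_span ⟨_, ?_, ?_, rfl⟩
    · exact W.sub_mem (W.smul_mem _ w'.2) (W.smul_mem _ w.2)
    · simp [mul_comm]

theorem PGen.tan (X : Set (J → ι → ℂ)) (B : BF ι) (W : Submodule ℂ (ι → ℂ)) (hW : NDW B W)
    (d : ℕ) (hd : 2 ≤ d) (j : J) (hX : ∀ p ∈ X, p j ∈ W) :
    PGen X (fun p => TanW B W d (p j)) := by
  refine ⟨W × W, fun w p => lf (p j) ^ (d-1) * 
    lf (B (p j) w.1 • (w.2 : ι → ℂ) - B (p j) w.2 • (w.1 : ι → ℂ)), ?_, ?_⟩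
  · intro w c hc
    refine ((lf_PC (hc j)).pow _).mul (lf_PC fun i => ?_)
    simp only [Pi.sub_apply, Pi.smul_apply, smul_eq_mul]
    have h : ∀ w : W, PC (fun t => B (c t j) w) := fun w => lin_PC (hc j) (B.flip w)
    exact ((h _).mul (PC.const _)).sub ((h _).mul (PC.const _))
  · intro p hp
    exact span_TanW B W hW d hd (p j) (hX p hp)

/-- connecting two isotropic vectors -/
theorem conn (B : BF ι) (hB : ∀ x y, B x y = B y x) (W : Submodule ℂ (ι → ℂ)) (hW : NDW B W)
    (h3 : 3 ≤ Module.finrank ℂ W) (p p' : ι → ℂ) (hp : p ∈ W) (hp' : p' ∈ W) (hpp : B p p = 0)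
    (hpp' : B p' p' = 0) :
    ∃ c : ℂ → ι → ℂ, (∀ i, PC (fun t => c t i)) ∧ (∀ t, c t ∈ W ∧ B (c t) (c t) = 0) ∧
      c 0 = p ∧ c 1 = p' := by

  have hz : ∃ z ∈ W, B p z = 0 ∧ B p' z = 0 ∧ B z z = - 2 * B p p' := by
    by_cases h0 : B p p' = 0
    · exact ⟨0, W.zero_mem, by simp, by simp, by simp [h0]⟩
    have : ∃ z ∈ W, B p z = 0 ∧ B p' z = 0 ∧ B z z ≠ 0 := by
      by_contra hcon
      push Not at hcon
      have hzero : ∀ z ∈ W, B p z = 0 → B p' z = 0 → z = 0 := by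
        intro z hz h1 h2
        apply hW z hz
        intro y hy
        -- decompose y
        set y' := y - (B p' y / B p p') • p - (B p y / B p p') • p' with hy'
        have hy'W : y' ∈ W := W.sub_mem (W.sub_mem hy (W.smul_mem _ hp)) (W.smul_mem _ hp')
        have hcc : B p' p = B p p' := hB _ _
        have e1 : B p y' = 0 := by
          simp only [hy', map_sub, map_smul, smul_eq_mul, hpp]; field_simp; ring
        have e2 : B p' y' = 0 := by
          simp only [hy', map_sub, map_smul, smul_eq_mul, hpp', hcc]; field_simp; ring
        have q1 := hcon (z + y') (W.add_mem hz hy'W) (by simp [h1, e1]) (by simp [h2, e2])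
        have q2 := hcon z hz h1 h2
        have q3 := hcon y' hy'W e1 e2
        have q4 : B z y' = 0 := by
          have h4 := hB y' z
          simp only [map_add, LinearMap.add_apply, q2, q3] at q1
          rw [h4] at q1
          linear_combination q1 / 2
        have : y = y' + (B p' y / B p p') • p + (B p y / B p p') • p' := by rw [hy']; abel
        rw [this]
        simp only [map_add, map_smul, smul_eq_mul, q4, hB z p, hB z p', h1, h2]; ring
      -- injective map W → ℂ × ℂ
      let f : W →ₗ[ℂ] ℂ × ℂ := ((B p).comp W.subtype).prod ((B p').comp W.subtype)
      have hf : Function.Injective f := by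
        rw [← LinearMap.ker_eq_bot, LinearMap.ker_eq_bot']
        intro z hz
        have := Prod.ext_iff.1 hz
        ext1
        exact hzero z z.2 this.1 this.2
      have := LinearMap.finrank_le_finrank_of_injective hf
      simp at this
      omega
    obtain ⟨z, hz, h1, h2, h3⟩ := this
    obtain ⟨s, hs⟩ := IsAlgClosed.exists_pow_nat_eq (-2 * B p p' / B z z) (n := 2) (by norm_num)
    refine ⟨s • z, W.smul_mem _ hz, by simp [h1], by simp [h2], ?_⟩
    simp only [map_smul, LinearMap.smul_apply, smul_eq_mul]
    rw [← mul_assoc, ← pow_two, hs, div_mul_cancel₀ _ h3]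
  obtain ⟨z, hzW, h1, h2, h4⟩ := hz
  have hcc : B p' p = B p p' := hB _ _
  refine ⟨fun t => ((1 - t) ^ 2) • p + (t ^ 2) • p' + (t * (1 - t)) • z, ?_, ?_, ?_, ?_⟩
  · intro i
    simp only [Pi.add_apply, Pi.smul_apply, smul_eq_mul]
    have h1 : PC (fun t : ℂ => 1 - t) := (PC.const 1).sub PC.id
    exact (((h1.pow 2).mul (PC.const _)).add ((PC.id.pow 2).mul (PC.const _))).add 
      ((PC.id.mul h1).mul (PC.const _))
  · intro t
    refine ⟨W.add_mem (W.add_mem (W.smul_mem _ hp) (W.smul_mem _ hp')) (W.smul_mem _ hzW), ?_⟩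
    simp only [map_add, map_smul, LinearMap.add_apply, LinearMap.smul_apply, smul_eq_mul, hpp, hpp',
      hcc, hB z p, hB z p', h1, h2, h4]
    ring
  · simp
  · simp

/-- tuples of isotropic vectors in given subspaces -/
def XW (B : BF ι) (W : J → Submodule ℂ (ι → ℂ)) : Set (J → ι → ℂ) :=
  {p | ∀ j, p j ∈ W j ∧ B (p j) (p j) = 0}

theorem exists_and (B : BF ι) (hB : ∀ x y, B x y = B y x) (W : J → Submodule ℂ (ι → ℂ))
    (hW : ∀ j, NDW B (W j)) (h3 : ∀ j, 3 ≤ Module.finrank ℂ (W j))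
    {P Q : (J → ι → ℂ) → Prop} (hP : OpenC (XW B W) P) (hQ : OpenC (XW B W) Q)
    (eP : ∃ p ∈ XW B W, P p) (eQ : ∃ p ∈ XW B W, Q p) : ∃ p ∈ XW B W, P p ∧ Q p := by
  obtain ⟨p, hp, hpP⟩ := eP
  obtain ⟨q, hq, hqQ⟩ := eQ
  have := fun j => conn B hB (W j) (hW j) (h3 j) (p j) (q j) (hp j).1 (hq j).1 (hp j).2 (hq j).2
  choose c hc hX h0 h1 using this
  set c' : ℂ → J → ι → ℂ := fun t j => c j t
  have hX' : ∀ t, c' t ∈ XW B W := fun t j => hX j t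
  have hc' : PCT c' := fun j i => hc j i
  have e0 : c' 0 = p := funext h0
  have e1 : c' 1 = q := funext h1
  have f1 := hP c' hc' hX' 0 (by rw [e0]; exact hpP)
  have f2 := hQ c' hc' hX' 1 (by rw [e1]; exact hqQ)
  obtain ⟨t, ht⟩ := (f1.union f2).exists_notMem
  simp only [Set.mem_union, Set.mem_ofPred_eq, not_or, not_not] at ht
  exact ⟨c' t, hX' t, ht⟩

theorem exists_forall {K : Type*} [Finite K] (B : BF ι) (hB : ∀ x y, B x y = B y x)
    (W : J → Submodule ℂ (ι → ℂ))
    (hW : ∀ j, NDW B (W j)) (h3 : ∀ j, 3 ≤ Module.finrank ℂ (W j))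
    {P : K → (J → ι → ℂ) → Prop} (hP : ∀ k, OpenC (XW B W) (P k))
    (eP : ∀ k, ∃ p ∈ XW B W, P k p) : ∃ p ∈ XW B W, ∀ k, P k p := by
  classical
  have := Fintype.ofFinite K
  have key : ∀ s : Finset K, ∃ p ∈ XW B W, ∀ k : s, P k p := by
    intro s
    induction s using Finset.induction_on with
    | empty => exact ⟨0, fun j => ⟨(W j).zero_mem, by simp⟩, fun k => absurd k.2 (Finset.notMem_empty _)⟩
    | insert a s ha ih =>
      obtain ⟨p, hp, h1, h2⟩ := exists_and B hB W hW h3 (hP a) 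
        (OpenC.forall fun k : s => hP k) (eP a) ih
      refine ⟨p, hp, ?_⟩
      rintro ⟨k, hk⟩
      rcases Finset.mem_insert.1 hk with rfl | hk
      · exact h1
      · exact h2 ⟨k, hk⟩
  obtain ⟨p, hp, h⟩ := key Finset.univ
  exact ⟨p, hp, fun k => h ⟨k, Finset.mem_univ k⟩⟩

end lf
end AH

set_option linter.unusedSectionVars false
set_option linter.style.haveILetI false

namespace AH
open MvPolynomial

section
variable {ι κ : Type} [Fintype ι] [Fintype κ]

/-- the standard form -/
noncomputable def dotB (ι : Type) [Fintype ι] : BF ι :=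
  LinearMap.mk₂ ℂ (fun x y => ∑ i, x i * y i)
    (fun x y z => by simp [add_mul, Finset.sum_add_distrib])
    (fun c x y => by simp [mul_assoc, Finset.mul_sum])
    (fun x y z => by simp [mul_add, Finset.sum_add_distrib])
    (fun c x y => by simp [mul_left_comm, Finset.mul_sum])

theorem dotB_apply (x y : ι → ℂ) : dotB ι x y = ∑ i, x i * y i := rfl
theorem dotB_symm (x y : ι → ℂ) : dotB ι x y = dotB ι y x := by
  simp [dotB_apply, mul_comm]
theorem dotB_single [DecidableEq ι] (x : ι → ℂ) (i : ι) : dotB ι x (Pi.single i 1) = x i := by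
  simp [dotB_apply, Pi.single_apply]
theorem dotB_nd : NDW (dotB ι) ⊤ := by
  classical
  intro p _ h
  ext i
  rw [← dotB_single p i, h _ trivial]; rfl

def Good (B : BF ι) (d r k : ℕ) : Prop :=
  ∃ p : Fin r → ι → ℂ, (∀ j, B (p j) (p j) = 0) ∧ RankGE ℂ k (⋃ j, TanW B ⊤ d (p j))

theorem Good.of_fintype {J : Type} [Fintype J] {B : BF ι} {d r k : ℕ} (hJ : Fintype.card J = r)
    (p : J → ι → ℂ) (hp : ∀ j, B (p j) (p j) = 0)
    (hk : RankGE ℂ k (⋃ j, TanW B ⊤ d (p j))) : Good B d r k := by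
  obtain ⟨e⟩ : Nonempty (J ≃ Fin r) := ⟨Fintype.equivFinOfCardEq hJ⟩
  refine ⟨fun j => p (e.symm j), fun j => hp _, hk.mono ?_⟩
  intro x hx
  simp only [Set.mem_iUnion] at hx ⊢
  obtain ⟨j, hj⟩ := hx
  exact ⟨e j, by simpa using hj⟩

/-- linear substitution -/
noncomputable def sub (g : (ι → ℂ) →ₗ[ℂ] (κ → ℂ)) : MvPolynomial ι ℂ →ₐ[ℂ] MvPolynomial κ ℂ := by
  classical
  exact aeval (fun i => lf (g (Pi.single i 1)))

theorem sub_lf (g : (ι → ℂ) →ₗ[ℂ] (κ → ℂ)) (a : ι → ℂ) : sub g (lf a) = lf (g a) := by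
  classical
  have : a = ∑ i, a i • Pi.single i (1:ℂ) := by
    ext j; simp [Pi.single_apply]
  conv_rhs => rw [this]
  rw [map_sum, lf_sum, lf, map_sum]
  refine Finset.sum_congr rfl fun i _ => ?_
  rw [map_smul, lf_smul, map_mul, smul_eq_C_mul]
  congr 1
  · exact (sub g).commutes (a i)
  · simp [sub]

theorem sub_inj (g : (ι → ℂ) →ₗ[ℂ] (κ → ℂ)) (hg : Function.Injective g) :
    Function.Injective (sub g) := by
  classical
  obtain ⟨g', hg'⟩ := LinearMap.exists_leftInverse_of_injective g (LinearMap.ker_eq_bot.2 hg)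
  have : (sub g').comp (sub g) = AlgHom.id ℂ _ := by
    ext i : 1
    rw [AlgHom.comp_apply, ← lf_single, sub_lf, sub_lf, ← LinearMap.comp_apply, hg']
    rfl
  intro x y hxy
  have h2 := congrArg (sub g') hxy
  rwa [← AlgHom.comp_apply, ← AlgHom.comp_apply, this] at h2

theorem sub_TanW {B : BF ι} {B' : BF κ} (g : (ι → ℂ) →ₗ[ℂ] (κ → ℂ)) 
    (hB : ∀ x y, B' (g x) (g y) = B x y) (W : Submodule ℂ (ι → ℂ)) (d : ℕ) (p : ι → ℂ) :
    sub g '' TanW B W d p = TanW B' (W.map g) d (g p) := by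
  ext f
  constructor
  · rintro ⟨_, ⟨m, hm, h, rfl⟩, rfl⟩
    exact ⟨g m, ⟨m, hm, rfl⟩, by rw [hB, h], by rw [map_mul, map_pow, sub_lf, sub_lf]⟩
  · rintro ⟨_, ⟨m, hm, rfl⟩, h, rfl⟩
    exact ⟨_, ⟨m, hm, by rw [← hB, h], rfl⟩, by rw [map_mul, map_pow, sub_lf, sub_lf]⟩

/-- transport of ranks for tuples -/
theorem rank_transport {J : Type} {B : BF ι} {B' : BF κ} (g : (ι → ℂ) →ₗ[ℂ] (κ → ℂ))
    (hg : Function.Injective g)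
    (hB : ∀ x y, B' (g x) (g y) = B x y) (W : Submodule ℂ (ι → ℂ)) (d k : ℕ) (p : J → ι → ℂ)
    (h : RankGE ℂ k (⋃ j, TanW B W d (p j))) :
    RankGE ℂ k (⋃ j, TanW B' (W.map g) d (g (p j))) := by
  have := h.map (sub g).toLinearMap (sub_inj g hg)
  have e : ∀ j, (sub g).toLinearMap '' TanW B W d (p j) = TanW B' (W.map g) d (g (p j)) :=
    fun j => sub_TanW g hB W d (p j)
  simpa only [Set.image_iUnion, e] using this

theorem Good.transport {B : BF ι} {B' : BF κ} (g : (ι → ℂ) ≃ₗ[ℂ] (κ → ℂ))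
    (hB : ∀ x y, B' (g x) (g y) = B x y) {d r k : ℕ} (h : Good B d r k) : Good B' d r k := by
  obtain ⟨p, hp, hr⟩ := h
  refine ⟨fun j => g (p j), fun j => by rw [hB, hp], ?_⟩
  have := rank_transport (B' := B') g.toLinearMap g.injective hB ⊤ d k p hr
  have e : (⊤ : Submodule ℂ (ι → ℂ)).map g.toLinearMap = ⊤ := by simp
  rw [e] at this
  exact this

theorem exists_iso (B : BF ι) (hB : ∀ x y, B x y = B y x) (hnd : NDW B ⊤) {N : ℕ}
    (hN : Fintype.card ι = N) :
    ∃ g : (ι → ℂ) ≃ₗ[ℂ] (Fin N → ℂ), ∀ x y, dotB (Fin N) (g x) (g y) = B x y := by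
  have hfr : Module.finrank ℂ (ι → ℂ) = N := by simp [hN]
  have h1 : (QuadraticMap.associated (R := ℂ) (LinearMap.BilinMap.toQuadraticMap B)) = B :=
    QuadraticMap.associated_left_inverse ℂ hB
  have h2 := QuadraticForm.equivalent_weightedSumSquares_of_isAlgClosed
    (LinearMap.BilinMap.toQuadraticMap B) (by
      rw [h1]
      intro x hx
      exact hnd x trivial fun w _ => hx w)
  rw [hfr] at h2
  obtain ⟨g⟩ := h2
  refine ⟨g.toLinearEquiv, ?_⟩
  have hq : ∀ x, dotB (Fin N) (g.toLinearEquiv x) (g.toLinearEquiv x) = B x x := by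
    intro x
    have := g.map_app x
    rw [QuadraticMap.weightedSumSquares_apply] at this
    simpa [dotB_apply] using this
  intro x y
  have h3 := hq (x + y)
  simp only [map_add, LinearMap.add_apply, hq] at h3
  rw [dotB_symm (g.toLinearEquiv y), hB y x] at h3
  linear_combination h3 / 2

theorem Good.to_std {B : BF ι} (hB : ∀ x y, B x y = B y x) (hnd : NDW B ⊤) {N : ℕ}
    (hN : Fintype.card ι = N) {d r k : ℕ} (h : Good B d r k) : Good (dotB (Fin N)) d r k := by
  obtain ⟨g, hg⟩ := exists_iso B hB hnd hN
  exact h.transport g hg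

theorem pderiv_pow_lf [DecidableEq ι] (i : ι) (p : ι → ℂ) (k : ℕ) :
    pderiv i (lf p ^ k) = (k * p i) • lf p ^ (k - 1) := by
  rw [pderiv_pow, pderiv_lf, smul_eq_C_mul]
  simp; ring

theorem pderiv_pow_mul_lf [DecidableEq ι] (i : ι) (p m : ι → ℂ) (k : ℕ) :
    pderiv i (lf p ^ k * lf m) = (k * p i) • (lf p ^ (k - 1) * lf m) + m i • lf p ^ k := by
  rw [pderiv_mul, pderiv_lf, pderiv_pow_lf, smul_mul_assoc, mul_comm _ (C (m i)), ← smul_eq_C_mul]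

theorem lf_hom (p : ι → ℂ) : (lf p).IsHomogeneous 1 := by
  unfold lf
  apply IsHomogeneous.sum
  intro i _
  simpa using (isHomogeneous_C ι (p i)).mul (isHomogeneous_X ℂ i)

/-- Laplacian -/
noncomputable def lapl (ι : Type) [Fintype ι] : MvPolynomial ι ℂ →ₗ[ℂ] MvPolynomial ι ℂ :=
  ∑ i, (pderiv i).toLinearMap ∘ₗ (pderiv i).toLinearMap

theorem lapl_apply (f : MvPolynomial ι ℂ) : lapl ι f = ∑ i, pderiv i (pderiv i f) := by
  simp [lapl]

/-- harmonic polynomials -/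
noncomputable def Harm (ι : Type) [Fintype ι] (d : ℕ) : Submodule ℂ (MvPolynomial ι ℂ) :=
  homogeneousSubmodule ι ℂ d ⊓ LinearMap.ker (lapl ι)

theorem mem_Harm {d : ℕ} {f : MvPolynomial ι ℂ} :
    f ∈ Harm ι d ↔ f.IsHomogeneous d ∧ lapl ι f = 0 := by
  simp [Harm]

theorem lapl_pow_mul (p m : ι → ℂ) (k : ℕ) (hp : dotB ι p p = 0) (hm : dotB ι p m = 0) :
    lapl ι (lf p ^ k * lf m) = 0 := by
  classical
  rw [lapl_apply]
  have : ∀ i, pderiv i (pderiv i (lf p ^ k * lf m)) = 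
      (p i * p i) • ((k * (k - 1 : ℕ) : ℂ) • (lf p ^ (k - 1 - 1) * lf m)) + 
      (p i * m i) • ((2 * k : ℂ) • lf p ^ (k - 1)) := by
    intro i
    rw [pderiv_pow_mul_lf, map_add, Derivation.map_smul, Derivation.map_smul, pderiv_pow_mul_lf,
      pderiv_pow_lf]
    simp only [smul_add, smul_smul]
    rw [add_assoc, ← add_smul]
    congr 2 <;> ring
  simp only [this, Finset.sum_add_distrib, ← Finset.sum_smul]
  rw [dotB_apply] at hp hm
  rw [hp, hm]; simp

theorem TanW_Harm {d : ℕ} (hd : 1 ≤ d) (W : Submodule ℂ (ι → ℂ)) (p : ι → ℂ)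
    (hp : dotB ι p p = 0) : TanW (dotB ι) W d p ⊆ Harm ι d := by
  rintro _ ⟨m, _, h, rfl⟩
  rw [SetLike.mem_coe, mem_Harm]
  refine ⟨?_, lapl_pow_mul p m _ hp h⟩
  have := ((lf_hom p).pow (d-1)).mul (lf_hom m)
  convert this using 1; omega

theorem pow_Harm {d : ℕ} (hd : 1 ≤ d) (p : ι → ℂ)
    (hp : dotB ι p p = 0) : lf p ^ d ∈ Harm ι d := by
  apply TanW_Harm hd ⊤ p hp
  exact ⟨p, trivial, hp, by rw [← pow_succ]; congr 1; omega⟩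

end

/-- dimension of harmonic forms of degree `d` in `n+1` variables -/
def hh : ℕ → ℕ → ℕ
  | 0, d => if d ≤ 1 then 1 else 0
  | _ + 1, 0 => 1
  | n + 1, d + 1 => hh n (d + 1) + hh (n + 1) d

theorem hh_choose (n d : ℕ) : hh n (d + 2) + (n + d).choose n = (n + d + 2).choose n := by
  induction n generalizing d with
  | zero => simp [hh]
  | succ n ih =>
    induction d with
    | zero =>
      have h1 := ih 0
      have : hh (n+1) 1 = n + 2 := by
        clear ih h1
        induction n with
        | zero => simp [hh]
        | succ n ih => rw [hh, ih]; cases n <;> simp [hh]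
      have h2 : hh (n+1) 2 = hh n 2 + hh (n+1) 1 := by rw [hh]
      have h3 : (n+1+0+2).choose (n+1) = (n+2).choose n + (n+2).choose (n+1) :=
        Nat.choose_succ_succ (n+2) n
      have h4 : (n+2).choose (n+1) = n + 2 := Nat.choose_succ_self_right (n+1)
      rw [zero_add, h2, h3, h4, this]
      simp only [Nat.add_zero, Nat.choose_self, zero_add] at h1 ⊢
      omega
    | succ d ihd =>
      have h1 := ih (d+1)
      rw [show d + 1 + 2 = (d + 2) + 1 from rfl, hh]
      have e1 : (n + 1 + (d+1) ).choose (n+1) = (n + (d + 1)).choose n + (n+1+d).choose (n+1) := by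
        rw [show n + 1 + (d+1) = (n + (d+1)) + 1 by ring, Nat.choose_succ_succ]; congr 2; ring
      have e2 : (n + 1 + (d+1) + 2).choose (n+1) = (n + (d + 1) + 2).choose n + (n+1+d+2).choose (n+1) := by
        rw [show n + 1 + (d+1) + 2 = (n + (d+1) + 2) + 1 by ring, Nat.choose_succ_succ]; congr 2; ring
      rw [e1, e2]
      rw [show d + 2 + 1 = d + 1 + 2 by ring]
      omega

theorem vars_of_pderiv {n : ℕ} (f : MvPolynomial (Fin (n+1)) ℂ) (h : pderiv (Fin.last n) f = 0) :
    ∃ g : MvPolynomial (Fin n) ℂ, rename Fin.castSucc g = f := by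
  apply exists_rename_eq_of_vars_subset_range _ _ (Fin.castSucc_injective n)
  intro i hi
  rcases Fin.eq_castSucc_or_eq_last i with ⟨j, rfl⟩ | rfl
  · exact ⟨j, rfl⟩
  · exfalso
    rw [Finset.mem_coe, mem_vars_iff_mem_support] at hi
    obtain ⟨m, hm, hi⟩ := hi
    have h1 := coeff_pderiv f (i := Fin.last n) (m - Finsupp.single (Fin.last n) 1)
    rw [h] at h1
    have h2 : m - Finsupp.single (Fin.last n) 1 + Finsupp.single (Fin.last n) 1 = m := by
      apply tsub_add_cancel_of_le
      rw [Finsupp.single_le_iff]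
      exact Nat.one_le_iff_ne_zero.2 (Finsupp.mem_support_iff.1 hi)
    rw [h2] at h1
    simp only [coeff_zero] at h1
    rw [mem_support_iff] at hm
    have h3 : (((m - Finsupp.single (Fin.last n) 1 : Fin (n+1) →₀ ℕ) (Fin.last n) : ℂ) + 1) ≠ 0 := by
      exact Nat.cast_add_one_ne_zero _
    rcases mul_eq_zero.1 h1.symm with h4 | h4
    · exact hm h4
    · exact h3 h4

theorem lapl_rename {n : ℕ} (g : MvPolynomial (Fin n) ℂ) :
    lapl (Fin (n+1)) (rename Fin.castSucc g) = rename Fin.castSucc (lapl (Fin n) g) := by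
  classical
  rw [lapl_apply, lapl_apply, Fin.sum_univ_castSucc, map_sum]
  have h0 : pderiv (Fin.last n) (rename Fin.castSucc g) = 0 := by
    apply pderiv_eq_zero_of_notMem_vars
    intro h
    have := vars_rename (Fin.castSucc) g h
    simp at this
  rw [h0, map_zero, add_zero]
  refine Finset.sum_congr rfl fun i _ => ?_
  rw [pderiv_rename (Fin.castSucc_injective n), pderiv_rename (Fin.castSucc_injective n)]

theorem pderiv_Harm {n d : ℕ} (i : Fin n) (f : MvPolynomial (Fin n) ℂ) (hf : f ∈ Harm (Fin n) (d+1)) :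
    pderiv i f ∈ Harm (Fin n) d := by
  rw [mem_Harm] at hf ⊢
  refine ⟨hf.1.pderiv, ?_⟩
  rw [lapl_apply]
  have : ∀ j, pderiv j (pderiv j (pderiv i f)) = pderiv i (pderiv j (pderiv j f)) := by
    intro j
    have hc : ∀ g : MvPolynomial (Fin n) ℂ, pderiv j (pderiv i g) = pderiv i (pderiv j g) := by
      intro g
      ext m
      simp only [coeff_pderiv]
      rcases eq_or_ne i j with rfl | hij
      · rfl
      · rw [add_right_comm]
        simp [hij, hij.symm]
        ring
    rw [hc, hc]
  simp only [this]
  rw [← map_sum, ← lapl_apply, hf.2, map_zero]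

theorem rank_Harm (n d : ℕ) : Module.rank ℂ (Harm (Fin (n+1)) d) ≤ (hh n d : Cardinal) := by
  induction n generalizing d with
  | zero =>
    have key : ∀ f ∈ Harm (Fin 1) d, f = coeff (Finsupp.single 0 d) f • X 0 ^ d := by
      intro f hf
      rw [mem_Harm] at hf
      ext m
      have hm : m = Finsupp.single 0 (m 0) := by ext; simp
      rw [hm, coeff_smul, coeff_X_pow]
      split_ifs with h
      · rw [← h]; simp
      · simp only [smul_eq_mul, mul_zero]
        apply hf.1.coeff_eq_zero
        simp only [Finsupp.degree_single]
        rintro rfl; exact h rfl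
    by_cases hd : d ≤ 1
    · simp only [hh, hd, if_true, Nat.cast_one]
      have : Harm (Fin 1) d ≤ Submodule.span ℂ {X 0 ^ d} := by
        intro f hf
        rw [key f hf]
        exact Submodule.smul_mem _ _ (Submodule.mem_span_singleton_self _)
      refine (Submodule.rank_mono this).trans ((rank_span_le _).trans ?_)
      simp
    · have : Harm (Fin 1) d = ⊥ := by
        rw [eq_bot_iff]
        intro f hf
        have h2 := (mem_Harm.1 hf).2
        rw [key f hf, map_smul, lapl_apply] at h2
        obtain ⟨e, rfl⟩ : ∃ e, d = e + 2 := ⟨d - 2, by omega⟩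
        simp [Derivation.leibniz] at h2
        rw [Submodule.mem_bot, key f hf]
        have h3 : (e : MvPolynomial (Fin 1) ℂ) + 2 ≠ 0 := by exact_mod_cast (by omega : e + 2 ≠ 0)
        have h4 : (e : MvPolynomial (Fin 1) ℂ) + 1 ≠ 0 := by exact_mod_cast (by omega : e + 1 ≠ 0)
        have h5 : pderiv (0 : Fin 1) (2 : MvPolynomial (Fin 1) ℂ) = 0 := by
          exact pderiv_C (R := ℂ) (i := (0 : Fin 1)) (a := 2)
        rw [h5, mul_zero, smul_zero, add_zero, ← Finsupp.single_add, smul_eq_zero] at h2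
        rcases h2 with h2 | h2
        · rw [h2, zero_smul]
        · exact absurd h2 (mul_ne_zero h3 (mul_ne_zero h4 (pow_ne_zero _ (X_ne_zero _))))
      rw [this]; simp
  | succ n ih =>
    induction d with
    | zero =>
      have : Harm (Fin (n+2)) 0 ≤ Submodule.span ℂ {1} := by
        intro f hf
        have h1 := (mem_Harm.1 hf).1
        rw [← totalDegree_zero_iff_isHomogeneous] at h1
        rw [totalDegree_eq_zero_iff_eq_C.1 h1, ← mul_one (C _), ← smul_eq_C_mul]
        exact Submodule.smul_mem _ _ (Submodule.mem_span_singleton_self _)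
      refine (Submodule.rank_mono this).trans ((rank_span_le _).trans ?_)
      simp [hh]
    | succ d ihd =>
      let D : Harm (Fin (n+2)) (d+1) →ₗ[ℂ] MvPolynomial (Fin (n+2)) ℂ := 
        (pderiv (Fin.last (n+1))).toLinearMap ∘ₗ (Harm (Fin (n+2)) (d+1)).subtype
      rw [← LinearMap.rank_range_add_rank_ker D, hh, add_comm, Nat.cast_add]
      apply add_le_add
      · refine le_trans ?_ (ih (d+1))
        have e1 : (LinearMap.ker D).map (Harm (Fin (n+2)) (d+1)).subtype ≤ 
            (Harm (Fin (n+1)) (d+1)).map (rename Fin.castSucc).toLinearMap := by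
          rintro _ ⟨⟨f, hf⟩, hk, rfl⟩
          obtain ⟨g, hg⟩ := vars_of_pderiv f hk
          refine ⟨g, ?_, hg⟩
          rw [SetLike.mem_coe, mem_Harm]
          rw [mem_Harm] at hf
          have hinj := rename_injective (R := ℂ) _ (Fin.castSucc_injective (n+1))
          constructor
          · rw [← hg] at hf
            exact (IsHomogeneous.rename_isHomogeneous_iff (Fin.castSucc_injective (n+1))).1 hf.1
          · apply hinj
            rw [← lapl_rename, hg, hf.2, map_zero]
        have e2 := (LinearEquiv.rank_eq (Submodule.equivMapOfInjective 
          (Harm (Fin (n+2)) (d+1)).subtype (Submodule.injective_subtype _) (LinearMap.ker D)))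
        rw [e2]
        exact (Submodule.rank_mono e1).trans (rank_map_le _ _)
      · refine le_trans (Submodule.rank_mono ?_) ihd
        rintro _ ⟨⟨f, hf⟩, rfl⟩
        exact pderiv_Harm _ f hf

theorem Harm_fin (n d : ℕ) : FiniteDimensional ℂ (Harm (Fin (n+1)) d) := by
  exact Module.rank_lt_aleph0_iff.1 <| (rank_Harm n d).trans_lt (Cardinal.natCast_lt_aleph0)

theorem finrank_Harm (n d : ℕ) : Module.finrank ℂ (Harm (Fin (n+1)) d) ≤ hh n d := by
  have := Harm_fin n d
  have := rank_Harm n d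
  rw [← Module.finrank_eq_rank] at this
  exact_mod_cast this

end AH

set_option linter.unusedSectionVars false
set_option linter.style.haveILetI false

namespace AH
open MvPolynomial

section drop
variable {K V : Type*} [Field K] [AddCommGroup V] [Module K V]
theorem RankGE.drop {k e : ℕ} {s t : Set V} (h : RankGE K (k + e) s) (M : Submodule K V)
    [FiniteDimensional K M] (hM : Module.finrank K M ≤ e)
    (hst : s ⊆ (Submodule.span K t ⊔ M : Submodule K V)) : RankGE K k t := by
  obtain ⟨b, hbt, hbs, hbi⟩ := exists_linearIndependent K t
  by_cases hk : ∃ f : Fin k ↪ b, True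
  · obtain ⟨f, -⟩ := hk
    exact ⟨fun i => (f i : V), fun i => hbt (f i).2, hbi.comp f f.injective⟩
  · exfalso
    have hfin : Finite b := by
      by_contra hinf
      rw [not_finite_iff_infinite] at hinf
      exact hk ⟨Fin.valEmbedding.trans (Infinite.natEmbedding b), trivial⟩
    have := Fintype.ofFinite b
    have hlt : Fintype.card b < k := by
      by_contra hge
      push Not at hge
      exact hk ⟨(Fin.castLEEmb hge).trans (Fintype.equivFin b).symm.toEmbedding, trivial⟩
    have : FiniteDimensional K (Submodule.span K b) := FiniteDimensional.span_of_finite K hfin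
    rw [← hbs] at hst
    have h1 := h.le_finrank _ hst
    have h2 := finrank_span_eq_card hbi
    rw [Subtype.range_coe] at h2
    have h3 := Submodule.finrank_add_le_finrank_add_finrank (Submodule.span K b) M
    have h4 : Module.finrank K (Submodule.span K b) < k := h2.trans_lt hlt
    omega
end drop

section tan
variable {ι : Type} [Fintype ι]

theorem span_TanW_eq (B : BF ι) (d : ℕ) (p : ι → ℂ) :
    Submodule.span ℂ (TanW B ⊤ d p) =
      (LinearMap.ker (B p)).map ((LinearMap.mulLeft ℂ (lf p ^ (d-1))).comp lfL) := by
  apply le_antisymm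
  · rw [Submodule.span_le]
    rintro _ ⟨m, _, hm, rfl⟩
    exact ⟨m, hm, rfl⟩
  · rintro _ ⟨m, hm, rfl⟩
    exact Submodule.subset_span ⟨m, trivial, hm, rfl⟩

theorem TanW_zero (B : BF ι) {d : ℕ} (hd : 2 ≤ d) (W : Submodule ℂ (ι → ℂ)) : 
    TanW B W d 0 ⊆ {0} := by
  rintro _ ⟨m, _, _, rfl⟩
  rw [lf_zero, zero_pow (by omega), zero_mul]; rfl

theorem span_TanW_fin (B : BF ι) (d : ℕ) (p : ι → ℂ) : 
    FiniteDimensional ℂ (Submodule.span ℂ (TanW B ⊤ d p)) := by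
  rw [span_TanW_eq]; infer_instance

theorem finrank_span_TanW {n : ℕ} (hn : Fintype.card ι = n + 1) (B : BF ι) (hnd : NDW B ⊤) {d : ℕ}
    (hd : 2 ≤ d) (p : ι → ℂ) : Module.finrank ℂ (Submodule.span ℂ (TanW B ⊤ d p)) ≤ n := by
  by_cases hp : p = 0
  · subst hp
    have : Submodule.span ℂ (TanW B ⊤ d 0) = ⊥ := by
      rw [Submodule.span_eq_bot]
      intro x hx; exact TanW_zero B hd _ hx
    rw [this]; simp
  · rw [span_TanW_eq]
    refine (Submodule.finrank_map_le _ _).trans ?_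
    have h1 := LinearMap.finrank_range_add_finrank_ker (B p)
    have h2 : 0 < Module.finrank ℂ (LinearMap.range (B p)) := by
      by_contra hcon
      have : Module.finrank ℂ (LinearMap.range (B p)) = 0 := by omega
      rw [Submodule.finrank_eq_zero, LinearMap.range_eq_bot] at this
      exact hp (hnd p trivial fun w _ => by rw [this]; rfl)
    simp only [Module.finrank_fintype_fun_eq_card, hn] at h1
    omega

theorem Good.pred {n : ℕ} (hn : Fintype.card ι = n + 1) {B : BF ι} (hnd : NDW B ⊤) {d r : ℕ}
    (hd : 2 ≤ d) (h : Good B d (r+1) ((r+1)*n)) : Good B d r (r*n) := by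
  obtain ⟨p, hp, hk⟩ := h
  refine ⟨fun j => p j.castSucc, fun j => hp _, ?_⟩
  have := span_TanW_fin B d (p (Fin.last r))
  rw [add_mul, one_mul] at hk
  refine hk.drop (Submodule.span ℂ (TanW B ⊤ d (p (Fin.last r)))) (finrank_span_TanW hn B hnd hd _) ?_
  intro x hx
  simp only [Set.mem_iUnion] at hx
  obtain ⟨j, hj⟩ := hx
  rcases Fin.eq_castSucc_or_eq_last j with ⟨i, rfl⟩ | rfl
  · exact Submodule.mem_sup_left (Submodule.subset_span (Set.mem_iUnion.2 ⟨i, hj⟩))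
  · exact Submodule.mem_sup_right (Submodule.subset_span hj)

theorem Good.down {n : ℕ} (hn : Fintype.card ι = n + 1) {B : BF ι} (hnd : NDW B ⊤) {d r r0 : ℕ}
    (hd : 2 ≤ d) (hr : r ≤ r0) (h : Good B d r0 (r0*n)) : Good B d r (r*n) := by
  induction hr using Nat.decreasingInduction with
  | self => exact h
  | of_succ k hk ih => exact ih.pred hn hnd hd

theorem Good.le {B : BF ι} {d r k l : ℕ} (h : Good B d r k) (hl : l ≤ k) : Good B d r l := by
  obtain ⟨p, hp, hk⟩ := h
  exact ⟨p, hp, hk.le hl⟩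

theorem Good.up {B : BF ι} {d r r' k : ℕ} (h : Good B d r k) (hr : r ≤ r') : Good B d r' k := by
  obtain ⟨p, hp, hk⟩ := h
  obtain ⟨e, rfl⟩ := Nat.exists_eq_add_of_le hr
  refine Good.of_fintype (J := Fin r ⊕ Fin e) (by simp) (Sum.elim p 0) ?_ (hk.mono ?_)
  · rintro (j | j)
    · exact hp j
    · simp
  · intro x hx
    simp only [Set.mem_iUnion] at hx ⊢
    obtain ⟨j, hj⟩ := hx
    exact ⟨Sum.inl j, hj⟩

/-- the main claim in `n+1` variables and degree `d` -/
def AHn (n d : ℕ) : Prop := ∀ r, Good (dotB (Fin (n+1))) d r (min (r*n) (hh n d))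

theorem AHn_of {n d r0 r1 : ℕ} (hd : 2 ≤ d) (h0 : Good (dotB (Fin (n+1))) d r0 (r0*n))
    (h1 : Good (dotB (Fin (n+1))) d r1 (hh n d)) (hle : r1 ≤ r0 + 1) : AHn n d := by
  intro r
  by_cases hr : r ≤ r0
  · exact (h0.down (by simp) dotB_nd hd hr).le (min_le_left _ _)
  · exact (h1.up (by omega)).le (min_le_right _ _)

/-- it suffices to treat floor and ceiling -/
theorem AHn_of_mid {n d : ℕ} (hn : 1 ≤ n) (hd : 2 ≤ d)
    (h : ∀ r, r * n < hh n d + n → hh n d < r * n + n → 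
      Good (dotB (Fin (n+1))) d r (min (r*n) (hh n d))) : AHn n d := by
  have e1 := Nat.div_add_mod (hh n d) n
  have e2 := Nat.mod_lt (hh n d) hn
  set q := hh n d / n
  set m := hh n d % n
  have e3 : n * q = q * n := mul_comm _ _
  have h0 := h q (by omega) (by omega)
  rw [min_eq_left (by omega)] at h0
  rcases Nat.eq_zero_or_pos m with hm | hm
  · refine AHn_of hd h0 (r1 := q) ?_ (by omega)
    have : hh n d = q * n := by omega
    rw [this]; exact h0
  · have h1 := h (q+1) (by rw [add_mul]; omega) (by rw [add_mul]; omega)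
    rw [min_eq_right (by rw [add_mul]; omega)] at h1
    exact AHn_of hd h0 h1 le_rfl

/-- coefficients of a polynomial curve in a subspace -/
theorem coeff_mem {A : Type*} [CommRing A] [Algebra ℂ A] (P : Polynomial A) (S : Submodule ℂ A)
    (h : {t : ℂ | P.eval (algebraMap ℂ A t) ∉ S}.Finite) (k : ℕ) : P.coeff k ∈ S := by
  by_contra hk
  obtain ⟨φ, hφ, hS⟩ := Submodule.exists_le_ker_of_notMem hk
  set Q : Polynomial ℂ := ∑ k ∈ Finset.range (P.natDegree + 1), Polynomial.monomial k (φ (P.coeff k))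
  have hQ : ∀ t, Q.eval t = φ (P.eval (algebraMap ℂ A t)) := by
    intro t
    rw [Polynomial.eval_eq_sum_range (p := P), map_sum, Polynomial.eval_finsetSum]
    refine Finset.sum_congr rfl fun k _ => ?_
    rw [Polynomial.eval_monomial, ← map_pow, mul_comm, ← smul_eq_mul, ← map_smul, Algebra.smul_def,
      mul_comm]
  have hQk : Q.coeff k = φ (P.coeff k) := by
    simp only [Q, Polynomial.finsetSum_coeff, Polynomial.coeff_monomial]
    rw [Finset.sum_ite_eq']
    split_ifs with hr
    · rfl
    · rw [Polynomial.coeff_eq_zero_of_natDegree_lt (by simpa using hr), map_zero]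
  have : Q = 0 := by
    apply Polynomial.eq_zero_of_infinite_isRoot
    refine Set.Infinite.mono ?_ h.infinite_compl
    intro t ht
    simp only [Set.mem_compl_iff, Set.mem_ofPred_eq, not_not] at ht
    simp only [Set.mem_ofPred_eq, Polynomial.IsRoot, hQ]
    exact hS ht
  rw [this] at hQk
  exact hφ (by simpa using hQk.symm)

/-- isotropic complement -/
theorem exists_c (B : BF ι) (hB : ∀ x y, B x y = B y x) (W : Submodule ℂ (ι → ℂ)) (hW : NDW B W)
    (p : ι → ℂ) (hp : p ∈ W) (hpp : B p p = 0) (h0 : p ≠ 0) : 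
    ∃ c ∈ W, B c c = 0 ∧ B p c = 1 := by
  have : ∃ w ∈ W, B p w ≠ 0 := by
    by_contra hcon; push Not at hcon; exact h0 (hW p hp hcon)
  obtain ⟨w, hw, hne⟩ := this
  set y := (B p w)⁻¹ • w
  have h1 : B p y = 1 := by simp [y, hne]
  have h2 : B y p = 1 := by rw [hB, h1]
  have hy : y ∈ W := W.smul_mem _ hw
  refine ⟨y - (B y y / 2) • p, W.sub_mem hy (W.smul_mem _ hp), ?_, ?_⟩
  · simp only [map_sub, map_smul, LinearMap.sub_apply, LinearMap.smul_apply, smul_eq_mul, h1, h2, hpp]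
    ring
  · simp [h1, hpp]

/-- powers of isotropic vectors -/
def Pow (B : BF ι) (W : Submodule ℂ (ι → ℂ)) (d : ℕ) : Set (MvPolynomial ι ℂ) :=
  {f | ∃ p ∈ W, B p p = 0 ∧ f = lf p ^ d}

theorem TanW_sub_Pow (B : BF ι) (hB : ∀ x y, B x y = B y x) (W : Submodule ℂ (ι → ℂ))
    (hW : NDW B W) {d : ℕ} (hd : 2 ≤ d)
    (p : ι → ℂ) (hp : p ∈ W) (hpp : B p p = 0) : 
    TanW B W d p ⊆ Submodule.span ℂ (Pow B W d) := by
  by_cases h0 : p = 0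
  · subst h0
    intro x hx
    rw [TanW_zero B hd _ hx]; exact Submodule.zero_mem _
  obtain ⟨c, hc, hcc, hpc⟩ := exists_c B hB W hW p hp hpp h0
  have hcp : B c p = 1 := by rw [hB, hpc]
  rintro _ ⟨m, hm, hpm, rfl⟩
  set m' := m - B m c • p with hm'
  have hm'W : m' ∈ W := W.sub_mem hm (W.smul_mem _ hp)
  have hm'c : B m' c = 0 := by simp [hm', hpc]
  have hm'p : B p m' = 0 := by simp [hm', hpm, hpp]
  have hpm' : B m' p = 0 := by rw [hB, hm'p]
  have hcm' : B c m' = 0 := by rw [hB, hm'c]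
  have e : m = m' + B m c • p := by rw [hm']; abel
  rw [e, lf_add, mul_add, lf_smul, mul_smul_comm, ← pow_succ]
  apply Submodule.add_mem
  · set P : Polynomial (MvPolynomial ι ℂ) := (Polynomial.C (lf p) + Polynomial.X * Polynomial.C (lf m')
      - Polynomial.X ^ 2 * Polynomial.C ((B m' m' / 2) • lf c)) ^ d with hP
    have h1 : P.coeff 1 = (d : ℂ) • (lf p ^ (d-1) * lf m') := by
      have := Polynomial.coeff_derivative P 0
      simp only [zero_add, Nat.cast_zero, mul_one] at this
      rw [← this, Polynomial.coeff_zero_eq_eval_zero, hP, Polynomial.derivative_pow]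
      simp [Polynomial.derivative_pow, Algebra.smul_def]
      ring
    have h2 := coeff_mem P (Submodule.span ℂ (Pow B W d)) (by
      convert Set.finite_empty
      rw [Set.eq_empty_iff_forall_notMem]
      intro t ht
      apply ht
      refine Submodule.subset_span ⟨p + t • m' - (t^2 * (B m' m' / 2)) • c, ?_, ?_, ?_⟩
      · exact W.sub_mem (W.add_mem hp (W.smul_mem _ hm'W)) (W.smul_mem _ hc)
      · simp only [map_sub, map_add, map_smul, LinearMap.sub_apply, LinearMap.add_apply, 
          LinearMap.smul_apply, smul_eq_mul, hpp, hpc, hcp, hcc, hm'p, hpm', hm'c, hcm']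
        ring
      · rw [hP, Polynomial.eval_pow]
        congr 1
        simp only [Polynomial.eval_sub, Polynomial.eval_add, Polynomial.eval_C, Polynomial.eval_mul,
          Polynomial.eval_X, Polynomial.eval_pow, lf_sub, lf_add, lf_smul, mul_smul, 
          ← map_pow, ← Algebra.smul_def]) 1
    rw [h1] at h2
    have hd0 : (d : ℂ) ≠ 0 := by exact_mod_cast (by omega : d ≠ 0)
    exact (Submodule.smul_mem_iff _ hd0).1 h2
  · apply Submodule.smul_mem
    refine Submodule.subset_span ⟨p, hp, hpp, ?_⟩
    congr 1; omega

theorem Good.pow {B : BF ι} (hB : ∀ x y, B x y = B y x) (hnd : NDW B ⊤) {d r k : ℕ} (hd : 2 ≤ d)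
    (h : Good B d r k) : RankGE ℂ k (Pow B ⊤ d) := by
  obtain ⟨p, hp, hk⟩ := h
  refine hk.of_span ?_
  intro x hx
  simp only [Set.mem_iUnion] at hx
  obtain ⟨j, hj⟩ := hx
  exact TanW_sub_Pow B hB ⊤ hnd hd (p j) trivial (hp j) hj

theorem AHn.pow {n d : ℕ} (hn : 1 ≤ n) (hd : 2 ≤ d) (h : AHn n d) :
    RankGE ℂ (hh n d) (Pow (dotB (Fin (n+1))) ⊤ d) := by
  have := h (hh n d)
  rw [min_eq_right (Nat.le_mul_of_pos_right _ hn)] at this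
  exact this.pow dotB_symm dotB_nd hd

end tan

theorem hh_one (d : ℕ) : hh 1 (d+1) = 2 := by
  induction d with
  | zero => simp [hh]
  | succ d ih => rw [hh, ih]; simp [hh]

theorem hh_two (d : ℕ) : hh 2 d = 2 * d + 1 := by
  induction d with
  | zero => simp [hh]
  | succ d ih => rw [hh, ih, hh_one]; ring

theorem AHn_one {d : ℕ} (hd : 2 ≤ d) : AHn 1 d := by
  have hI : Complex.I ^ 2 = -1 := Complex.I_sq
  have h2 : hh 1 d = 2 := by
    obtain ⟨e, rfl⟩ : ∃ e, d = e + 1 := ⟨d - 1, by omega⟩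
    exact hh_one e
  have key : Good (dotB (Fin 2)) d 2 2 := by
    refine ⟨![![1, Complex.I], ![1, -Complex.I]], ?_, ?_⟩
    · intro j; fin_cases j <;> simp [dotB_apply]
    · refine ⟨![lf ![1, Complex.I] ^ d, lf ![1, -Complex.I] ^ d], ?_, ?_⟩
      · intro i
        rw [Set.mem_iUnion]
        refine ⟨i, ?_⟩
        have hd' : d = d - 1 + 1 := by omega
        fin_cases i
        · exact ⟨![1, Complex.I], trivial, by simp [dotB_apply], by
            simp only [Matrix.cons_val_zero, Fin.zero_eta]; rw [← pow_succ, ← hd']⟩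
        · exact ⟨![1, -Complex.I], trivial, by simp [dotB_apply], by
            simp only [Matrix.cons_val_one, Fin.mk_one, Matrix.cons_val_zero]; rw [← pow_succ, ← hd']⟩
      · rw [LinearIndependent.pair_iff]
        intro s t hst
        have h3 := congrArg (eval ![1, Complex.I]) hst
        have h4 := congrArg (eval ![1, -Complex.I]) hst
        have hd0 : d ≠ 0 := by omega
        have h22 : (1 + 1 : ℂ) ≠ 0 := by norm_num
        simp [lf, Algebra.smul_def, hd0, h22] at h3 h4
        exact ⟨h4, h3⟩
  refine AHn_of hd (r0 := 2) (r1 := 2) (by simpa using key) ?_ (by omega)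
  rw [h2]; exact key

/-- the form for conics -/
noncomputable def B3 : BF (Fin 3) :=
  LinearMap.mk₂ ℂ (fun x y => 2 * x 1 * y 1 - x 0 * y 2 - x 2 * y 0)
    (fun x y z => by simp; ring)
    (fun c x y => by simp; ring)
    (fun x y z => by simp; ring)
    (fun c x y => by simp; ring)

theorem B3_apply (x y : Fin 3 → ℂ) : B3 x y = 2 * x 1 * y 1 - x 0 * y 2 - x 2 * y 0 := rfl

theorem B3_nd : NDW B3 ⊤ := by
  intro p _ h
  have h0 := h ![1,0,0] trivial
  have h1 := h ![0,1,0] trivial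
  have h2 := h ![0,0,1] trivial
  simp [B3_apply] at h0 h1 h2
  ext i; fin_cases i
  · exact h2
  · exact h1
  · exact h0

noncomputable def phi3 : MvPolynomial (Fin 3) ℂ →ₐ[ℂ] Polynomial ℂ :=
  aeval ![Polynomial.X ^ 2, -2 * Polynomial.X, 1]

/-- dual functional -/
noncomputable def dualF (N : ℕ) : Polynomial ℂ →ₗ[ℂ] Polynomial ℂ →ₗ[ℂ] ℂ :=
  ∑ k ∈ Finset.range (N+1), ((-1)^k / (N.choose k : ℂ)) • 
    (LinearMap.mul ℂ ℂ).compl₁₂ (Polynomial.lcoeff ℂ k) (Polynomial.lcoeff ℂ (N - k))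

theorem dualF_apply (N : ℕ) (G f : Polynomial ℂ) : dualF N G f = 
    ∑ k ∈ Finset.range (N+1), ((-1)^k / (N.choose k : ℂ)) * (G.coeff k * f.coeff (N-k)) := by
  simp [dualF]

theorem dualF_pow (N : ℕ) (G : Polynomial ℂ) (hG : G.natDegree ≤ N) (z : ℂ) :
    dualF N G ((Polynomial.X - Polynomial.C z) ^ N) = G.eval z := by
  rw [dualF_apply, Polynomial.eval_eq_sum_range' (Nat.lt_succ_of_le hG)]
  refine Finset.sum_congr rfl fun k hk => ?_
  have hk : k ≤ N := by simpa [Nat.lt_succ_iff] using hk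
  rw [sub_eq_add_neg, ← Polynomial.C_neg, Polynomial.coeff_X_add_C_pow, Nat.choose_symm hk,
    Nat.sub_sub_self hk, neg_pow z]
  have : (N.choose k : ℂ) ≠ 0 := by exact_mod_cast (Nat.choose_pos hk).ne'
  field_simp
  rw [← pow_mul, mul_comm k 2, pow_mul]; simp

theorem dualF_pow' (N : ℕ) (G : Polynomial ℂ) (hG : G.natDegree ≤ N + 1) (z : ℂ) :
    dualF (N+1) G ((Polynomial.X - Polynomial.C z) ^ N) = - (G.derivative.eval z) / (N+1) := by
  have hd : G.derivative.natDegree < N + 1 := by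
    have := Polynomial.natDegree_derivative_le G
    omega
  rw [dualF_apply, Polynomial.eval_eq_sum_range' hd, Finset.sum_range_succ']
  have h0 : ((Polynomial.X - Polynomial.C z) ^ N).coeff (N + 1 - 0) = 0 := by
    apply Polynomial.coeff_eq_zero_of_natDegree_lt
    rw [Polynomial.natDegree_pow, Polynomial.natDegree_X_sub_C]; omega
  rw [h0]
  simp only [mul_zero, add_zero]
  rw [neg_div, Finset.sum_div, ← Finset.sum_neg_distrib]
  refine Finset.sum_congr rfl fun k hk => ?_
  have hk : k ≤ N := by simpa [Nat.lt_succ_iff] using hk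
  rw [sub_eq_add_neg, ← Polynomial.C_neg, Polynomial.coeff_X_add_C_pow, Nat.add_sub_add_right,
    Nat.choose_symm hk,
    Nat.sub_sub_self hk, neg_pow z, Polynomial.coeff_derivative]
  have h1 : ((N+1).choose (k+1) : ℂ) ≠ 0 := by exact_mod_cast (Nat.choose_pos (by omega)).ne'
  have h2 : (N + 1 : ℂ) ≠ 0 := by exact_mod_cast (by omega : N + 1 ≠ 0)
  have h3 : ((N + 1 : ℕ) : ℂ) * (N.choose k : ℂ) = ((N+1).choose (k+1) : ℂ) * ((k + 1 : ℕ) : ℂ) := by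
    exact_mod_cast Nat.add_one_mul_choose_eq N k
  push_cast at h3
  field_simp
  have h4 : ((-1 : ℂ)^k)^2 = 1 := by rw [← pow_mul, mul_comm k 2, pow_mul]; simp
  rw [pow_succ]
  linear_combination (-G.coeff (k+1) * z^k * ((-1 : ℂ)^k)^2) * h3 - G.coeff (k+1) * z^k * ((N+1).choose (k+1) : ℂ) * (k+1) * h4

theorem good_two (d r : ℕ) (hd : 2 ≤ d) : Good B3 d r (min (r * 2) (2 * d + 1)) := by
  set v : ℂ → Fin 3 → ℂ := fun z => ![1, z, z^2] with hv
  set v' : ℂ → Fin 3 → ℂ := fun z => ![0, 1, 2*z] with hv'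
  refine ⟨fun j => v (j : ℕ), fun j => by simp [B3_apply, hv]; ring, ?_⟩
  set K := min (r * 2) (2 * d + 1) with hK
  set S : Set (Polynomial ℂ) := phi3.toLinearMap '' (⋃ j : Fin r, TanW B3 ⊤ d (v (j : ℕ))) with hS
  apply RankGE.of_map phi3.toLinearMap
  have hphi : ∀ a, phi3 (lf a) = Polynomial.C (a 0) * Polynomial.X ^ 2 - 
      2 * Polynomial.C (a 1) * Polynomial.X + Polynomial.C (a 2) := by
    intro a
    simp [phi3, lf, Fin.sum_univ_three, Polynomial.C_eq_algebraMap]; ring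
  have hv2 : ∀ z, phi3 (lf (v z)) = (Polynomial.X - Polynomial.C z) ^ 2 := by
    intro z; rw [hphi]; simp [hv]; ring
  have hv'2 : ∀ z, phi3 (lf (v' z)) = (-2 : ℂ) • (Polynomial.X - Polynomial.C z) := by
    intro z; rw [hphi]; simp [hv', smul_sub, Polynomial.smul_eq_C_mul]
    rfl
  have m1 : ∀ j : Fin r, (Polynomial.X - Polynomial.C ((j : ℕ) : ℂ)) ^ (2 * d) ∈ S := by
    intro j
    refine ⟨lf (v (j:ℕ)) ^ (d-1) * lf (v (j : ℕ)), Set.mem_iUnion.2 ⟨j, v (j:ℕ), trivial, by simp [B3_apply, hv]; ring, rfl⟩, ?_⟩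
    rw [AlgHom.toLinearMap_apply, map_mul, map_pow, hv2, ← pow_mul, ← pow_add]
    congr 1; omega
  have m2 : ∀ j : Fin r, (Polynomial.X - Polynomial.C ((j : ℕ) : ℂ)) ^ (2 * d - 1) ∈ 
      Submodule.span ℂ S := by
    intro j
    have : lf (v (j:ℕ)) ^ (d-1) * lf (v' (j : ℕ)) ∈ (⋃ j : Fin r, TanW B3 ⊤ d (v (j : ℕ))) := by
      refine Set.mem_iUnion.2 ⟨j, v' (j:ℕ), trivial, by simp [B3_apply, hv, hv'], rfl⟩
    have h1 : phi3.toLinearMap (lf (v (j:ℕ)) ^ (d-1) * lf (v' (j : ℕ))) ∈ S := ⟨_, this, rfl⟩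
    rw [AlgHom.toLinearMap_apply, map_mul, map_pow, hv2, hv'2, mul_smul_comm, ← pow_mul, 
      ← pow_succ] at h1
    have h2 := Submodule.subset_span (R := ℂ) h1
    rw [SetLike.mem_coe, Submodule.smul_mem_iff _ (by norm_num)] at h2
    convert h2 using 2; omega
  -- finite-dimensionality
  apply rankGE_of_le_finrank
  have hfin : FiniteDimensional ℂ (Submodule.span ℂ S) := by
    rw [hS, Submodule.span_image, Submodule.span_iUnion]
    have := fun j : Fin r => span_TanW_fin B3 d (v (j : ℕ))
    infer_instance
  let Φ : Polynomial.degreeLT ℂ K →ₗ[ℂ] Module.Dual ℂ (Submodule.span ℂ S) :=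
    ((dualF (2*d)).compl₂ (Submodule.span ℂ S).subtype).comp (Polynomial.degreeLT ℂ K).subtype
  have hinj : Function.Injective Φ := by
    rw [← LinearMap.ker_eq_bot, LinearMap.ker_eq_bot']
    rintro ⟨G, hG⟩ h0
    have hz : ∀ f ∈ Submodule.span ℂ S, dualF (2*d) G f = 0 := fun f hf => 
      LinearMap.congr_fun h0 ⟨f, hf⟩
    ext1
    by_contra hne
    change G ≠ 0 at hne
    have hdeg : G.natDegree < K := by
      rw [Polynomial.mem_degreeLT] at hG
      exact (Polynomial.natDegree_lt_iff_degree_lt hne).2 hG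
    have hdvd : ∀ j : Fin r, (Polynomial.X - Polynomial.C ((j : ℕ) : ℂ)) ^ 2 ∣ G := by
      intro j
      have h1 := hz _ (Submodule.subset_span (m1 j))
      rw [dualF_pow _ _ (by omega)] at h1
      have h2 := hz _ (m2 j)
      have h3 : 2 * d = (2 * d - 1) + 1 := by omega
      rw [h3] at h2
      rw [Nat.add_sub_cancel, dualF_pow' _ _ (by omega)] at h2
      have h4 : (((2 * d - 1 : ℕ) : ℂ) + 1) ≠ 0 := Nat.cast_add_one_ne_zero _
      have h5 : G.derivative.eval ((j:ℕ):ℂ) = 0 := by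
        rcases div_eq_zero_iff.1 h2 with h | h
        · exact neg_eq_zero.1 h
        · exact absurd h h4
      rw [← Polynomial.le_rootMultiplicity_iff hne]
      exact (Polynomial.one_lt_rootMultiplicity_iff_isRoot hne).2 ⟨h1, h5⟩
    have hprod : ∏ j : Fin r, (Polynomial.X - Polynomial.C ((j : ℕ) : ℂ)) ^ 2 ∣ G := by
      apply Finset.prod_dvd_of_coprime
      · intro i _ j _ hij
        apply IsCoprime.pow
        apply Polynomial.isCoprime_X_sub_C_of_isUnit_sub
        rw [isUnit_iff_ne_zero, sub_ne_zero]
        intro h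
        exact hij (Fin.ext (by exact_mod_cast h))
      · intro j _; exact hdvd j
    have h6 := Polynomial.natDegree_le_of_dvd hprod hne
    rw [Polynomial.natDegree_prod_of_monic _ _ (fun j _ => (Polynomial.monic_X_sub_C _).pow 2)] at h6
    simp only [Polynomial.natDegree_pow, Polynomial.natDegree_X_sub_C] at h6
    simp at h6
    omega
  have := LinearMap.finrank_le_finrank_of_injective hinj
  rw [Subspace.dual_finrank_eq] at this
  have h7 : Module.finrank ℂ (Polynomial.degreeLT ℂ K) = K := by
    rw [(Polynomial.degreeLTEquiv ℂ K).finrank_eq]; simp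
  rw [h7] at this
  exact this

theorem AHn_two {d : ℕ} (hd : 2 ≤ d) : AHn 2 d := by
  intro r
  rw [hh_two]
  exact (good_two d r hd).to_std (fun x y => by simp [B3_apply]; ring) B3_nd (by simp)

end AH

set_option linter.unusedSectionVars false
set_option linter.style.haveILetI false

namespace AH
open MvPolynomial

section limits
variable {A : Type} [CommRing A] [Algebra ℂ A]

/-- limits at zero of curves in a family of subspaces -/
def Lsub (S : ℂ → Submodule ℂ A) : Submodule ℂ A where
  carrier := {x | ∃ f : Polynomial A, f.coeff 0 = x ∧ ∀ t : ℂ, t ≠ 0 → f.eval (algebraMap ℂ A t) ∈ S t}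
  add_mem' := by
    rintro _ _ ⟨f, rfl, hf⟩ ⟨g, rfl, hg⟩
    refine ⟨f + g, by simp, fun t ht => ?_⟩
    rw [Polynomial.eval_add]; exact (S t).add_mem (hf t ht) (hg t ht)
  zero_mem' := ⟨0, by simp, fun t _ => by simp⟩
  smul_mem' := by
    rintro c _ ⟨f, rfl, hf⟩
    refine ⟨c • f, by simp, fun t ht => ?_⟩
    rw [Polynomial.eval_smul]; exact (S t).smul_mem _ (hf t ht)

theorem Lsub_mem {S : ℂ → Submodule ℂ A} (f : Polynomial A)
    (h : ∀ t : ℂ, t ≠ 0 → f.eval (algebraMap ℂ A t) ∈ S t) : f.coeff 0 ∈ Lsub S := ⟨f, rfl, h⟩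

theorem Lsub_div {S : ℂ → Submodule ℂ A} (f : Polynomial A)
    (h : ∀ t : ℂ, t ≠ 0 → f.eval (algebraMap ℂ A t) ∈ S t) (h0 : f.coeff 0 = 0) :
    f.coeff 1 ∈ Lsub S := by
  refine ⟨f.divX, by simp [Polynomial.coeff_divX], fun t ht => ?_⟩
  have h1 := h t ht
  rw [← Polynomial.divX_mul_X_add f, h0] at h1
  simp only [map_zero, add_zero, Polynomial.eval_mul, Polynomial.eval_X] at h1
  rw [mul_comm, ← Algebra.smul_def, Submodule.smul_mem_iff _ ht] at h1
  exact h1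

theorem Lsub_rank {S : ℂ → Submodule ℂ A} {k : ℕ} (h : RankGE ℂ k (Lsub S : Set A)) :
    ∃ t, RankGE ℂ k (S t : Set A) := by
  obtain ⟨w, hw, hi⟩ := h
  choose f hf hS using hw
  have hv : ∀ i, PC (fun t => (f i).eval (algebraMap ℂ A t)) := fun i => ⟨f i, fun t => rfl⟩
  have h0 : (fun i => (f i).eval (algebraMap ℂ A 0)) = w := by
    funext i
    rw [map_zero, ← Polynomial.coeff_zero_eq_eval_zero, hf]
  have hfin := PC.linInd hv (t0 := 0) (by rw [h0]; exact hi)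
  obtain ⟨t, ht⟩ := (hfin.union (Set.finite_singleton (0:ℂ))).exists_notMem
  simp only [Set.mem_union, Set.mem_ofPred_eq, not_or, not_not, Set.mem_singleton_iff] at ht
  exact ⟨t, _, fun i => hS i t ht.2, ht.1⟩
end limits

section hyper
/-- the hyperplane -/
def Dh (n : ℕ) : Submodule ℂ (Fin (n+1) → ℂ) := LinearMap.ker (LinearMap.proj (Fin.last n))

theorem mem_Dh {n : ℕ} {x : Fin (n+1) → ℂ} : x ∈ Dh n ↔ x (Fin.last n) = 0 := Iff.rfl

/-- the embedding -/
def gD (n : ℕ) : (Fin n → ℂ) →ₗ[ℂ] (Fin (n+1) → ℂ) where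
  toFun x := Fin.snoc (α := fun _ => ℂ) x 0
  map_add' x y := by
    ext i; refine Fin.lastCases ?_ (fun j => ?_) i <;> simp
  map_smul' c x := by
    ext i; refine Fin.lastCases ?_ (fun j => ?_) i <;> simp

theorem gD_castSucc {n : ℕ} (x : Fin n → ℂ) (i : Fin n) : gD n x i.castSucc = x i := by
  simp [gD]
theorem gD_last {n : ℕ} (x : Fin n → ℂ) : gD n x (Fin.last n) = 0 := by
  simp [gD]
theorem gD_inj (n : ℕ) : Function.Injective (gD n) := by
  intro x y h; ext i; rw [← gD_castSucc x, h, gD_castSucc]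
theorem gD_dot {n : ℕ} (x y : Fin n → ℂ) : dotB (Fin (n+1)) (gD n x) (gD n y) = dotB (Fin n) x y := by
  rw [dotB_apply, dotB_apply, Fin.sum_univ_castSucc]
  simp [gD_castSucc, gD_last]
theorem gD_surj {n : ℕ} {x : Fin (n+1) → ℂ} (hx : x ∈ Dh n) : ∃ y, gD n y = x := by
  refine ⟨fun i => x i.castSucc, ?_⟩
  ext i; refine Fin.lastCases ?_ (fun j => ?_) i
  · rw [gD_last]; exact hx.symm
  · rw [gD_castSucc]
theorem map_gD (n : ℕ) : (⊤ : Submodule ℂ (Fin n → ℂ)).map (gD n) = Dh n := by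
  ext x; constructor
  · rintro ⟨y, _, rfl⟩; exact gD_last y
  · intro hx; obtain ⟨y, rfl⟩ := gD_surj hx; exact ⟨y, trivial, rfl⟩
theorem Dh_finrank (n : ℕ) : Module.finrank ℂ (Dh n) = n := by
  rw [← map_gD, ← (Submodule.equivMapOfInjective (gD n) (gD_inj n) ⊤).finrank_eq]
  simp
theorem Dh_nd (n : ℕ) : NDW (dotB (Fin (n+1))) (Dh n) := by
  intro p hp h
  obtain ⟨y, rfl⟩ := gD_surj hp
  have : y = 0 := dotB_nd y trivial fun w _ => by rw [← gD_dot]; exact h _ (gD_last w)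
  rw [this, map_zero]

theorem sub_gD_Pow (n d : ℕ) : 
    sub (gD n) '' Pow (dotB (Fin n)) ⊤ d = Pow (dotB (Fin (n+1))) (Dh n) d := by
  ext f; constructor
  · rintro ⟨_, ⟨p, _, hp, rfl⟩, rfl⟩
    exact ⟨gD n p, gD_last p, by rw [gD_dot, hp], by rw [map_pow, sub_lf]⟩
  · rintro ⟨p, hp, hpp, rfl⟩
    obtain ⟨y, rfl⟩ := gD_surj hp
    exact ⟨_, ⟨y, trivial, by rw [← gD_dot, hpp], rfl⟩, by rw [map_pow, sub_lf]⟩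

theorem AHn.D_pow {a d : ℕ} (ha : 1 ≤ a) (hd : 2 ≤ d) (h : AHn a d) :
    RankGE ℂ (hh a d) (Pow (dotB (Fin (a+2))) (Dh (a+1)) d) := by
  have := (h.pow ha hd).map (sub (gD (a+1))).toLinearMap (sub_inj _ (gD_inj _))
  rw [← sub_gD_Pow]
  exact this

theorem AHn.D_tan {a d : ℕ} (h : AHn a d) (r : ℕ) : ∃ p : Fin r → Fin (a+2) → ℂ,
    (∀ j, p j ∈ Dh (a+1) ∧ dotB (Fin (a+2)) (p j) (p j) = 0) ∧ 
    RankGE ℂ (min (r*a) (hh a d)) (⋃ j, TanW (dotB (Fin (a+2))) (Dh (a+1)) d (p j)) := by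
  obtain ⟨p, hp, hk⟩ := h r
  refine ⟨fun j => gD _ (p j), fun j => ⟨gD_last _, by rw [gD_dot, hp]⟩, ?_⟩
  have := rank_transport (gD (a+1)) (gD_inj _) gD_dot ⊤ d _ p hk
  rwa [map_gD] at this

theorem D_Harm (a d : ℕ) (hd : 1 ≤ d) : ∃ H : Submodule ℂ (MvPolynomial (Fin (a+2)) ℂ), 
    FiniteDimensional ℂ H ∧ Module.finrank ℂ H ≤ hh a d ∧
    (∀ p ∈ Dh (a+1), dotB (Fin (a+2)) p p = 0 → TanW (dotB (Fin (a+2))) (Dh (a+1)) d p ⊆ H) := by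
  have := Harm_fin a d
  refine ⟨(Harm (Fin (a+1)) d).map (sub (gD (a+1))).toLinearMap, inferInstance, 
    (Submodule.finrank_map_le _ _).trans (finrank_Harm a d), ?_⟩
  intro p hp hpp
  obtain ⟨y, rfl⟩ := gD_surj hp
  rw [gD_dot] at hpp
  rw [← map_gD, ← sub_TanW (gD (a+1)) gD_dot]
  rintro _ ⟨f, hf, rfl⟩
  exact ⟨f, TanW_Harm hd _ y hpp hf, rfl⟩

/-- unit vector orthogonal to the hyperplane -/
noncomputable def eL (n : ℕ) : Fin (n+1) → ℂ := Pi.single (Fin.last n) 1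

theorem dot_eL {n : ℕ} (x : Fin (n+1) → ℂ) : dotB (Fin (n+1)) x (eL n) = x (Fin.last n) := 
  dotB_single x _
theorem eL_last (n : ℕ) : eL n (Fin.last n) = 1 := by simp [eL]
theorem eL_dot {n : ℕ} (x : Fin (n+1) → ℂ) : dotB (Fin (n+1)) (eL n) x = x (Fin.last n) := by
  rw [dotB_symm, dot_eL]

/-- the degeneration step -/
theorem horace_limit {a d s ε q k : ℕ} (hd : 3 ≤ d)
    (Z1 : Fin s → Fin (a+2) → ℂ) (P2 : Fin ε → Fin (a+2) → ℂ) (Z3 : Fin q → Fin (a+2) → ℂ)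
    (hZ1 : ∀ j, dotB _ (Z1 j) (Z1 j) = 0)
    (hP2 : ∀ j, P2 j ∈ Dh (a+1) ∧ dotB _ (P2 j) (P2 j) = 0)
    (hZ3 : ∀ j, Z3 j ∈ Dh (a+1) ∧ dotB _ (Z3 j) (Z3 j) = 0)
    (hZ1' : ∀ j, Z1 j (Fin.last (a+1)) ≠ 0) (hP2' : ∀ j, P2 j ≠ 0)
    (hA : RankGE ℂ (hh a d) ((⋃ j, TanW (dotB _) (Dh (a+1)) d (Z3 j)) ∪ ⋃ j, {lf (P2 j) ^ d}))
    (hB : RankGE ℂ k (((⋃ j, TanW (dotB _) ⊤ (d-1) (Z1 j)) ∪ 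
      ⋃ j, TanW (dotB _) (Dh (a+1)) (d-1) (P2 j)) ∪ ⋃ j, {lf (Z3 j) ^ (d-1)})) :
    Good (dotB (Fin (a+2))) d (s + ε + q) (hh a d + k) := by
  classical
  set B := dotB (Fin (a+2)) with hBdef
  set D := Dh (a+1) with hD
  set e := eL (a+1) with he
  set L := Fin.last (a+1) with hL
  choose c hcD hcc hpc using fun j => exists_c B dotB_symm D (Dh_nd _) (P2 j) (hP2 j).1 (hP2 j).2 (hP2' j)

  let pt : ℂ → Fin ε → Fin (a+2) → ℂ := fun t j => P2 j + t • e - (t^2/2) • c j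
  have heL : e L = 1 := eL_last _
  have hee : B e e = 1 := by rw [dot_eL]; exact heL
  have hpe : ∀ j, B (P2 j) e = 0 := fun j => by rw [dot_eL]; exact (hP2 j).1
  have hep : ∀ j, B e (P2 j) = 0 := fun j => by rw [dotB_symm]; exact hpe j
  have hce : ∀ j, B (c j) e = 0 := fun j => by rw [dot_eL]; exact hcD j
  have hec : ∀ j, B e (c j) = 0 := fun j => by rw [dotB_symm]; exact hce j
  have hcp : ∀ j, B (c j) (P2 j) = 1 := fun j => by rw [hBdef, dotB_symm]; exact hpc j
  have hpt : ∀ t j, B (pt t j) (pt t j) = 0 := by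
    intro t j
    simp only [pt, map_sub, map_add, map_smul, LinearMap.sub_apply, LinearMap.add_apply, 
      LinearMap.smul_apply, smul_eq_mul, (hP2 j).2, hpe, hep, hee, hce, hec, hpc, hcp, hcc]
    ring
  have hpt' : ∀ t j, B (pt t j) (e - t • c j) = 0 := by
    intro t j
    simp only [pt, map_sub, map_add, map_smul, LinearMap.sub_apply, LinearMap.add_apply, 
      LinearMap.smul_apply, smul_eq_mul, hpe, hee, hce, hec, hpc, hcc]
    ring
  let pts : ℂ → (Fin s ⊕ Fin ε) ⊕ Fin q → Fin (a+2) → ℂ := fun t => Sum.elim (Sum.elim Z1 (pt t)) Z3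
  let S : ℂ → Submodule ℂ (MvPolynomial (Fin (a+2)) ℂ) := fun t => 
    Submodule.span ℂ (⋃ j, TanW B ⊤ d (pts t j))
  suffices h : RankGE ℂ (hh a d + k) (Lsub S : Set (MvPolynomial (Fin (a+2)) ℂ)) by
    obtain ⟨t, ht⟩ := Lsub_rank h
    refine Good.of_fintype (J := (Fin s ⊕ Fin ε) ⊕ Fin q) (by simp) (pts t) ?_ 
      (ht.of_span (by rfl))
    rintro ((j | j) | j)
    · exact hZ1 j
    · exact hpt t j
    · exact (hZ3 j).2
  have hdd : d - 1 + 1 = d := by omega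
  -- members of S
  have mS1 : ∀ t j m, B (Z1 j) m = 0 → lf (Z1 j) ^ (d-1) * lf m ∈ S t := fun t j m hm =>
    Submodule.subset_span (Set.mem_iUnion.2 ⟨.inl (.inl j), m, trivial, hm, rfl⟩)
  have mS2 : ∀ t j m, B (pt t j) m = 0 → lf (pt t j) ^ (d-1) * lf m ∈ S t := fun t j m hm =>
    Submodule.subset_span (Set.mem_iUnion.2 ⟨.inl (.inr j), m, trivial, hm, rfl⟩)
  have mS3 : ∀ t j m, B (Z3 j) m = 0 → lf (Z3 j) ^ (d-1) * lf m ∈ S t := fun t j m hm =>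
    Submodule.subset_span (Set.mem_iUnion.2 ⟨.inr j, m, trivial, hm, rfl⟩)
  have const : ∀ x, (∀ t, x ∈ S t) → x ∈ Lsub S := fun x hx => 
    ⟨Polynomial.C x, by simp, fun t _ => by simpa using hx t⟩

  let Pt : Fin ε → Polynomial (MvPolynomial (Fin (a+2)) ℂ) := fun j => 
    Polynomial.C (lf (P2 j)) + Polynomial.X * Polynomial.C (lf e) - 
      Polynomial.X ^ 2 * Polynomial.C ((1/2 : ℂ) • lf (c j))
  have hPt : ∀ t j, (Pt j).eval (algebraMap ℂ _ t) = lf (pt t j) := by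
    intro t j
    simp only [Pt, pt, Polynomial.eval_sub, Polynomial.eval_add, Polynomial.eval_C, Polynomial.eval_mul,
          Polynomial.eval_X, Polynomial.eval_pow, lf_sub, lf_add, lf_smul,
          ← map_pow, ← Algebra.smul_def, smul_smul]
    congr 3; ring
  have hPt0 : ∀ j, (Pt j).coeff 0 = lf (P2 j) := by
    intro j; simp [Pt, Polynomial.coeff_zero_eq_eval_zero]
  have hPt1 : ∀ j, (Pt j).derivative.eval 0 = lf e := by
    intro j; simp [Pt]
  have hPte : ∀ j, (Pt j).eval 0 = lf (P2 j) := by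
    intro j; simp [Pt]
  have hPtk : ∀ j (k : ℕ), ((Pt j)^k).coeff 0 = lf (P2 j) ^ k := by
    intro j k; rw [Polynomial.coeff_zero_eq_eval_zero, Polynomial.eval_pow, hPte]
  have hPtk1 : ∀ j (k : ℕ), ((Pt j)^k).coeff 1 = (k : ℂ) • (lf (P2 j) ^ (k-1) * lf e) := by
    intro j k
    have := Polynomial.coeff_derivative ((Pt j)^k) 0
    simp only [zero_add, Nat.cast_zero, mul_one] at this
    rw [← this, Polynomial.coeff_zero_eq_eval_zero, Polynomial.derivative_pow]
    simp [hPte, hPt1, Algebra.smul_def]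
    ring
  -- p^(d-1) e in L
  have mL1 : ∀ j, lf (P2 j) ^ (d-1) * lf e ∈ Lsub S := by
    intro j
    refine ⟨(Pt j)^(d-1) * (Polynomial.C (lf e) - Polynomial.X * Polynomial.C (lf (c j))), ?_, ?_⟩
    · rw [Polynomial.mul_coeff_zero, hPtk]; simp
    · intro t _
      have := mS2 t j _ (hpt' t j)
      rw [lf_sub e, lf_smul] at this
      simpa only [Polynomial.eval_sub, Polynomial.eval_C, Polynomial.eval_mul,
          Polynomial.eval_X, Polynomial.eval_pow, hPt, ← Algebra.smul_def] using this
  set U : Set (MvPolynomial (Fin (a+2)) ℂ) := 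
    (⋃ j, TanW B D d (Z3 j)) ∪ ⋃ j, {lf (P2 j) ^ d} with hU
  -- lifting
  have lift : ∀ x ∈ Submodule.span ℂ U, ∃ f : Polynomial (MvPolynomial (Fin (a+2)) ℂ), 
      f.coeff 0 = x ∧ (∀ t : ℂ, t ≠ 0 → f.eval (algebraMap ℂ _ t) ∈ S t) ∧ f.coeff 1 ∈ Lsub S := by
    intro x hx
    induction hx using Submodule.span_induction with
    | mem x hx =>
      rcases hx with hx | hx
      · obtain ⟨j, m, hm, hpm, rfl⟩ := Set.mem_iUnion.1 hx
        refine ⟨Polynomial.C _, Polynomial.coeff_C_zero, fun t _ => ?_, ?_⟩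
        · rw [Polynomial.eval_C]; exact mS3 t j m hpm
        · rw [Polynomial.coeff_C_of_ne_zero (by norm_num)]; exact Submodule.zero_mem _
      · obtain ⟨j, hj⟩ := Set.mem_iUnion.1 hx
        rw [Set.mem_singleton_iff] at hj
        refine ⟨(Pt j)^d, by rw [hPtk, hj], fun t _ => ?_, ?_⟩
        · rw [Polynomial.eval_pow, hPt]
          have := mS2 t j _ (hpt t j)
          rwa [← pow_succ, hdd] at this
        · rw [hPtk1]; exact Submodule.smul_mem _ _ (mL1 j)
    | zero => exact ⟨0, by simp, fun t _ => by simp, by simp⟩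
    | add x y _ _ hx hy =>
      obtain ⟨f, h1, h2, h3⟩ := hx
      obtain ⟨g, h1', h2', h3'⟩ := hy
      refine ⟨f + g, by simp [h1, h1'], fun t ht => ?_, ?_⟩
      · rw [Polynomial.eval_add]; exact Submodule.add_mem _ (h2 t ht) (h2' t ht)
      · rw [Polynomial.coeff_add]; exact Submodule.add_mem _ h3 h3'
    | smul r x _ hx =>
      obtain ⟨f, h1, h2, h3⟩ := hx
      refine ⟨r • f, by simp [h1], fun t ht => ?_, ?_⟩
      · rw [Polynomial.eval_smul]; exact Submodule.smul_mem _ _ (h2 t ht)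
      · rw [Polynomial.coeff_smul]; exact Submodule.smul_mem _ _ h3
  -- U spans harmonic polynomials on D
  obtain ⟨H, hHfin, hHrank, hHT⟩ := D_Harm a d (by omega)
  have hUH : U ⊆ H := by
    intro x hx
    rcases hx with hx | hx
    · obtain ⟨j, hj⟩ := Set.mem_iUnion.1 hx
      exact hHT _ (hZ3 j).1 (hZ3 j).2 hj
    · obtain ⟨j, hj⟩ := Set.mem_iUnion.1 hx
      rw [Set.mem_singleton_iff] at hj
      exact hHT _ (hP2 j).1 (hP2 j).2 ⟨P2 j, (hP2 j).1, (hP2 j).2, by rw [hj, ← pow_succ, hdd]⟩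
  have hspan : Submodule.span ℂ U = H := RankGE.span_eq hA H hUH hHrank
  -- p^(d-2) e w in L
  have mL2 : ∀ j w, w ∈ D → B (P2 j) w = 0 → B (c j) w = 0 → 
      lf (P2 j) ^ (d-2) * lf e * lf w ∈ Lsub S := by
    intro j w hw hpw hcw
    have hew : B e w = 0 := by rw [eL_dot]; exact hw
    have hx : lf (P2 j) ^ (d-1) * lf w ∈ Submodule.span ℂ U := by
      rw [hspan]; exact hHT _ (hP2 j).1 (hP2 j).2 ⟨w, hw, hpw, rfl⟩
    obtain ⟨f, h1, h2, h3⟩ := lift _ hx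
    have h4 : ((Pt j)^(d-1) * Polynomial.C (lf w) - f).coeff 1 ∈ Lsub S := by
      apply Lsub_div
      · intro t ht
        rw [Polynomial.eval_sub, Polynomial.eval_mul, Polynomial.eval_pow, hPt, Polynomial.eval_C]
        refine Submodule.sub_mem _ (mS2 t j w ?_) (h2 t ht)
        simp only [pt, map_sub, map_add, map_smul, LinearMap.sub_apply, LinearMap.add_apply, 
          LinearMap.smul_apply, smul_eq_mul, hpw, hew, hcw]
        ring
      · rw [Polynomial.coeff_sub, Polynomial.mul_coeff_zero, hPtk, h1]; simp
    rw [Polynomial.coeff_sub] at h4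
    have h5 := Submodule.add_mem _ h4 h3
    rw [sub_add_cancel, Polynomial.coeff_mul_C, hPtk1, smul_mul_assoc] at h5
    have h6 : ((d - 1 : ℕ) : ℂ) ≠ 0 := by exact_mod_cast (by omega : d - 1 ≠ 0)
    rw [Submodule.smul_mem_iff _ h6] at h5
    exact h5
  -- conclusion
  have hlast : ∀ x ∈ D, x L = 0 := fun x hx => hx
  refine RankGE.add (pderiv L).toLinearMap (u := U) ?_ ?_ hA ?_
  · intro x hx
    obtain ⟨f, h1, h2, h3⟩ := lift x (Submodule.subset_span hx)
    exact Submodule.subset_span ⟨f, h1, h2⟩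
  · intro x hx
    rcases hx with hx | hx
    · obtain ⟨j, m, hm, hpm, rfl⟩ := Set.mem_iUnion.1 hx
      change pderiv L _ = 0
      rw [pderiv_pow_mul_lf, hlast _ hm, hlast _ (hZ3 j).1]; simp
    · obtain ⟨j, hj⟩ := Set.mem_iUnion.1 hx
      rw [Set.mem_singleton_iff] at hj
      change pderiv L _ = 0
      rw [hj, pderiv_pow_lf, hlast _ (hP2 j).1]; simp
  · refine hB.of_span ?_
    have hmap : Submodule.span ℂ ((pderiv L).toLinearMap '' (Lsub S : Set (MvPolynomial (Fin (a+2)) ℂ))) = 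
        (Lsub S).map (pderiv L).toLinearMap := by
      rw [Submodule.span_image, Submodule.span_eq]
    rw [hmap]
    have img : ∀ x ∈ Lsub S, pderiv L x ∈ (Lsub S).map (pderiv L).toLinearMap := fun x hx => ⟨x, hx, rfl⟩
    have hpowP : ∀ j, lf (P2 j) ^ (d-1) ∈ (Lsub S).map (pderiv L).toLinearMap := by
      intro j
      have := img _ (mL1 j)
      rw [pderiv_pow_mul_lf, hlast _ (hP2 j).1, heL] at this
      simpa using this
    intro x hx
    rcases hx with (hx | hx) | hx
    · obtain ⟨j, m, hm, hpm, rfl⟩ := Set.mem_iUnion.1 hx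
      have h1 := img _ (const _ fun t => mS1 t j _ (hZ1 j))
      rw [← pow_succ, hdd, pderiv_pow_lf] at h1
      have hd0 : (d : ℂ) ≠ 0 := by exact_mod_cast (by omega : d ≠ 0)
      rw [Submodule.smul_mem_iff _ (mul_ne_zero hd0 (hZ1' j))] at h1
      have h2 := img _ (const _ fun t => mS1 t j m hpm)
      rw [pderiv_pow_mul_lf] at h2
      have h3 := (Submodule.add_mem_iff_left _ (Submodule.smul_mem _ (m L) h1)).1 h2
      have hd1 : ((d-1 : ℕ) : ℂ) ≠ 0 := by exact_mod_cast (by omega : d-1 ≠ 0)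
      rw [Submodule.smul_mem_iff _ (mul_ne_zero hd1 (hZ1' j))] at h3
      exact h3
    · obtain ⟨j, m, hm, hpm, rfl⟩ := Set.mem_iUnion.1 hx
      set m' := m - B m (c j) • P2 j with hm'
      have hm'D : m' ∈ D := D.sub_mem hm (D.smul_mem _ (hP2 j).1)
      have e1 : m = m' + B m (c j) • P2 j := by rw [hm']; abel
      have h1 := img _ (mL2 j m' hm'D (by simp [hm', hpm, (hP2 j).2]) (by
        rw [hm', map_sub, map_smul, hcp]
        have : B (c j) m = B m (c j) := dotB_symm _ _
        rw [this]; simp))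
      have e2 : pderiv L (lf (P2 j) ^ (d-2) * lf e * lf m') = lf (P2 j) ^ (d-2) * lf m' := by
        rw [pderiv_mul, pderiv_pow_mul_lf, pderiv_lf, hlast _ hm'D, hlast _ (hP2 j).1, heL]
        simp
      rw [e2] at h1
      have h2 := Submodule.smul_mem _ (B m (c j)) (hpowP j)
      have h3 := Submodule.add_mem _ h1 h2
      rw [SetLike.mem_coe]
      convert h3 using 1
      conv_lhs => rw [e1]
      rw [lf_add, mul_add, lf_smul, mul_smul_comm, show d - 1 - 1 = d - 2 by omega, ← pow_succ,
        show d - 2 + 1 = d - 1 by omega]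
    · obtain ⟨j, hj⟩ := Set.mem_iUnion.1 hx
      rw [Set.mem_singleton_iff] at hj
      have h1 := img _ (const _ fun t => mS3 t j e (by rw [dot_eL]; exact (hZ3 j).1))
      rw [pderiv_pow_mul_lf, hlast _ (hZ3 j).1, heL] at h1
      rw [hj]
      simpa using h1

end hyper
end AH

set_option linter.unusedSectionVars false
set_option linter.style.haveILetI false

namespace AH
open MvPolynomial

theorem isom_inj {ι κ : Type} [Fintype ι] [Fintype κ] (g : (ι → ℂ) →ₗ[ℂ] (κ → ℂ))
    (hg : ∀ x y, dotB κ (g x) (g y) = dotB ι x y) : Function.Injective g := by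
  rw [← LinearMap.ker_eq_bot, LinearMap.ker_eq_bot']
  intro x hx
  apply dotB_nd x trivial
  intro w _
  rw [← hg, hx]; simp

theorem exists_reflect {ι : Type} [Fintype ι] (u : ι → ℂ) (hu : dotB ι u u ≠ 0) :
    ∃ g : (ι → ℂ) →ₗ[ℂ] (ι → ℂ), (∀ x y, dotB ι (g x) (g y) = dotB ι x y) ∧ 
      ∀ x, g x = x - (2 * dotB ι u x / dotB ι u u) • u := by
  refine ⟨LinearMap.id - ((2 / dotB ι u u) • (dotB ι u)).smulRight u, ?_, ?_⟩
  · intro x y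
    simp only [LinearMap.sub_apply, LinearMap.id_apply, LinearMap.smulRight_apply, 
      LinearMap.smul_apply, map_sub, map_smul, smul_eq_mul, dotB_symm x u]
    field_simp
    ring
  · intro x
    simp only [LinearMap.sub_apply, LinearMap.id_apply, LinearMap.smulRight_apply, 
      LinearMap.smul_apply, smul_eq_mul]
    congr 2; ring

theorem exists_to_eL {n : ℕ} (w : Fin (n+1) → ℂ) (hw : dotB _ w w ≠ 0) :
    ∃ g : (Fin (n+1) → ℂ) →ₗ[ℂ] (Fin (n+1) → ℂ), (∀ x y, dotB _ (g x) (g y) = dotB _ x y) ∧ 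
      ∀ x, dotB _ w x = 0 → g x ∈ Dh n := by
  obtain ⟨s, hs⟩ := IsAlgClosed.exists_pow_nat_eq (dotB _ w w) (n := 2) (by norm_num)
  have hs0 : s ≠ 0 := by rintro rfl; apply hw; rw [← hs]; simp
  set e := s • eL n with he
  have hee : dotB _ e e = s^2 := by
    simp [he, dot_eL, eL_last]; ring
  have hew : dotB _ e w = dotB _ w e := dotB_symm _ _
  -- reduction
  have red : ∀ g : (Fin (n+1) → ℂ) →ₗ[ℂ] (Fin (n+1) → ℂ), (∀ x y, dotB _ (g x) (g y) = dotB _ x y) → 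
      ∀ σ : ℂ, σ ≠ 0 → g w = σ • e → ∀ x, dotB _ w x = 0 → g x ∈ Dh n := by
    intro g hg σ hσ hgw x hx
    rw [← hg, hgw, he] at hx
    simp only [map_smul, LinearMap.smul_apply, smul_eq_mul, eL_dot] at hx
    rw [mem_Dh]
    rcases mul_eq_zero.1 hx with h | h
    · exact absurd h hσ
    · exact (mul_eq_zero.1 h).resolve_left hs0
  by_cases h1 : dotB _ (w - e) (w - e) = 0
  · have h2 : dotB _ (w + e) (w + e) = 4 * s^2 := by
      simp only [map_sub, map_add, LinearMap.sub_apply, LinearMap.add_apply, hee, hew, ← hs] at h1 ⊢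
      linear_combination -h1
    have h3 : dotB _ (w + e) (w + e) ≠ 0 := by
      rw [h2]; exact mul_ne_zero (by norm_num) (pow_ne_zero _ hs0)
    obtain ⟨g, hg, hgx⟩ := exists_reflect (w + e) h3
    refine ⟨g, hg, red g hg (-1) (by norm_num) ?_⟩
    have h4 : 2 * dotB _ (w + e) w / dotB _ (w + e) (w + e) = 1 := by
      rw [div_eq_one_iff_eq h3]
      simp only [map_add, LinearMap.add_apply, hee, hew, ← hs]; ring
    rw [hgx, h4]; simp
  · obtain ⟨g, hg, hgx⟩ := exists_reflect (w - e) h1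
    refine ⟨g, hg, red g hg 1 one_ne_zero ?_⟩
    have h4 : 2 * dotB _ (w - e) w / dotB _ (w - e) (w - e) = 1 := by
      rw [div_eq_one_iff_eq h1]
      simp only [map_sub, LinearMap.sub_apply, hee, hew, ← hs]; ring
    rw [hgx, h4]; simp

/-- generalized cross product, as a functional -/
noncomputable def crossL {n : ℕ} (v : Fin n → Fin (n+1) → ℂ) : (Fin (n+1) → ℂ) →ₗ[ℂ] ℂ :=
  (Matrix.detRowAlternating (R := ℂ) (n := Fin (n+1))).toMultilinearMap.toLinearMap 
    (Fin.snoc (α := fun _ => Fin (n+1) → ℂ) v 0) (Fin.last n)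

theorem crossL_apply {n : ℕ} (v : Fin n → Fin (n+1) → ℂ) (x) : crossL v x = 
    Matrix.det (Matrix.of (Fin.snoc (α := fun _ => Fin (n+1) → ℂ) v x)) := by
  have : Function.update (Fin.snoc (α := fun _ => Fin (n+1) → ℂ) v 0) (Fin.last n) x = 
      Fin.snoc (α := fun _ => Fin (n+1) → ℂ) v x := Fin.update_snoc_last ..
  simp only [crossL, MultilinearMap.toLinearMap_apply, this]
  rfl

theorem crossL_self {n : ℕ} (v : Fin n → Fin (n+1) → ℂ) (i : Fin n) : crossL v (v i) = 0 := by
  rw [crossL_apply]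
  apply Matrix.det_zero_of_row_eq (i := i.castSucc) (j := Fin.last n) (Fin.castSucc_lt_last i).ne
  change Fin.snoc (α := fun _ => Fin (n+1) → ℂ) v (v i) i.castSucc = 
    Fin.snoc (α := fun _ => Fin (n+1) → ℂ) v (v i) (Fin.last n)
  rw [Fin.snoc_castSucc, Fin.snoc_last]

noncomputable def cross {n : ℕ} (v : Fin n → Fin (n+1) → ℂ) : Fin (n+1) → ℂ := 
  fun k => crossL v (Pi.single k 1)

theorem cross_dot {n : ℕ} (v : Fin n → Fin (n+1) → ℂ) (x) : dotB _ (cross v) x = crossL v x := by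
  have hx : x = ∑ i, x i • Pi.single i (1:ℂ) := by
    ext j; simp [Pi.single_apply]
  conv_rhs => rw [hx]
  rw [map_sum, dotB_apply]
  refine Finset.sum_congr rfl fun i _ => ?_
  rw [map_smul, smul_eq_mul, mul_comm]; rfl

/-- isotropic vectors span -/
theorem iso_span {n : ℕ} (hn : 2 ≤ n) : RankGE ℂ n {x : Fin n → ℂ | dotB _ x x = 0} := by
  have : Submodule.span ℂ {x : Fin n → ℂ | dotB _ x x = 0} = ⊤ := by
    rw [eq_top_iff]
    intro x _
    have hx : x = ∑ i, x i • Pi.single i (1:ℂ) := by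
      ext j; simp [Pi.single_apply]
    rw [hx]
    refine Submodule.sum_mem _ fun k _ => Submodule.smul_mem _ _ ?_
    have : Nontrivial (Fin n) := Fin.nontrivial_iff_two_le.2 hn
    obtain ⟨l, hl⟩ := exists_ne k
    have hs : ∀ σ : ℂ, σ ^ 2 = -1 → (Pi.single k 1 + σ • Pi.single l 1 : Fin n → ℂ) ∈ 
        {x : Fin n → ℂ | dotB _ x x = 0} := by
      intro σ hσ
      simp [dotB_single, hl, hl.symm]
      linear_combination hσ
    have h1 := Submodule.subset_span (R := ℂ) (hs Complex.I Complex.I_sq)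
    have h2 := Submodule.subset_span (R := ℂ) (hs (-Complex.I) (by simp))
    have h3 := Submodule.smul_mem _ (1/2 : ℂ) (Submodule.add_mem _ h1 h2)
    convert h3 using 1
    ext i; simp; ring
  apply rankGE_of_le_finrank
  rw [this]; simp

theorem exists_cross {n : ℕ} (hn : 2 ≤ n) : ∃ v : Fin n → Fin (n+1) → ℂ, 
    (∀ i, dotB _ (v i) (v i) = 0) ∧ dotB _ (cross v) (cross v) ≠ 0 := by
  obtain ⟨w, hw, hi⟩ := iso_span hn
  refine ⟨fun i => gD n (w i), fun i => by rw [gD_dot]; exact hw i, ?_⟩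
  set v := fun i => gD n (w i) with hv
  have h1 : ∀ x ∈ Dh n, crossL v x = 0 := by
    intro x hx
    obtain ⟨y, rfl⟩ := gD_surj hx
    have hy : y ∈ Submodule.span ℂ (Set.range w) := by
      rw [hi.span_eq_top_of_card_eq_finrank' (by simp)]; trivial
    clear hx
    induction hy using Submodule.span_induction with
    | mem x hx => obtain ⟨i, rfl⟩ := hx; exact crossL_self v i
    | zero => simp
    | add x y _ _ hx hy => rw [map_add, map_add, hx, hy, add_zero]
    | smul c x _ hx => rw [map_smul, map_smul, hx, smul_zero]
  have h2 : crossL v (eL n) ≠ 0 := by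
    rw [crossL_apply]
    have hli : LinearIndependent ℂ (Fin.snoc (α := fun _ => Fin (n+1) → ℂ) v (eL n)) := by
      rw [linearIndependent_finSnoc]
      refine ⟨hi.map' (gD n) (LinearMap.ker_eq_bot.2 (gD_inj n)), ?_⟩
      intro hmem
      have : Submodule.span ℂ (Set.range v) ≤ Dh n := by
        rw [Submodule.span_le]; rintro _ ⟨i, rfl⟩; exact gD_last _
      have := this hmem
      rw [mem_Dh, eL_last] at this
      exact one_ne_zero this
    have hu : IsUnit (Matrix.of (Fin.snoc (α := fun _ => Fin (n+1) → ℂ) v (eL n))) := 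
      Matrix.linearIndependent_rows_iff_isUnit.1 hli
    rw [Matrix.isUnit_iff_isUnit_det] at hu
    exact hu.ne_zero
  have h3 : cross v = crossL v (eL n) • eL n := by
    ext k
    refine Fin.lastCases ?_ (fun j => ?_) k
    · simp [eL_last]; rfl
    · have : cross v j.castSucc = 0 := h1 _ (by rw [mem_Dh]; simp)
      rw [this]; simp [eL]
  rw [h3]
  simp [dot_eL, eL_last, h2]

theorem cross_PF {n : ℕ} {J : Type} (f : Fin n → J) : 
    PF (fun p : J → Fin (n+1) → ℂ => dotB _ (cross fun i => p (f i)) (cross fun i => p (f i))) := by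
  intro c hc
  simp only [dotB_apply, cross, crossL_apply]
  refine PC.sum _ fun k => ?_
  have : PC (fun t => Matrix.det (Matrix.of (Fin.snoc (α := fun _ => Fin (n+1) → ℂ) 
      (fun i => c t (f i)) (Pi.single k 1)))) := by
    apply PC.det
    intro i j
    refine Fin.lastCases ?_ (fun i => ?_) i
    · simp only [Matrix.of_apply, Fin.snoc_last]; exact PC.const _
    · simp only [Matrix.of_apply, Fin.snoc_castSucc]; exact hc _ _
  exact this.mul this

theorem top_finrank (n : ℕ) : Module.finrank ℂ (⊤ : Submodule ℂ (Fin n → ℂ)) = n := by simp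

/-- putting some of the points on the hyperplane -/
theorem exists_E1' {n d s ε : ℕ} (hn : 2 ≤ n) (hd : 4 ≤ d) (hε : ε ≤ n)
    (h1 : AHn n (d-1)) (hle : (s + ε) * n ≤ hh n (d-1))
    (h2 : Good (dotB (Fin (n+1))) (d-2) s (hh n (d-2))) :
    ∃ (Z1 : Fin s → Fin (n+1) → ℂ) (P2 : Fin ε → Fin (n+1) → ℂ), 
      (∀ j, dotB _ (Z1 j) (Z1 j) = 0) ∧ (∀ j, P2 j ∈ Dh n ∧ dotB _ (P2 j) (P2 j) = 0) ∧
      RankGE ℂ ((s+ε)*n) ((⋃ j, TanW (dotB _) ⊤ (d-1) (Z1 j)) ∪ ⋃ j, TanW (dotB _) ⊤ (d-1) (P2 j)) ∧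
      RankGE ℂ (hh n (d-2)) (⋃ j, TanW (dotB _) ⊤ (d-2) (Z1 j)) := by
  classical
  let J := Fin s ⊕ Fin n
  let B := dotB (Fin (n+1))
  let X := XW B (fun _ : J => ⊤)
  have hX : ∀ (p : J → Fin (n+1) → ℂ), (∀ j, B (p j) (p j) = 0) → p ∈ X := fun p hp j => ⟨trivial, hp j⟩
  have o1 : OpenC X (fun p => RankGE ℂ ((s+ε)*n) ((⋃ j : Fin s, TanW B ⊤ (d-1) (p (.inl j))) ∪ 
      ⋃ j : Fin ε, TanW B ⊤ (d-1) (p (.inr (Fin.castLE hε j))))) := by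
    apply PGen.openC
    apply PGen.union <;> apply PGen.iUnion <;> intro j <;> 
      exact PGen.tan X B ⊤ dotB_nd (d-1) (by omega) _ (fun p _ => trivial)
  have o2 : OpenC X (fun p => RankGE ℂ (hh n (d-2)) (⋃ j : Fin s, TanW B ⊤ (d-2) (p (.inl j)))) := by
    apply PGen.openC
    apply PGen.iUnion
    intro j
    exact PGen.tan X B ⊤ dotB_nd (d-2) (by omega) _ (fun p _ => trivial)
  have o3 : OpenC X (fun p => B (cross fun i => p (.inr i)) (cross fun i => p (.inr i)) ≠ 0) :=
    OpenC.ne (cross_PF (J := J) Sum.inr)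
  have e1 : ∃ p ∈ X, RankGE ℂ ((s+ε)*n) ((⋃ j : Fin s, TanW B ⊤ (d-1) (p (.inl j))) ∪ 
      ⋃ j : Fin ε, TanW B ⊤ (d-1) (p (.inr (Fin.castLE hε j)))) := by
    obtain ⟨p, hp, hk⟩ := h1 (s + ε)
    rw [min_eq_left hle] at hk
    refine ⟨Sum.elim (fun j => p (Fin.castAdd ε j)) (fun k => if h : k < ε then p (Fin.natAdd s ⟨k, h⟩) else 0), ?_, ?_⟩
    · apply hX
      rintro (j | j)
      · exact hp _
      · simp only [Sum.elim_inr]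
        split_ifs
        · exact hp _
        · simp
    · refine hk.mono ?_
      intro x hx
      obtain ⟨j, hj⟩ := Set.mem_iUnion.1 hx
      refine Fin.addCases (fun i hj => ?_) (fun i hj => ?_) j hj
      · exact Or.inl (Set.mem_iUnion.2 ⟨i, hj⟩)
      · refine Or.inr (Set.mem_iUnion.2 ⟨i, ?_⟩)
        beta_reduce
        rw [Sum.elim_inr, dif_pos (by simp)]
        exact hj
  have e2 : ∃ p ∈ X, RankGE ℂ (hh n (d-2)) (⋃ j : Fin s, TanW B ⊤ (d-2) (p (.inl j))) := by
    obtain ⟨p, hp, hk⟩ := h2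
    refine ⟨Sum.elim p 0, ?_, ?_⟩
    · apply hX
      rintro (j | j)
      · exact hp _
      · simp
    · exact hk
  have e3 : ∃ p ∈ X, B (cross fun i => p (.inr i)) (cross fun i => p (.inr i)) ≠ 0 := by
    obtain ⟨v, hv, hc⟩ := exists_cross hn
    refine ⟨Sum.elim 0 v, ?_, hc⟩
    apply hX
    rintro (j | j)
    · simp
    · exact hv j
  have hfr : ∀ j : J, 3 ≤ Module.finrank ℂ (⊤ : Submodule ℂ (Fin (n+1) → ℂ)) := by
    intro j; rw [top_finrank]; omega
  obtain ⟨p, hpX, ⟨r1, r2⟩, r3⟩ := exists_and B dotB_symm _ (fun _ => dotB_nd) hfr (o1.and o2) o3 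
    (exists_and B dotB_symm _ (fun _ => dotB_nd) hfr o1 o2 e1 e2) e3
  obtain ⟨g, hg, hgD⟩ := exists_to_eL _ r3
  have ginj := isom_inj g hg
  have gtop : (⊤ : Submodule ℂ (Fin (n+1) → ℂ)).map g = ⊤ := by
    rw [Submodule.map_top, LinearMap.range_eq_top]
    exact LinearMap.surjective_of_injective ginj
  refine ⟨fun j => g (p (.inl j)), fun j => g (p (.inr (Fin.castLE hε j))), ?_, ?_, ?_, ?_⟩
  · intro j; rw [hg]; exact (hpX _).2
  · intro j
    refine ⟨hgD _ ?_, by rw [hg]; exact (hpX _).2⟩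
    rw [cross_dot]
    exact crossL_self (fun i => p (.inr i)) (Fin.castLE hε j)
  · have := rank_transport (J := Fin s ⊕ Fin ε) (B' := B) g ginj hg ⊤ (d-1) ((s+ε)*n) 
      (Sum.elim (fun j => p (.inl j)) (fun j => p (.inr (Fin.castLE hε j)))) (r1.mono (by
        rw [Set.iUnion_sum]; exact subset_rfl))
    rw [gtop] at this
    refine this.mono ?_
    rw [Set.iUnion_sum]; exact subset_rfl
  · have := rank_transport (B' := B) g ginj hg ⊤ (d-2) _ _ r2
    rwa [gtop] at this

end AH

set_option linter.unusedSectionVars false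
set_option linter.style.haveILetI false

namespace AH
open MvPolynomial

theorem exists_E1 {a d s ε : ℕ} (ha : 2 ≤ a) (hd : 4 ≤ d) (hε : ε ≤ a+1)
    (h1 : AHn (a+1) (d-1)) (hle : (s + ε) * (a+1) ≤ hh (a+1) (d-1))
    (h2 : Good (dotB (Fin (a+2))) (d-2) s (hh (a+1) (d-2))) :
    ∃ (Z1 : Fin s → Fin (a+2) → ℂ) (P2 : Fin ε → Fin (a+2) → ℂ), 
      (∀ j, dotB _ (Z1 j) (Z1 j) = 0) ∧ (∀ j, P2 j ∈ Dh (a+1) ∧ dotB _ (P2 j) (P2 j) = 0) ∧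
      RankGE ℂ (s*(a+1)+ε*a) ((⋃ j, TanW (dotB _) ⊤ (d-1) (Z1 j)) ∪ ⋃ j, TanW (dotB _) (Dh (a+1)) (d-1) (P2 j)) ∧
      RankGE ℂ (hh (a+1) (d-2)) (⋃ j, TanW (dotB _) ⊤ (d-2) (Z1 j)) := by
  obtain ⟨Z1, P2, e1, e2, e3, e4⟩ := exists_E1' (n := a+1) (s := s) (ε := ε) (by omega) hd hε h1 hle h2
  refine ⟨Z1, P2, e1, e2, ?_, e4⟩
  rw [show (s + ε) * (a+1) = (s*(a+1)+ε*a) + ε by ring] at e3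
  let M := Submodule.span ℂ (Set.range fun j => lf (P2 j) ^ (d-2) * lf (eL (a+1)))
  have : FiniteDimensional ℂ M := FiniteDimensional.span_of_finite ℂ (Set.finite_range _)
  refine e3.drop M ?_ ?_
  · have := finrank_range_le_card (R := ℂ) (fun j => lf (P2 j) ^ (d-2) * lf (eL (a+1)))
    simpa [Set.finrank] using this
  · rintro f (hf | hf)
    · exact Submodule.mem_sup_left (Submodule.subset_span (Or.inl hf))
    · obtain ⟨j, hj⟩ := Set.mem_iUnion.1 hf
      obtain ⟨m, -, hm, rfl⟩ := hj
      have hmm : m = (m - m (Fin.last _) • eL (a+1)) + m (Fin.last _) • eL (a+1) := by simp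
      rw [hmm, lf_add, mul_add]
      refine Submodule.add_mem _ (Submodule.mem_sup_left (Submodule.subset_span (Or.inr ?_))) 
        (Submodule.mem_sup_right ?_)
      · refine Set.mem_iUnion.2 ⟨j, _, ?_, ?_, rfl⟩
        · rw [mem_Dh]; simp [eL_last]
        · have : P2 j (Fin.last _) = 0 := (e2 j).1
          simp [hm, dot_eL, this]
      · rw [lf_smul, mul_smul_comm]
        exact Submodule.smul_mem _ _ (Submodule.subset_span ⟨j, by rw [show d - 1 - 1 = d - 2 by omega]⟩)

theorem deriv_tan {n d : ℕ} (hd : 3 ≤ d) (p : Fin (n+1) → ℂ) (hp : dotB _ p p = 0) 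
    (h0 : p (Fin.last n) ≠ 0) : TanW (dotB _) ⊤ (d-1) p ⊆ 
      Submodule.span ℂ ((pderiv (Fin.last n)).toLinearMap '' TanW (dotB _) ⊤ d p) := by
  have key : ∀ m : Fin (n+1) → ℂ, dotB _ p m = 0 → 
      (((d-1 : ℕ) : ℂ) * p (Fin.last n)) • (lf p ^ (d-2) * lf m) + m (Fin.last n) • lf p ^ (d-1) ∈ 
      Submodule.span ℂ ((pderiv (Fin.last n)).toLinearMap '' TanW (dotB _) ⊤ d p) := by
    intro m hm
    refine Submodule.subset_span ⟨lf p ^ (d-1) * lf m, ⟨m, trivial, hm, rfl⟩, ?_⟩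
    exact pderiv_pow_mul_lf _ _ _ _
  have hpp : lf p ^ (d-1) ∈ 
      Submodule.span ℂ ((pderiv (Fin.last n)).toLinearMap '' TanW (dotB _) ⊤ d p) := by
    have h := key p hp
    rw [← pow_succ, show d - 2 + 1 = d - 1 by omega, ← add_smul] at h
    rwa [Submodule.smul_mem_iff] at h
    rw [← add_one_mul]
    refine mul_ne_zero ?_ h0
    exact Nat.cast_add_one_ne_zero (d-1)
  rintro _ ⟨m, -, hm, rfl⟩
  have h := Submodule.sub_mem _ (key m hm) (Submodule.smul_mem _ (m (Fin.last n)) hpp)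
  rw [add_sub_cancel_right, Submodule.smul_mem_iff] at h
  · rwa [show d - 1 - 1 = d - 2 by omega]
  · refine mul_ne_zero ?_ h0
    rw [Nat.cast_ne_zero]; omega

theorem hh_succ (n d : ℕ) : hh (n+1) (d+1) = hh n (d+1) + hh (n+1) d := by simp [hh]

/-- filling up with powers in a linear subspace -/
theorem fill_pow {N : ℕ} {W : Submodule ℂ (Fin N → ℂ)} {d a b : ℕ} {U : Set (MvPolynomial (Fin N) ℂ)}
    (hU : RankGE ℂ a U) (hb : RankGE ℂ b (U ∪ Pow (dotB _) W d)) (q : ℕ) :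
    ∃ Z : Fin q → Fin N → ℂ, (∀ j, Z j ∈ W ∧ dotB _ (Z j) (Z j) = 0) ∧ 
      RankGE ℂ (min (a + q) b) (U ∪ ⋃ j, {lf (Z j) ^ d}) := by
  by_cases hab : b ≤ a
  · refine ⟨0, fun j => ⟨W.zero_mem, by simp⟩, ?_⟩
    exact (hU.le (by omega)).mono Set.subset_union_left
  · obtain ⟨w, hw, hk⟩ := RankGE.greedy hU hb (min q (b - a)) (by omega) 
      ⟨lf 0 ^ d, 0, W.zero_mem, by simp, rfl⟩
    choose z hzW hz hzw using hw
    refine ⟨fun j => if h : (j : ℕ) < min q (b - a) then z ⟨j, h⟩ else 0, ?_, ?_⟩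
    · intro j
      beta_reduce
      split_ifs with h
      · exact ⟨hzW _, hz _⟩
      · exact ⟨W.zero_mem, by simp⟩
    · refine (hk.le (by omega)).mono ?_
      rintro f (hf | ⟨i, rfl⟩)
      · exact Or.inl hf
      · refine Or.inr (Set.mem_iUnion.2 ⟨⟨i, by omega⟩, ?_⟩)
        beta_reduce
        rw [dif_pos i.2]
        exact hzw i

theorem horace_gen {a d s ε q : ℕ} (ha : 2 ≤ a) (hd : 4 ≤ d) (hε : ε ≤ a)
    (hq : q * a + ε = hh a d)
    (hAa : AHn a d) (hAa' : AHn a (d-1))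
    (h1 : AHn (a+1) (d-1)) (hle : (s + ε) * (a+1) ≤ hh (a+1) (d-1))
    (h2 : Good (dotB (Fin (a+2))) (d-2) s (hh (a+1) (d-2))) :
    Good (dotB (Fin (a+2))) d (s + ε + q) (min ((s + ε + q) * (a+1)) (hh (a+1) d)) := by
  classical
  let J := (Fin s ⊕ Fin ε) ⊕ Fin q
  let B := dotB (Fin (a+2))
  let W : J → Submodule ℂ (Fin (a+2) → ℂ) := Sum.elim (Sum.elim (fun _ => ⊤) (fun _ => Dh (a+1))) (fun _ => Dh (a+1))
  let X := XW B W
  have hW : ∀ j, NDW B (W j) := by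
    rintro ((j | j) | j)
    · exact dotB_nd
    · exact Dh_nd _
    · exact Dh_nd _
  have h3 : ∀ j, 3 ≤ Module.finrank ℂ (W j) := by
    rintro ((j | j) | j)
    · change 3 ≤ Module.finrank ℂ (⊤ : Submodule ℂ (Fin (a+2) → ℂ)); rw [top_finrank]; omega
    · change 3 ≤ Module.finrank ℂ (Dh (a+1)); rw [Dh_finrank]; omega
    · change 3 ≤ Module.finrank ℂ (Dh (a+1)); rw [Dh_finrank]; omega
  have hX : ∀ (z1 : Fin s → Fin (a+2) → ℂ) (p2 : Fin ε → Fin (a+2) → ℂ) (z3 : Fin q → Fin (a+2) → ℂ),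
      (∀ j, B (z1 j) (z1 j) = 0) → (∀ j, p2 j ∈ Dh (a+1) ∧ B (p2 j) (p2 j) = 0) → 
      (∀ j, z3 j ∈ Dh (a+1) ∧ B (z3 j) (z3 j) = 0) → (Sum.elim (Sum.elim z1 p2) z3 : J → _) ∈ X := by
    rintro z1 p2 z3 e1 e2 e3 ((j | j) | j)
    · exact ⟨trivial, e1 j⟩
    · exact e2 j
    · exact e3 j
  -- the four conditions
  let PA : (J → Fin (a+2) → ℂ) → Prop := fun p => RankGE ℂ (hh a d) 
    ((⋃ j : Fin q, TanW B (Dh (a+1)) d (p (.inr j))) ∪ ⋃ j : Fin ε, {lf (p (.inl (.inr j))) ^ d})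
  let U : (J → Fin (a+2) → ℂ) → Set (MvPolynomial (Fin (a+2)) ℂ) := fun p => 
    (⋃ j : Fin s, TanW B ⊤ (d-1) (p (.inl (.inl j)))) ∪ 
      ⋃ j : Fin ε, TanW B (Dh (a+1)) (d-1) (p (.inl (.inr j)))
  let PB : (J → Fin (a+2) → ℂ) → Prop := fun p => RankGE ℂ (min (s*(a+1)+ε*a + q) (hh (a+1) (d-1)))
    (U p ∪ ⋃ j : Fin q, {lf (p (.inr j)) ^ (d-1)})
  let PU : (J → Fin (a+2) → ℂ) → Prop := fun p => RankGE ℂ (s*(a+1)+ε*a) (U p)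
  let PV : (J → Fin (a+2) → ℂ) → Prop := fun p => RankGE ℂ (hh (a+1) (d-2)) 
    (⋃ j : Fin s, TanW B ⊤ (d-2) (p (.inl (.inl j))))
  let PC1 : (J → Fin (a+2) → ℂ) → Prop := fun p => ∀ j : Fin s, p (.inl (.inl j)) (Fin.last (a+1)) ≠ 0
  let PC2 : (J → Fin (a+2) → ℂ) → Prop := fun p => ∀ j : Fin ε, p (.inl (.inr j)) 0 ≠ 0
  have pfpow : ∀ (j : J) (e : ℕ), PF (fun p : J → Fin (a+2) → ℂ => lf (p j) ^ e) := fun j e c hc =>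
    (lf_PC fun i => hc j i).pow e
  have pU : PGen X U := by
    apply PGen.union <;> apply PGen.iUnion <;> intro j
    · exact PGen.tan X B ⊤ dotB_nd (d-1) (by omega) _ (fun p _ => trivial)
    · exact PGen.tan X B _ (Dh_nd _) (d-1) (by omega) (.inl (.inr j)) (fun p hp => (hp (.inl (.inr j))).1)
  have oA : OpenC X PA := by
    apply PGen.openC
    apply PGen.union <;> apply PGen.iUnion <;> intro j
    · exact PGen.tan X B _ (Dh_nd _) d (by omega) (.inr j) (fun p hp => (hp (.inr j)).1)
    · exact PGen.single X (pfpow _ _)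
  have oB : OpenC X PB := by
    apply PGen.openC
    exact pU.union (PGen.iUnion fun j => PGen.single X (pfpow _ _))
  have oU : OpenC X PU := pU.openC _
  have oV : OpenC X PV := by
    apply PGen.openC
    apply PGen.iUnion
    intro j
    exact PGen.tan X B ⊤ dotB_nd (d-2) (by omega) _ (fun p _ => trivial)
  have oC1 : OpenC X PC1 := OpenC.forall fun j => OpenC.ne fun c hc => hc _ _
  have oC2 : OpenC X PC2 := OpenC.forall fun j => OpenC.ne fun c hc => hc _ _
  have eU : ∃ p ∈ X, PU p ∧ PV p := by
    obtain ⟨Z1, P2, e1, e2, e3, e4⟩ := exists_E1 ha hd (by omega) h1 hle h2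
    exact ⟨Sum.elim (Sum.elim Z1 P2) 0, hX _ _ _ e1 e2 (fun j => ⟨Submodule.zero_mem _, by simp⟩), e3, e4⟩
  have eC : ∃ p ∈ X, PC1 p ∧ PC2 p := by
    have i0 : (0 : Fin (a+2)) ≠ Fin.last (a+1) := by simp [Fin.ext_iff]
    have i1 : (1 : Fin (a+2)) ≠ Fin.last (a+1) := by 
      rw [Ne, Fin.ext_iff, Fin.val_last, Fin.val_one]; omega
    have i2 : (0 : Fin (a+2)) ≠ 1 := by simp
    refine ⟨Sum.elim (Sum.elim (fun _ => Pi.single 0 1 + Complex.I • Pi.single (Fin.last (a+1)) 1) 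
      (fun _ => Pi.single 0 1 + Complex.I • Pi.single 1 1)) 0, hX _ _ _ ?_ ?_ ?_, ?_, ?_⟩
    · intro j; simp [B, dotB_single, i0, i0.symm]
    · intro j
      refine ⟨?_, ?_⟩
      · rw [mem_Dh]; simp [i0, i0.symm, i1, i1.symm]
      · simp [B, dotB_single, i2, i2.symm]
    · exact fun j => ⟨Submodule.zero_mem _, by simp⟩
    · intro j; simp [i0, i0.symm]
    · intro j; simp [i2, i2.symm]
  have eUVC := exists_and B dotB_symm W hW h3 (oU.and oV) (oC1.and oC2) eU eC
  have eB : ∃ p ∈ X, PB p := by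
    obtain ⟨p, hp, ⟨hpU, hpV⟩, hp1, hp2⟩ := eUVC
    have hb : RankGE ℂ (hh (a+1) (d-1)) (U p ∪ Pow B (Dh (a+1)) (d-1)) := by
      have e1 : hh (a+1) (d-1) = hh a (d-1) + hh (a+1) (d-2) := by
        obtain ⟨e, rfl⟩ : ∃ e, d = e + 2 := ⟨d-2, by omega⟩
        exact hh_succ a e
      rw [e1]
      refine RankGE.add (pderiv (Fin.last (a+1))).toLinearMap (u := Pow B (Dh (a+1)) (d-1)) ?_ ?_ 
        (hAa'.D_pow (by omega) (by omega)) ?_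
      · exact fun x hx => Submodule.subset_span (Or.inr hx)
      · rintro _ ⟨p, hpD, -, rfl⟩
        change pderiv (Fin.last (a+1)) (lf p ^ (d-1)) = 0
        have : p (Fin.last (a+1)) = 0 := hpD
        rw [pderiv_pow_lf, this]; simp
      · refine RankGE.of_span hpV ?_
        intro x hx
        obtain ⟨j, hj⟩ := Set.mem_iUnion.1 hx
        have := deriv_tan (d := d-1) (by omega) _ (hp (.inl (.inl j))).2 (hp1 j) hj
        refine Submodule.span_mono ?_ this
        refine Set.image_mono ?_
        exact fun y hy => Or.inl (Or.inl (Set.mem_iUnion.2 ⟨j, hy⟩))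
    obtain ⟨Z, hZ, hk⟩ := fill_pow hpU hb q
    exact ⟨Sum.elim (fun j => p (.inl j)) Z, by 
      rintro ((j | j) | j)
      · exact hp _
      · exact hp _
      · exact hZ j, hk⟩
  have eA : ∃ p ∈ X, PA p := by
    obtain ⟨z3, hz3, hk⟩ := hAa.D_tan q
    rw [min_eq_left (by omega)] at hk
    obtain ⟨Z, hZ, hk'⟩ := fill_pow hk ((hAa.D_pow (by omega) (by omega)).mono Set.subset_union_right) ε
    refine ⟨Sum.elim (Sum.elim 0 Z) z3, hX _ _ _ (fun j => by simp) hZ hz3, ?_⟩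
    rw [min_eq_right (by omega)] at hk'
    exact hk'
  obtain ⟨p, hp, ⟨hA, hB⟩, hC1, hC2⟩ := exists_and B dotB_symm W hW h3 (oA.and oB) (oC1.and oC2) 
    (exists_and B dotB_symm W hW h3 oA oB eA eB) eC
  have := horace_limit (d := d) (by omega) (fun j => p (.inl (.inl j))) (fun j => p (.inl (.inr j))) 
    (fun j => p (.inr j)) (fun j => (hp (.inl (.inl j))).2) (fun j => hp (.inl (.inr j))) 
    (fun j => hp (.inr j)) hC1 (fun j h => hC2 j (by rw [h]; rfl)) hA hB
  refine this.le ?_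
  have e1 : hh (a+1) d = hh a d + hh (a+1) (d-1) := by
    obtain ⟨e, rfl⟩ : ∃ e, d = e + 1 := ⟨d-1, by omega⟩
    exact hh_succ a e
  have e2 : (s + ε + q) * (a+1) = hh a d + (s*(a+1) + ε*a + q) := by rw [← hq]; ring
  rw [e1, e2]
  omega

end AH

set_option linter.unusedSectionVars false
set_option linter.style.haveILetI false

namespace AH
open MvPolynomial

theorem hh_zero_right (n : ℕ) : hh n 0 = 1 := by cases n <;> simp [hh]
theorem hh_zero_left (d : ℕ) : hh 0 (d+2) = 0 := by simp [hh]
theorem hh_d1 (n : ℕ) : hh n 1 = n + 1 := by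
  induction n with
  | zero => simp [hh]
  | succ n ih => rw [hh_succ, ih, hh_zero_right]
theorem hh_d2 (n : ℕ) : 2 * hh n 2 = n * (n+3) := by
  induction n with
  | zero => simp [hh]
  | succ n ih => rw [hh_succ, mul_add, ih, hh_d1]; ring
theorem hh_d3 (n : ℕ) : 6 * hh n 3 = n * (n+1) * (n+5) := by
  induction n with
  | zero => simp [hh]
  | succ n ih => 
    rw [hh_succ, mul_add, ih]
    have := hh_d2 (n+1)
    linear_combination 3 * this
theorem hh_d4 (n : ℕ) : 24 * hh n 4 = n * (n+1) * (n+2) * (n+7) := by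
  induction n with
  | zero => simp [hh]
  | succ n ih => 
    rw [hh_succ, mul_add, ih]
    have := hh_d3 (n+1)
    linear_combination 4 * this
theorem hh_d5 (n : ℕ) : 120 * hh n 5 = n * (n+1) * (n+2) * (n+3) * (n+9) := by
  induction n with
  | zero => simp [hh]
  | succ n ih => 
    rw [hh_succ, mul_add, ih]
    have := hh_d4 (n+1)
    linear_combination 5 * this

theorem hh_mono (a d : ℕ) : hh (a+1) d ≤ hh (a+1) (d+1) := by
  rw [hh_succ]; omega

theorem hh_mono' (a : ℕ) {d e : ℕ} (h : d ≤ e) : hh (a+1) d ≤ hh (a+1) e :=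
  monotone_nat_of_le_succ (hh_mono a) h

theorem hh_growth (b d : ℕ) : hh b (d+1) ≤ (b+1) * hh b d := by
  induction b generalizing d with
  | zero => 
    rcases d with _ | _ | d <;> simp [hh]
  | succ b ihb =>
    induction d with
    | zero => rw [hh_d1, hh_zero_right]; omega
    | succ d ihd =>
      rw [hh_succ b (d+1)]
      have h1 := ihb (d+1)
      have h2 := hh_succ b d
      rw [h2] at ihd ⊢
      nlinarith

theorem hh_ineq (a : ℕ) (ha : 3 ≤ a) (d : ℕ) : a * a * a + hh a (d+5) ≤ a * hh a (d+4) := by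
  induction d with
  | zero =>
    have h4 := hh_d4 a
    have h5 := hh_d5 a
    obtain ⟨b, rfl⟩ : ∃ b, a = b + 3 := ⟨a-3, by omega⟩
    simp only [zero_add]
    zify at h4 h5 ⊢
    have hb : (0:ℤ) ≤ b := by positivity
    have : 120 * (((b:ℤ)+3)*(b+3)*(b+3) + hh (b+3) 5) ≤ 120 * ((b+3) * hh (b+3) 4) := by
      have e : 120 * (((b:ℤ)+3) * hh (b+3) 4) = 5 * (b+3) * (24 * hh (b+3) 4) := by ring
      rw [mul_add, h5, e, h4]
      have : (0:ℤ) ≤ 4 * b^5 + 4*b^4 := by positivity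
      have h1 : (0:ℤ) ≤ b^5 := by positivity
      have h2 : (0:ℤ) ≤ b^4 := by positivity
      have h3 : (0:ℤ) ≤ b^3 := by positivity
      have h4 : (0:ℤ) ≤ b^2 := by positivity
      nlinarith
    linarith
  | succ d ih =>
    obtain ⟨b, rfl⟩ : ∃ b, a = b + 1 := ⟨a-1, by omega⟩
    have e1 := hh_succ b (d+5)
    have e2 := hh_succ b (d+4)
    have e3 := hh_growth b (d+5)
    rw [show d + 1 + 5 = d + 5 + 1 by ring, e1, show d + 1 + 4 = d + 4 + 1 by ring]
    have e4 : (b+1) * hh (b+1) (d+4+1) = (b+1) * hh b (d+5) + (b+1) * hh (b+1) (d+4) := by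
      rw [e2]; ring
    rw [e4]
    have e5 : hh b (d+4+1+1) = hh b (d+5+1) := rfl
    have e6 : hh (b+1) (d+4+1) = hh (b+1) (d+5) := rfl
    linarith

/-- quadrics -/
theorem rank_quad (n : ℕ) : RankGE ℂ (hh n 2 + 1) 
    {f : MvPolynomial (Fin (n+1)) ℂ | ∃ i j, f = X i * X j} := by
  classical
  let m : Sym2 (Fin (n+1)) → (Fin (n+1) →₀ ℕ) := fun z => Multiset.toFinsupp (Sym2.equivSym _ z : Multiset _)
  have hm : Function.Injective m := by
    intro x y h
    have h1 := Multiset.toFinsupp.injective h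
    exact (Sym2.equivSym _).injective (Sym.coe_injective h1)
  have hli := (basisMonomials (Fin (n+1)) ℂ).linearIndependent.comp m hm
  have hc : Fintype.card (Sym2 (Fin (n+1))) = hh n 2 + 1 := by
    rw [Sym2.card, Fintype.card_fin]
    have h1 := hh_d2 n
    have h2 : (n+1+1).choose 2 * 2 = (n+2)*(n+1) := by
      rw [Nat.choose_two_right, Nat.div_mul_cancel]
      · simp
      · exact (Nat.even_mul_pred_self _).two_dvd
    have : (n+1+1).choose 2 * 2 = (hh n 2 + 1) * 2 := by rw [h2]; linarith
    omega
  let e := Fintype.equivFinOfCardEq hc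
  refine ⟨_, ?_, hli.comp e.symm e.symm.injective⟩
  intro i
  generalize hz : e.symm i = z
  simp only [Function.comp, hz]
  induction z using Sym2.ind with
  | _ x y =>
    refine ⟨x, y, ?_⟩
    have : m s(x, y) = Finsupp.single x 1 + Finsupp.single y 1 := by
      simp only [m]
      change Multiset.toFinsupp (x ::ₘ y ::ₘ 0) = _
      rw [← Multiset.singleton_add, map_add, Multiset.toFinsupp_singleton]
      congr 1
      exact Multiset.toFinsupp_singleton y
    rw [this]
    simp [X, monomial_mul]

theorem good_quad_pts {n : ℕ} (hn : 2 ≤ n) : ∃ p : Fin (n+1) → Fin (n+1) → ℂ, 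
    (∀ j, dotB _ (p j) (p j) = 0) ∧ (∀ i j, i ≠ j → dotB _ (p i) (p j) ≠ 0) ∧ LinearIndependent ℂ p := by
  classical
  let B := dotB (Fin (n+1))
  let J := Fin (n+1)
  let X := XW B (fun _ : J => ⊤)
  have hfr : ∀ j : J, 3 ≤ Module.finrank ℂ (⊤ : Submodule ℂ (Fin (n+1) → ℂ)) := by
    intro j; rw [top_finrank]; omega
  let P1 : (J → Fin (n+1) → ℂ) → Prop := fun p => (Matrix.of p).det ≠ 0
  let P2 : (J × J) → (J → Fin (n+1) → ℂ) → Prop := fun ij p => ij.1 ≠ ij.2 → B (p ij.1) (p ij.2) ≠ 0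
  have o1 : OpenC X P1 := OpenC.ne fun c hc => PC.det fun i j => hc i j
  have o2 : ∀ ij, OpenC X (P2 ij) := by
    intro ij
    by_cases h : ij.1 = ij.2
    · intro c _ _ t0 _
      have : {t | ¬ P2 ij (c t)} = ∅ := by ext t; simp [P2, h]
      rw [this]; exact Set.finite_empty
    · have : P2 ij = fun p => B (p ij.1) (p ij.2) ≠ 0 := by funext p; simp [P2, h]
      rw [this]
      refine OpenC.ne fun c hc => ?_
      simp only [B, dotB_apply]
      exact PC.sum _ fun k => (hc _ _).mul (hc _ _)
  have e1 : ∃ p ∈ X, P1 p := by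
    obtain ⟨w, hw, hi⟩ := iso_span (n := n+1) (by omega)
    refine ⟨w, fun j => ⟨trivial, hw j⟩, ?_⟩
    have hu : IsUnit (Matrix.of w) := Matrix.linearIndependent_rows_iff_isUnit.1 hi
    rw [Matrix.isUnit_iff_isUnit_det] at hu
    exact hu.ne_zero
  have e2 : ∀ ij, ∃ p ∈ X, P2 ij p := by
    intro ij
    have i2 : (0 : Fin (n+1)) ≠ 1 := by
      clear * - hn
      obtain ⟨m, hm⟩ : ∃ m, n = m + 1 := ⟨n-1, by omega⟩
      subst hm; exact Fin.zero_ne_one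
    refine ⟨fun j => if j = ij.1 then Pi.single 0 1 + Complex.I • Pi.single 1 1 else 
      Pi.single 0 1 - Complex.I • Pi.single 1 1, ?_, ?_⟩
    · intro j
      refine ⟨trivial, ?_⟩
      beta_reduce
      split_ifs <;> simp [B, dotB_single, i2, i2.symm]
    · intro h
      beta_reduce
      rw [if_pos rfl, if_neg (Ne.symm h)]
      simp [B, dotB_single, i2, i2.symm]
  obtain ⟨p, hp, h1, h2⟩ := exists_and B dotB_symm _ (fun _ => dotB_nd) hfr o1 (OpenC.forall o2) e1 
    (exists_forall B dotB_symm _ (fun _ => dotB_nd) hfr o2 e2)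
  refine ⟨p, fun j => (hp j).2, fun i j hij => h2 (i, j) hij, ?_⟩
  have : IsUnit (Matrix.of p) := by
    rw [Matrix.isUnit_iff_isUnit_det]; exact isUnit_iff_ne_zero.2 h1
  exact Matrix.linearIndependent_rows_iff_isUnit.2 this

theorem good_quad {n s : ℕ} (hn : 2 ≤ n) (hs : n + 1 ≤ s) : Good (dotB (Fin (n+1))) 2 s (hh n 2) := by
  classical
  refine Good.up (r := n+1) ?_ hs
  obtain ⟨p, hp, hb, hli⟩ := good_quad_pts hn
  refine ⟨p, hp, ?_⟩
  let g : (Fin (n+1) → ℂ) →ₗ[ℂ] (Fin (n+1) → ℂ) := Fintype.linearCombination ℂ p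
  have hg : Function.Injective g := hli.fintypeLinearCombination_injective
  have hr := (rank_quad n).map (sub g).toLinearMap (sub_inj g hg)
  have i2 : (0 : Fin (n+1)) ≠ 1 := by
      clear * - hn
      obtain ⟨m, hm⟩ : ∃ m, n = m + 1 := ⟨n-1, by omega⟩
      subst hm; exact Fin.zero_ne_one
  let M := Submodule.span ℂ {lf (p 0) * lf (p 1)}
  have : FiniteDimensional ℂ M := FiniteDimensional.span_of_finite ℂ (Set.finite_singleton _)
  refine hr.drop M (by simpa using finrank_span_le_card (R := ℂ) {lf (p 0) * lf (p 1)}) ?_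
  let S := Submodule.span ℂ (⋃ j, TanW (dotB (Fin (n+1))) ⊤ 2 (p j))
  have gX : ∀ i, sub g (X i) = lf (p i) := by
    intro i
    rw [← lf_single i, sub_lf]
    congr 1
    simp [g, Fintype.linearCombination_apply, Pi.single_apply]
  have hS : ∀ i m, dotB _ (p i) m = 0 → lf (p i) * lf m ∈ S ⊔ M := by
    intro i m hm
    refine Submodule.mem_sup_left (Submodule.subset_span (Set.mem_iUnion.2 ⟨i, m, trivial, hm, ?_⟩))
    simp
  have step : ∀ i j k, i ≠ j → lf (p i) * lf (p j) ∈ S ⊔ M → lf (p i) * lf (p k) ∈ S ⊔ M := by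
    intro i j k hij hmem
    have h1 := hS i (dotB _ (p i) (p j) • p k - dotB _ (p i) (p k) • p j) (by simp; ring)
    rw [lf_sub, lf_smul, lf_smul, mul_sub, mul_smul_comm, mul_smul_comm] at h1
    have h2 := Submodule.add_mem _ h1 (Submodule.smul_mem _ (dotB _ (p i) (p k)) hmem)
    rw [sub_add_cancel, Submodule.smul_mem_iff _ (hb i j hij)] at h2
    exact h2
  have h01 : lf (p 0) * lf (p 1) ∈ S ⊔ M := Submodule.mem_sup_right (Submodule.mem_span_singleton_self _)
  have h0 : ∀ k, lf (p 0) * lf (p k) ∈ S ⊔ M := fun k => step 0 1 k i2 h01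
  rintro _ ⟨_, ⟨i, j, rfl⟩, rfl⟩
  change sub g (X i * X j) ∈ S ⊔ M
  rw [map_mul, gX, gX]
  by_cases hi : i = 0
  · rw [hi]; exact h0 j
  · refine step i 0 j hi ?_
    rw [mul_comm]; exact h0 i

/-- Horace step, `d ≥ 5`. -/
theorem step5 {a d : ℕ} (ha : 2 ≤ a) (hd : 5 ≤ d) (hAa : AHn a d) (hAa' : AHn a (d-1))
    (h1 : AHn (a+1) (d-1)) (h2 : AHn (a+1) (d-2)) : AHn (a+1) d := by
  refine AHn_of_mid (by omega) (by omega) fun r hr1 hr2 => ?_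
  obtain ⟨q, ε, hε, hq⟩ : ∃ q ε, ε < a ∧ q * a + ε = hh a d := 
    ⟨hh a d / a, hh a d % a, Nat.mod_lt _ (by omega), Nat.div_add_mod' _ _⟩
  have e1 : hh (a+1) d = hh a d + hh (a+1) (d-1) := by
    obtain ⟨e, rfl⟩ : ∃ e, d = e + 1 := ⟨d-1, by omega⟩
    exact hh_succ a e
  have e2 : hh (a+1) (d-1) = hh a (d-1) + hh (a+1) (d-2) := by
    obtain ⟨e, rfl⟩ : ∃ e, d = e + 2 := ⟨d-2, by omega⟩
    exact hh_succ a e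
  have i1 : 2 * a - 1 ≤ q := by
    have h4 := hh_d4 a
    have : hh a 4 ≤ hh a d := by
      obtain ⟨b, rfl⟩ : ∃ b, a = b + 1 := ⟨a-1, by omega⟩
      exact hh_mono' b (by omega)
    by_contra hlt
    push Not at hlt
    obtain ⟨b, rfl⟩ : ∃ b, a = b + 2 := ⟨a-2, by omega⟩
    have : q ≤ 2 * b + 2 := by omega
    have : q * (b+2) ≤ (2*b+2) * (b+2) := Nat.mul_le_mul_right _ this
    nlinarith [Nat.zero_le b, sq_nonneg (b:ℤ)]
  have i2 : q + ε * a + a ≤ hh a (d-1) := by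
    by_cases ha2 : a = 2
    · subst ha2
      rw [hh_two] at hq ⊢
      omega
    · obtain ⟨e, rfl⟩ : ∃ e, d = e + 5 := ⟨d-5, by omega⟩
      have := hh_ineq a (by omega) e
      rw [show e + 5 - 1 = e + 4 by omega]
      have h3 : ε * a + a ≤ a * a := by nlinarith
      have h4 : a * (q + a * a) ≤ a * hh a (e+4) := by nlinarith
      have := Nat.le_of_mul_le_mul_left h4 (by omega)
      omega
  have i3 : hh (a+1) (d-2) + (ε + q) * (a+1) ≤ r * (a+1) := by
    have : (ε + q) * (a+1) = hh a d + (q + ε * a) := by rw [← hq]; ring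
    omega
  have i4 : ε + q ≤ r := by
    by_contra hlt
    push Not at hlt
    have : r * (a+1) < (ε+q) * (a+1) := Nat.mul_lt_mul_of_pos_right hlt (by omega)
    omega
  obtain ⟨s, rfl⟩ : ∃ s, r = s + ε + q := ⟨r - (ε+q), by omega⟩
  refine horace_gen ha (by omega) hε.le hq hAa hAa' h1 ?_ ?_
  · have : (s + ε + q) * (a+1) = (s+ε)*(a+1) + (q * a + q) := by ring
    omega
  · have h := h2 s
    have : (s + ε + q) * (a+1) = s*(a+1) + (ε + q) * (a+1) := by ring
    rwa [min_eq_right (by omega)] at h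

theorem step4 {a : ℕ} (ha : 5 ≤ a) (hAa : AHn a 4) (hAa' : AHn a 3)
    (h1 : AHn (a+1) 3) : AHn (a+1) 4 := by
  refine AHn_of_mid (by omega) (by omega) fun r hr1 hr2 => ?_
  obtain ⟨q, ε, hε, hq⟩ : ∃ q ε, ε < a ∧ q * a + ε = hh a 4 := 
    ⟨hh a 4 / a, hh a 4 % a, Nat.mod_lt _ (by omega), Nat.div_add_mod' _ _⟩
  have e1 : hh (a+1) 4 = hh a 4 + hh (a+1) 3 := hh_succ a 3
  have e2 : hh (a+1) 3 = hh a 3 + hh (a+1) 2 := hh_succ a 2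
  have d2 := hh_d2 (a+1)
  have d3 := hh_d3 a
  have d4 := hh_d4 a
  have i1 : 2 * a - 1 ≤ q := by
    by_contra hlt
    push Not at hlt
    obtain ⟨b, rfl⟩ : ∃ b, a = b + 5 := ⟨a-5, by omega⟩
    have : q ≤ 2 * b + 8 := by omega
    have : q * (b+5) ≤ (2*b+8) * (b+5) := Nat.mul_le_mul_right _ this
    nlinarith [Nat.zero_le b, sq_nonneg (b:ℤ)]
  have i3 : ε + q + (a+2) ≤ r := by
    by_cases h5 : a = 5
    · subst h5; omega
    by_cases h6 : a = 6
    · subst h6; omega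
    obtain ⟨b, rfl⟩ : ∃ b, a = b + 7 := ⟨a-7, by omega⟩
    by_contra hlt
    push Not at hlt
    have j1 : 24 * q ≤ (b+8) * (b+9) * (b+14) := by
      have : (b+7) * (24 * q) ≤ (b+7) * ((b+8) * (b+9) * (b+14)) := by nlinarith
      exact Nat.le_of_mul_le_mul_left this (by omega)
    have j2 : r * (b+7+1) ≤ (ε + q + (b + 7 + 1)) * (b+7+1) := Nat.mul_le_mul_right _ (by omega)
    have j3 : (ε + q + (b + 7 + 1)) * (b+7+1) = hh (b+7) 4 + q + ε * (b+7) + (b+8)*(b+8) := by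
      rw [← hq]; ring
    have j4 : ε * (b+7) ≤ (b+6) * (b+7) := Nat.mul_le_mul_right _ (by omega)
    nlinarith
  obtain ⟨s, rfl⟩ : ∃ s, r = s + ε + q := ⟨r - (ε+q), by omega⟩
  refine horace_gen (by omega) (by omega) hε.le hq hAa hAa' h1 ?_ ?_
  · have : (s + ε + q) * (a+1) = (s+ε)*(a+1) + (q * a + q) := by ring
    simp only [Nat.reduceSub]
    omega
  · exact good_quad (by omega) (by omega)

theorem AHn_all (H3 : ∀ n, 3 ≤ n → AHn n 3) (H34 : AHn 3 4) (H44 : AHn 4 4) (H54 : AHn 5 4) 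
    (n d : ℕ) (hn : 1 ≤ n) (hd : 3 ≤ d) : AHn n d := by
  induction n using Nat.strong_induction_on generalizing d with
  | _ n ihn =>
    rcases eq_or_ne n 1 with rfl | n1
    · exact AHn_one (by omega)
    rcases eq_or_ne n 2 with rfl | n2
    · exact AHn_two (by omega)
    obtain ⟨a, rfl⟩ : ∃ a, n = a + 1 := ⟨n-1, by omega⟩
    induction d using Nat.strong_induction_on with
    | _ d ihd =>
      rcases eq_or_ne d 3 with rfl | d3
      · exact H3 _ (by omega)
      rcases eq_or_ne d 4 with rfl | d4
      · rcases eq_or_ne a 2 with rfl | a2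
        · exact H34
        rcases eq_or_ne a 3 with rfl | a3
        · exact H44
        rcases eq_or_ne a 4 with rfl | a4
        · exact H54
        exact step4 (by omega) (ihn a (by omega) 4 (by omega) (by omega)) 
          (ihn a (by omega) 3 (by omega) (by omega)) (H3 _ (by omega))
      exact step5 (by omega) (by omega) (ihn a (by omega) d (by omega) (by omega)) 
          (ihn a (by omega) (d-1) (by omega) (by omega)) (ihd _ (by omega) (by omega)) 
          (ihd _ (by omega) (by omega))

end AH

set_option linter.unusedSectionVars false
namespace AH
open MvPolynomial

/-! A kernel-friendly rank algorithm modulo 7 -/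

/-- evaluate a natural number before using it; the number is stored together with a checksum in
the low bits, because hashing of literals only uses these -/
def force {α : Type} (n : ℕ) (f : ℕ → α) : α :=
  Nat.rec (f 0) (fun k _ => f (Nat.shiftRight (Nat.succ k) 32))
    (Nat.add (Nat.shiftLeft n 32) (Nat.mod n 4294967291))

/-- one reduction step modulo 7 in every lane of 14 bits -/
def red (M x : ℕ) : ℕ :=
  force x fun x => Nat.sub x (Nat.mul 7 (Nat.land (Nat.shiftRight x 3) M))

def lane (x s : ℕ) : ℕ := Nat.land (Nat.shiftRight x s) 7

/-- eliminate with one pivot -/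
def estep (M : ℕ) (s π y : ℕ) : ℕ :=
  Nat.rec y (fun k _ => red M (red M (Nat.add y (Nat.mul (Nat.succ k) π)))) (lane y s)

def ered (M : ℕ) (ps : List (ℕ × ℕ)) (x : ℕ) : ℕ :=
  List.rec x (fun q _ ih => force ih fun y => estep M q.1 q.2 y) ps

/-- guess for a pivot position: binary search for the top nonzero lane -/
def pos0 (M1 y : ℕ) : ℕ :=
  force (Nat.sub y (Nat.mul 7 (Nat.land (Nat.shiftRight (Nat.add y M1) 3) M1))) fun z =>
    List.rec (fun s => s) (fun j _ ih s =>
      force (Nat.add s j) fun s' => cond (Nat.beq (Nat.shiftRight z s') 0) (ih s) (ih s'))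
      [14336, 7168, 3584, 1792, 896, 448, 224, 112, 56, 28, 14] 0

def elim (M M1 : ℕ) (rows : List ℕ) : List (ℕ × ℕ) → List (ℕ × ℕ) :=
  List.rec (fun ps => ps) (fun x _ ih ps =>
    force x fun x => force (ered M ps (red M (red M (red M (red M (red M (red M x))))))) fun y =>
      force (Nat.mul 14 (Nat.div (pos0 M1 y) 14)) fun s => force (lane y s) fun a =>
        force (Nat.mod (Nat.mul 6 (Nat.pow a 5)) 7) fun t =>
          Bool.rec (ih ps) (force (red M (red M (Nat.mul t y))) fun π => ih ((s, π) :: ps))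
            (Nat.beq (Nat.mod (Nat.mul t a) 7) 6)) rows

/-- decimal digits, modulo 7 -/
def dg (x c : ℕ) : ℕ := Nat.mod (Nat.mod (Nat.div x (Nat.pow 10 c)) 10) 7

/-- integer representative of a digit -/
def dz (x c : ℕ) : ℤ := if dg x c < 4 then dg x c else (dg x c : ℤ) - 7

def enc (b : ℕ) (f : ℕ → ℕ) (l : List ℕ) : ℕ :=
  List.rec 0 (fun c _ ih => Nat.add (f c) (Nat.mul b ih)) l

def row3 (I J K : List ℕ) (p m : ℕ → ℕ) : ℕ :=
  force (Nat.pow 16384 K.length) fun bY => force (Nat.pow bY J.length) fun bX =>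
  force (enc bX p I) fun Xp => force (enc bY p J) fun Yp => force (enc 16384 p K) fun Zp =>
    Nat.add (Nat.mul (Nat.mul Xp Yp) (enc 16384 m K)) (Nat.add (Nat.mul (Nat.mul Xp (enc bY m J)) Zp)
      (Nat.mul (Nat.mul (enc bX m I) Yp) Zp))

abbrev Blk := List ℕ × List ℕ × List ℕ

def row3s (bs : List Blk) (p m : ℕ → ℕ) : ℕ :=
  List.rec 0 (fun b _ ih => Nat.add (row3 b.1 b.2.1 b.2.2 p m)
    (Nat.mul (Nat.pow 16384 (b.1.length * (b.2.1.length * b.2.2.length))) ih)) bs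

/-- the quadratic form on a block of size `k`: `σ` swaps the coordinates in pairs, and fixes the last
coordinate of a block of odd size, which gets weight two. -/
def sg (k t : ℕ) : ℕ :=
  cond (Nat.beq (Nat.mod t 2) 1) (Nat.sub t 1) (cond (Nat.beq (Nat.succ t) k) t (Nat.succ t))

def wt (k t : ℕ) : ℕ := cond (Nat.beq (sg k t) t) 2 1

def SG (sz : ℕ → ℕ) (c : ℕ) : ℕ :=
  Nat.add (Nat.mul 7 (Nat.div c 7)) (sg (sz (Nat.div c 7)) (Nat.mod c 7))

def WT (sz : ℕ → ℕ) (c : ℕ) : ℕ := wt (sz (Nat.div c 7)) (Nat.mod c 7)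

def bp (sz : ℕ → ℕ) (x c : ℕ) : ℕ := Nat.mod (Nat.mul (WT sz c) (dg x (SG sz c))) 7

def fx0 (sz : ℕ → ℕ) (x : ℕ) (cs : List ℕ) : ℕ :=
  List.rec 0 (fun c _ ih => cond (Nat.beq (bp sz x c) 0) ih c) cs

def mN (x0 y b0 b1 c : ℕ) : ℕ :=
  Nat.add (cond (Nat.beq c y) b0 0) (cond (Nat.beq c x0) (Nat.sub 7 b1) 0)

def rowsP (sz : ℕ → ℕ) (cs : List ℕ) (F : (ℕ → ℕ) → (ℕ → ℕ) → ℕ) (x : ℕ) (tl : List ℕ) : List ℕ :=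
  force (fx0 sz x cs) fun x0 => force (bp sz x x0) fun b0 =>
    List.rec tl (fun y _ ih => force (bp sz x y) fun b1 =>
      F (dg x) (mN x0 y b0 b1) :: ih) cs

def rowsL (sz : ℕ → ℕ) (cs : List ℕ) (F : (ℕ → ℕ) → (ℕ → ℕ) → ℕ) (xs : List ℕ) : List ℕ :=
  List.rec [] (fun x _ ih => rowsP sz cs F x ih) xs

/-- repeated lanes -/
def rep (a n : ℕ) : ℕ := Nat.rec 0 (fun _ ih => Nat.add a (Nat.mul 16384 ih)) n

def lenN {α : Type} (l : List α) : ℕ := List.rec 0 (fun _ _ ih => Nat.succ ih) l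

def rankN (n : ℕ) (rows : List ℕ) : ℕ :=
  force (rep 2047 n) fun M => force (rep 1 n) fun M1 => lenN (elim M M1 rows [])

end AH

set_option linter.unusedSectionVars false
namespace AH
open MvPolynomial

theorem force_eq {α : Type} (n : ℕ) (f : ℕ → α) : force n f = f n := by
  unfold force
  have h : ∀ m : ℕ, (Nat.rec (f 0) (fun k _ => f (Nat.shiftRight (Nat.succ k) 32)) m : α) =
      f (m >>> 32) := by
    intro m; cases m with
    | zero => rfl
    | succ k => rfl
  rw [h]
  congr 1
  show (n <<< 32 + n % 4294967291) >>> 32 = n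
  rw [Nat.shiftRight_eq_div_pow, Nat.shiftLeft_eq]
  omega

theorem red_def (M x : ℕ) : red M x = x - 7 * ((x >>> 3) &&& M) := by
  unfold red; rw [force_eq]; rfl

/-- `x` has lanes `f` -/
def In (n x : ℕ) (f : ℕ → ℕ) : Prop :=
  (∀ k, n ≤ k → f k = 0) ∧ x = ∑ k ∈ Finset.range n, f k * 16384 ^ k

theorem In.shift {n x : ℕ} {f : ℕ → ℕ} (h : In (n+1) x f) :
    ∃ x', In n x' (fun k => f (k+1)) ∧ x = f 0 + 16384 * x' := by
  refine ⟨∑ k ∈ Finset.range n, f (k+1) * 16384 ^ k, ⟨fun k hk => h.1 _ (by omega), rfl⟩, ?_⟩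
  rw [h.2, Finset.sum_range_succ', Finset.mul_sum, add_comm]
  congr 1
  · simp
  · exact Finset.sum_congr rfl fun k _ => by ring

theorem In.cons {n x' : ℕ} {f : ℕ → ℕ} (h : In n x' (fun k => f (k+1))) :
    In (n+1) (f 0 + 16384 * x') f := by
  refine ⟨fun k hk => ?_, ?_⟩
  · obtain ⟨j, rfl⟩ : ∃ j, k = j + 1 := ⟨k-1, by omega⟩
    exact h.1 j (by omega)
  · rw [h.2, Finset.sum_range_succ', Finset.mul_sum, add_comm]
    congr 1
    · exact Finset.sum_congr rfl fun k _ => by ring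
    · simp

theorem In.add {n x y : ℕ} {f g : ℕ → ℕ} (h : In n x f) (h' : In n y g) (c : ℕ) :
    In n (x + c * y) (fun k => f k + c * g k) := by
  refine ⟨fun k hk => by simp [h.1 k hk, h'.1 k hk], ?_⟩
  rw [h.2, h'.2, Finset.mul_sum, ← Finset.sum_add_distrib]
  exact Finset.sum_congr rfl fun k _ => by ring

theorem In.zero (n : ℕ) : In n 0 (fun _ => 0) := ⟨fun _ _ => rfl, by simp⟩

theorem In.lane {n x : ℕ} {f : ℕ → ℕ} (h : In n x f) (hf : ∀ k, f k < 16384) (k : ℕ) :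
    AH.lane x (14 * k) = f k % 8 := by
  have e : ∀ x s, AH.lane x s = x / 2 ^ s % 8 := by
    intro x s
    show (x >>> s) &&& 7 = _
    rw [Nat.shiftRight_eq_div_pow, show (7:ℕ) = 2^3 - 1 by rfl, Nat.and_two_pow_sub_one_eq_mod]
  rw [e]
  induction k generalizing n x f with
  | zero =>
    cases n with
    | zero => rw [h.1 0 (by omega), h.2]; simp
    | succ n => obtain ⟨x', -, rfl⟩ := h.shift; simp; omega
  | succ k ih =>
    cases n with
    | zero => rw [h.1 _ (by omega), h.2]; simp
    | succ n =>
      obtain ⟨x', h', rfl⟩ := h.shift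
      have := ih h' (fun k => hf _)
      rw [← this, show 14 * (k+1) = 14 + 14 * k by ring, pow_add, ← Nat.div_div_eq_div_mul]
      congr 2
      have := hf 0
      omega

theorem land_split (a b M : ℕ) (ha : a < 16384) :
    (a + 16384 * b) &&& (2047 + 16384 * M) = a % 2048 + 16384 * (b &&& M) := by
  have h1 := Nat.and_mod_two_pow (a := a + 16384 * b) (b := 2047 + 16384 * M) (n := 14)
  have h2 := Nat.and_div_two_pow (a := a + 16384 * b) (b := 2047 + 16384 * M) (n := 14)
  have e1 : (a + 16384 * b) % 2^14 = a := by omega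
  have e2 : (2047 + 16384 * M) % 2^14 = 2^11 - 1 := by omega
  have e3 : (a + 16384 * b) / 2^14 = b := by omega
  have e4 : (2047 + 16384 * M) / 2^14 = M := by omega
  rw [e1, e2, Nat.and_two_pow_sub_one_eq_mod] at h1
  rw [e3, e4] at h2
  omega

theorem In.red_aux {n x : ℕ} {f : ℕ → ℕ} (h : In n x f) (hf : ∀ k, f k < 16384) :
    In n ((x >>> 3) &&& rep 2047 n) (fun k => f k / 8) := by
  rw [Nat.shiftRight_eq_div_pow]
  induction n generalizing x f with
  | zero =>
    have : x = 0 := by rw [h.2]; simp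
    subst this
    refine ⟨fun k hk => by simp [h.1 k hk], by simp⟩
  | succ n ih =>
    obtain ⟨x', h', rfl⟩ := h.shift
    have h2 := ih h' (fun k => hf _)
    have h0 := hf 0
    have e : (f 0 + 16384 * x') / 2^3 = (f 0 / 8 + 2048 * (x' % 8)) + 16384 * (x' / 2^3) := by omega
    have e' : rep 2047 (n+1) = 2047 + 16384 * rep 2047 n := rfl
    rw [e, e', land_split _ _ _ (by omega)]
    have e3 : (f 0 / 8 + 2048 * (x' % 8)) % 2048 = f 0 / 8 := by omega
    rw [e3]
    exact In.cons (f := fun k => f k / 8) h2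

theorem In.red {n x : ℕ} {f : ℕ → ℕ} (h : In n x f) (hf : ∀ k, f k < 16384) :
    In n (AH.red (rep 2047 n) x) (fun k => f k % 8 + f k / 8) := by
  have h1 := h.red_aux hf
  rw [red_def]
  refine ⟨fun k hk => by simp [h.1 k hk], ?_⟩
  rw [Nat.sub_eq_iff_eq_add]
  · conv_lhs => rw [h.2]
    conv_rhs => rw [h1.2]
    rw [Finset.mul_sum, ← Finset.sum_add_distrib]
    refine Finset.sum_congr rfl fun k _ => ?_
    rw [← mul_assoc, ← add_mul]
    congr 1
    beta_reduce
    omega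
  · rw [h.2]
    conv_lhs => rw [← h.2, h1.2]
    rw [Finset.mul_sum]
    refine Finset.sum_le_sum fun k _ => ?_
    rw [← mul_assoc]
    exact Nat.mul_le_mul_right _ (by beta_reduce; omega)

/-- the vector mod 7 -/
def vec (n : ℕ) (f : ℕ → ℕ) : Fin n → ZMod 7 := fun k => (f k : ZMod 7)

theorem vec_congr (n : ℕ) {f g : ℕ → ℕ} (h : ∀ k, f k % 7 = g k % 7) : vec n f = vec n g := by
  funext k
  exact (ZMod.natCast_eq_natCast_iff _ _ _).2 (h k)

theorem In.red2 {n x : ℕ} {f : ℕ → ℕ} (h : In n x f) (hf : ∀ k, f k ≤ 56) :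
    ∃ g, In n (AH.red (rep 2047 n) (AH.red (rep 2047 n) x)) g ∧ (∀ k, g k ≤ 7) ∧
      ∀ k, g k % 7 = f k % 7 := by
  have h1 := h.red fun k => by have := hf k; omega
  have h2 := h1.red fun k => by have := hf k; omega
  exact ⟨_, h2, fun k => by have := hf k; omega, fun k => by omega⟩

theorem In.red1 {n x : ℕ} {f : ℕ → ℕ} (h : In n x f) (b : ℕ) (hf : ∀ k, f k ≤ b)
    (hb : b < 16384) : ∃ g, In n (AH.red (rep 2047 n) x) g ∧ (∀ k, g k ≤ 7 + b / 8) ∧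
      ∀ k, g k % 7 = f k % 7 :=
  ⟨_, h.red fun k => (hf k).trans_lt hb, fun k => by have := hf k; omega, fun k => by omega⟩

theorem In.red6 {n x : ℕ} {f : ℕ → ℕ} (h : In n x f) (hf : ∀ k, f k < 16384) :
    ∃ g, In n (AH.red (rep 2047 n) (AH.red (rep 2047 n) (AH.red (rep 2047 n) (AH.red (rep 2047 n)
      (AH.red (rep 2047 n) (AH.red (rep 2047 n) x)))))) g ∧ (∀ k, g k ≤ 7) ∧
      ∀ k, g k % 7 = f k % 7 := by
  obtain ⟨g1, h1, b1, c1⟩ := h.red1 16383 (fun k => by have := hf k; omega) (by norm_num)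
  obtain ⟨g2, h2, b2, c2⟩ := h1.red1 _ b1 (by norm_num)
  obtain ⟨g3, h3, b3, c3⟩ := h2.red1 _ b2 (by norm_num)
  obtain ⟨g4, h4, b4, c4⟩ := h3.red1 _ b3 (by norm_num)
  obtain ⟨u, hu, hu1, hu2⟩ := h4.red2 (fun k => (b4 k).trans (by norm_num))
  exact ⟨u, hu, hu1, fun k => by rw [hu2, c4, c3, c2, c1]⟩

section
variable {n : ℕ} (S : Submodule (ZMod 7) (Fin n → ZMod 7))

def OK (x : ℕ) (f : ℕ → ℕ) : Prop := In n x f ∧ (∀ k, f k ≤ 7) ∧ vec n f ∈ S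

def Tri : List (ℕ × ℕ) → Prop
  | [] => True
  | q :: ps => Tri ps ∧ ∃ k f, q.1 = 14 * k ∧ OK S q.2 f ∧ f k = 6 ∧
      ∀ q' ∈ ps, ∀ k', q'.1 = 14 * k' → f k' % 7 = 0

theorem estep_ok {k : ℕ} {f g : ℕ → ℕ} {π y : ℕ} (hf : OK S π f) (hk : f k = 6) (hg : OK S y g) :
    ∃ g', OK S (estep (rep 2047 n) (14*k) π y) g' ∧ g' k % 7 = 0 ∧
      ∀ j, f j % 7 = 0 → g j % 7 = 0 → g' j % 7 = 0 := by
  have hl : lane y (14*k) = g k := by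
    rw [hg.1.lane (fun j => by have := hg.2.1 j; omega)]
    have := hg.2.1 k; omega
  unfold estep
  rw [hl]
  cases hgk : g k with
  | zero => exact ⟨g, hg, by omega, fun j _ h => h⟩
  | succ c =>
    obtain ⟨u, hu, hu1, hu2⟩ := (hg.1.add hf.1 (c+1)).red2 (fun j => by
      have h1 := hg.2.1 j
      have h2 := hf.2.1 j
      have h3 := hg.2.1 k
      have : (c+1) * f j ≤ 7 * 7 := Nat.mul_le_mul (by omega) h2
      omega)
    refine ⟨u, ⟨hu, hu1, ?_⟩, ?_, ?_⟩
    · rw [vec_congr n hu2]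
      have : vec n (fun j => g j + (c+1) * f j) = vec n g + ((c+1 : ℕ) : ZMod 7) • vec n f := by
        funext j; simp [vec]
      rw [this]
      exact S.add_mem hg.2.2 (S.smul_mem _ hf.2.2)
    · rw [hu2, hk, hgk]; omega
    · intro j hj1 hj2
      rw [hu2]
      simp [Nat.add_mod, Nat.mul_mod, hj1, hj2]

theorem ered_ok {ps : List (ℕ × ℕ)} (hps : Tri S ps) {g : ℕ → ℕ} {y : ℕ} (hg : OK S y g) :
    ∃ g', OK S (ered (rep 2047 n) ps y) g' ∧
      ∀ q' ∈ ps, ∀ k', q'.1 = 14 * k' → g' k' % 7 = 0 := by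
  induction ps with
  | nil => exact ⟨g, hg, by simp⟩
  | cons q ps ih =>
    obtain ⟨u, hu, hu0⟩ := ih hps.1
    obtain ⟨k, f, hq, hf, hk, h0⟩ := hps.2
    obtain ⟨v, hv, hvk, hvj⟩ := estep_ok S hf hk hu
    refine ⟨v, ?_, ?_⟩
    · have : ered (rep 2047 n) (q :: ps) y = force (ered (rep 2047 n) ps y) fun y =>
        estep (rep 2047 n) q.1 q.2 y := rfl
      rw [this, force_eq, hq]
      exact hv
    · intro q' hq' k' hk'
      rcases List.mem_cons.1 hq' with rfl | hq'
      · have : k' = k := by omega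
        rw [this]; exact hvk
      · exact hvj _ (h0 q' hq' k' hk') (hu0 q' hq' k' hk')

theorem elim_ok (M1 : ℕ) (rows : List ℕ) (hr : ∀ x ∈ rows, ∃ f, In n x f ∧ (∀ k, f k < 16384) ∧
    vec n f ∈ S) (ps : List (ℕ × ℕ)) (hps : Tri S ps) : Tri S (elim (rep 2047 n) M1 rows ps) := by
  induction rows generalizing ps with
  | nil => exact hps
  | cons x rows ih =>
    have ih' := fun ps => ih (fun x hx => hr x (List.mem_cons_of_mem _ hx)) ps
    obtain ⟨f, hf, hfb, hfv⟩ := hr x List.mem_cons_self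
    obtain ⟨g, hg, hg1, hg2⟩ := hf.red6 hfb
    obtain ⟨u, hu, hu0⟩ := ered_ok S hps (g := g) ⟨hg, hg1, by rw [vec_congr n hg2]; exact hfv⟩
    have : ∀ M, elim M M1 (x :: rows) ps = force x fun x =>
      force (ered M ps (red M (red M (red M (red M (red M (red M x))))))) fun y =>
      force (Nat.mul 14 (Nat.div (pos0 M1 y) 14)) fun s => force (lane y s) fun a =>
        force (Nat.mod (Nat.mul 6 (Nat.pow a 5)) 7) fun t =>
          Bool.rec (elim M M1 rows ps) (force (red M (red M (Nat.mul t y))) fun π =>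
            elim M M1 rows ((s, π) :: ps))
            (Nat.beq (Nat.mod (Nat.mul t a) 7) 6) := fun _ => rfl
    rw [this]
    simp only [force_eq]
    generalize ered (rep 2047 n) ps (red (rep 2047 n) (red (rep 2047 n) (red (rep 2047 n)
      (red (rep 2047 n) (red (rep 2047 n) (red (rep 2047 n) x)))))) = y at *
    generalize Nat.div (pos0 M1 y) 14 = k
    have hl : lane y (Nat.mul 14 k) = u k := by
      show lane y (14*k) = _
      rw [hu.1.lane (fun j => by have := hu.2.1 j; omega)]
      have := hu.2.1 k; omega
    rw [hl]
    have ht : Nat.mod (Nat.mul 6 (Nat.pow (u k) 5)) 7 < 7 := Nat.mod_lt _ (by norm_num)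
    generalize Nat.mod (Nat.mul 6 (Nat.pow (u k) 5)) 7 = t at *
    cases hb : Nat.beq (Nat.mod (Nat.mul t (u k)) 7) 6 with
    | false => exact ih' ps hps
    | true =>
      refine ih' _ ⟨hps, k, ?_⟩
      have hb' : (t * u k) % 7 = 6 := Nat.eq_of_beq_eq_true hb
      obtain ⟨v, hv, hv1, hv2⟩ := ((In.zero n).add hu.1 t).red2 (fun j => by
        have h1 := hu.2.1 j
        have : t * u j ≤ 6 * 7 := Nat.mul_le_mul (by omega) h1
        omega)
      refine ⟨v, rfl, ⟨?_, hv1, ?_⟩, ?_, ?_⟩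
      · rw [zero_add] at hv; exact hv
      · rw [vec_congr n hv2]
        have : vec n (fun j => 0 + t * u j) = (t : ZMod 7) • vec n u := by
          funext j; simp [vec]
        rw [this]
        exact S.smul_mem _ hu.2.2
      · have h1 := hv2 k
        have h2 := hv1 k
        simp only [zero_add] at h1
        omega
      · intro q' hq' k' hk'
        rw [hv2]
        simp [Nat.mul_mod, hu0 q' hq' k' hk']

theorem six_ne : ((6 : ℕ) : ZMod 7) ≠ 0 := by decide

theorem Tri.rank {ps : List (ℕ × ℕ)} (hps : Tri S ps) :
    ∃ w : Fin ps.length → (Fin n → ZMod 7), (∀ i, w i ∈ S) ∧ LinearIndependent (ZMod 7) w ∧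
      ∀ x ∈ Submodule.span (ZMod 7) (Set.range w),
        (∀ q ∈ ps, ∀ k : Fin n, q.1 = 14 * k → x k = 0) → x = 0 := by
  induction ps with
  | nil =>
    have : IsEmpty (Fin ([] : List (ℕ × ℕ)).length) := Fin.isEmpty
    refine ⟨fun i => (this.false i).elim, fun i => (this.false i).elim,
      linearIndependent_empty_type, ?_⟩
    intro x hx _
    simpa using hx
  | cons q ps ih =>
    obtain ⟨w, hw, hi, hz⟩ := ih hps.1
    obtain ⟨k, f, hq, hf, hk, h0⟩ := hps.2
    have : Fact (Nat.Prime 7) := ⟨by norm_num⟩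
    have hkn : k < n := by
      by_contra h
      have := hf.1.1 k (by omega)
      omega
    have hv0 : ∀ q' ∈ ps, ∀ k' : Fin n, q'.1 = 14 * k' → vec n f k' = 0 := by
      intro q' hq' k' hk'
      have := h0 q' hq' k' hk'
      exact (ZMod.natCast_eq_zero_iff _ _).2 (Nat.dvd_of_mod_eq_zero this)
    have hvk : vec n f ⟨k, hkn⟩ ≠ 0 := by
      show ((f k : ℕ) : ZMod 7) ≠ 0
      rw [hk]
      exact six_ne
    refine ⟨Fin.cons (vec n f) w, ?_, ?_, ?_⟩
    · intro i
      refine Fin.cases ?_ (fun j => ?_) i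
      · simpa using hf.2.2
      · simpa using hw j
    · refine linearIndependent_finCons.2 ⟨hi, fun hmem => hvk ?_⟩
      rw [hz _ hmem hv0]; rfl
    · intro x hx hx0
      rw [Fin.range_cons, Submodule.mem_span_insert] at hx
      obtain ⟨c, z, hz', rfl⟩ := hx
      have hz0 : z = 0 := by
        refine hz z hz' fun q' hq' k' hk' => ?_
        have h1 := hx0 q' (List.mem_cons_of_mem _ hq') k' hk'
        simpa [hv0 q' hq' k' hk'] using h1
      subst hz0
      have h1 := hx0 q List.mem_cons_self ⟨k, hkn⟩ hq
      have hc : c = 0 := by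
        simpa [hvk] using h1
      simp [hc]

end

theorem lenN_eq {α : Type} (l : List α) : lenN l = l.length := by
  induction l with
  | nil => rfl
  | cons a l ih => show Nat.succ (lenN l) = _; rw [ih]; rfl

theorem rankN_ok {n : ℕ} (s : Set (Fin n → ZMod 7)) [Fact (Nat.Prime 7)] (rows : List ℕ)
    (hr : ∀ x ∈ rows, ∃ f, In n x f ∧ (∀ k, f k < 16384) ∧ vec n f ∈ s) :
    RankGE (ZMod 7) (rankN n rows) s := by
  unfold rankN
  simp only [force_eq, lenN_eq]
  have := elim_ok (Submodule.span (ZMod 7) s) (rep 1 n) rows (fun x hx => by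
    obtain ⟨f, h1, h2, h3⟩ := hr x hx
    exact ⟨f, h1, h2, Submodule.subset_span h3⟩) [] trivial
  obtain ⟨w, hw, hi, -⟩ := this.rank
  exact RankGE.of_span (s := Set.range w) ⟨w, fun i => ⟨i, rfl⟩, hi⟩ (by rintro _ ⟨i, rfl⟩; exact hw i)

theorem rank_lift {n k : ℕ} [Fact (Nat.Prime 7)] (R : Set (Fin n → ℤ))
    (h : RankGE (ZMod 7) k ((fun r (j : Fin n) => ((r j : ℤ) : ZMod 7)) '' R)) :
    RankGE ℂ k ((fun r (j : Fin n) => ((r j : ℤ) : ℂ)) '' R) := by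
  obtain ⟨w, hw, hi⟩ := h
  choose r hr hrw using hw
  obtain ⟨g, hg⟩ := LinearMap.exists_leftInverse_of_injective (Fintype.linearCombination (ZMod 7) w)
    (LinearMap.ker_eq_bot.2 hi.fintypeLinearCombination_injective)
  have hgw : ∀ i, g (w i) = Pi.single i 1 := by
    intro i
    have := LinearMap.congr_fun hg (Pi.single i 1)
    simpa using this
  let A : Matrix (Fin k) (Fin n) ℤ := Matrix.of r
  let b : Matrix (Fin n) (Fin k) ℤ := Matrix.of fun j l => ((g (Pi.single j 1) l).val : ℤ)
  have hAB : (A * b).map (Int.castRingHom (ZMod 7)) = 1 := by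
    ext i l
    have h1 : w i = ∑ j, w i j • (Pi.single j (1 : ZMod 7) : Fin n → ZMod 7) := by
      funext t; simp [Finset.sum_apply, Pi.single_apply]
    have h2 := congrFun (hgw i) l
    rw [h1, map_sum, Finset.sum_apply] at h2
    simp only [map_smul, Pi.smul_apply, smul_eq_mul] at h2
    rw [Matrix.map_apply, Matrix.mul_apply, map_sum, Matrix.one_apply]
    trans ∑ j, w i j * g (Pi.single j 1) l
    · refine Finset.sum_congr rfl fun j _ => ?_
      rw [map_mul, ← hrw]
      simp [A, b]
    · rw [h2, Pi.single_apply]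
      simp only [eq_comm]
  have hdet : (A * b).det ≠ 0 := by
    intro h0
    have := congrArg Matrix.det hAB
    rw [← RingHom.mapMatrix_apply, ← RingHom.map_det, h0] at this
    simp at this
  have hdetC : ((A * b).map (Int.castRingHom ℂ)).det ≠ 0 := by
    rw [← RingHom.mapMatrix_apply, ← RingHom.map_det]
    simpa using hdet
  refine ⟨fun i => (fun r (j : Fin n) => ((r j : ℤ) : ℂ)) (r i), fun i => ⟨_, hr i, rfl⟩, ?_⟩
  refine LinearIndependent.of_comp (Matrix.vecMulLinear (b.map (Int.castRingHom ℂ))) ?_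
  have := Matrix.linearIndependent_rows_of_det_ne_zero hdetC
  have e : (fun i => (A * b).map (Int.castRingHom ℂ) i) = (Matrix.vecMulLinear
      (b.map (Int.castRingHom ℂ))) ∘ (fun i => (fun r (j : Fin n) => ((r j : ℤ) : ℂ)) (r i)) := by
    funext i l
    simp [Matrix.map_apply, Matrix.mul_apply, Matrix.vecMul, dotProduct, A]
  rw [← e]
  exact this

end AH

set_option linter.unusedSectionVars false
namespace AH
open MvPolynomial

theorem enc_eq (b : ℕ) (f : ℕ → ℕ) (l : List ℕ) : enc b f l = Nat.ofDigits b (l.map f) := by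
  induction l with
  | nil => rfl
  | cons c l ih =>
    show f c + b * enc b f l = _
    rw [ih, List.map_cons, Nat.ofDigits_cons]

theorem ofDigits_tens {α γ : Type} (b : ℕ) (p : α → ℕ) (q : γ → ℕ) (I : List α) (J : List γ) :
    Nat.ofDigits (b ^ J.length) (I.map p) * Nat.ofDigits b (J.map q) =
      Nat.ofDigits b ((I.product J).map fun c => p c.1 * q c.2) := by
  induction I with
  | nil => simp [List.product]
  | cons i I ih =>
    have h1 : (i :: I).product J = J.map (fun j => (i, j)) ++ I.product J := rfl
    have h2 : ∀ J : List γ, Nat.ofDigits b (J.map (fun j => p i * q j)) =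
        p i * Nat.ofDigits b (J.map q) := by
      intro J
      induction J with
      | nil => simp
      | cons j J ih => simp only [List.map_cons, Nat.ofDigits_cons, ih]; ring
    rw [h1, List.map_append, Nat.ofDigits_append, ← ih, List.map_cons, Nat.ofDigits_cons,
      List.map_map]
    simp only [Function.comp_def, h2, List.length_map]
    ring

theorem ofDigits_map_add {α : Type} (b : ℕ) (f g : α → ℕ) (l : List α) :
    Nat.ofDigits b (l.map f) + Nat.ofDigits b (l.map g) = Nat.ofDigits b (l.map fun c => f c + g c) := by
  induction l with
  | nil => simp
  | cons j J ih => simp only [List.map_cons, Nat.ofDigits_cons, ← ih]; ring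

theorem length_prod {α γ : Type} (I : List α) (J : List γ) :
    (I.product J).length = I.length * J.length := List.length_product I J

theorem In_ofDigits (L : List ℕ) : In L.length (Nat.ofDigits 16384 L) (fun k => L.getD k 0) := by
  induction L with
  | nil => exact ⟨fun k _ => by simp, by simp⟩
  | cons a L ih =>
    rw [Nat.ofDigits_cons]
    exact In.cons (f := fun k => (a :: L).getD k 0) (by simpa using ih)

section vals
variable {R : Type*} [CommRing R]
def v3 {R : Type*} [CommSemiring R] {α : Type*} (p m : α → R) (c : α × α × α) : R :=
  p c.1 * (p c.2.1 * m c.2.2) + (p c.1 * (m c.2.1 * p c.2.2) + m c.1 * (p c.2.1 * p c.2.2))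
def v4 {R : Type*} [CommSemiring R] {α : Type*} (p m : α → R) (c : α × α × α × α) : R :=
  p c.1 * v3 p m c.2 + m c.1 * (p c.2.1 * (p c.2.2.1 * p c.2.2.2))
end vals

def cols3 (bs : List Blk) : List (ℕ × ℕ × ℕ) :=
  bs.flatMap fun b => b.1.product (b.2.1.product b.2.2)

theorem row3_eq (I J K : List ℕ) (p m : ℕ → ℕ) :
    row3 I J K p m = Nat.ofDigits 16384 ((I.product (J.product K)).map (v3 p m)) := by
  unfold row3
  simp only [force_eq, enc_eq]
  have key : ∀ f g h : ℕ → ℕ, Nat.mul (Nat.mul (Nat.ofDigits ((16384 ^ K.length) ^ J.length) (I.map f))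
      (Nat.ofDigits (16384 ^ K.length) (J.map g))) (Nat.ofDigits 16384 (K.map h)) =
      Nat.ofDigits 16384 ((I.product (J.product K)).map fun c => f c.1 * (g c.2.1 * h c.2.2)) := by
    intro f g h
    rw [Nat.mul_eq, Nat.mul_eq, mul_assoc, ofDigits_tens, ← pow_mul, mul_comm K.length, ← length_prod,
      ofDigits_tens]
  show Nat.add (Nat.mul (Nat.mul (Nat.ofDigits ((16384 ^ K.length) ^ J.length) _)
      (Nat.ofDigits (16384 ^ K.length) _)) _) (Nat.add (Nat.mul (Nat.mul
      (Nat.ofDigits ((16384 ^ K.length) ^ J.length) _) (Nat.ofDigits (16384 ^ K.length) _)) _)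
      (Nat.mul (Nat.mul (Nat.ofDigits ((16384 ^ K.length) ^ J.length) _)
      (Nat.ofDigits (16384 ^ K.length) _)) _)) = _
  rw [key, key, key]
  rw [Nat.add_eq, Nat.add_eq, ofDigits_map_add, ofDigits_map_add]
  rfl

theorem row3s_eq (bs : List Blk) (p m : ℕ → ℕ) :
    row3s bs p m = Nat.ofDigits 16384 ((cols3 bs).map (v3 p m)) := by
  induction bs with
  | nil => rfl
  | cons b bs ih =>
    have : row3s (b :: bs) p m = row3 b.1 b.2.1 b.2.2 p m +
      16384 ^ (b.1.length * (b.2.1.length * b.2.2.length)) * row3s bs p m := rfl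
    rw [this, ih, row3_eq]
    simp only [cols3, List.flatMap_cons, List.map_append, Nat.ofDigits_append, List.length_map,
      length_prod]

/-- rows for quartics -/
def row4 (I : List ℕ) (p m : ℕ → ℕ) : ℕ :=
  Nat.add (Nat.mul (enc (Nat.pow 16384 (I.length * (I.length * I.length))) p I) (row3 I I I p m))
    (Nat.mul (enc (Nat.pow 16384 (I.length * (I.length * I.length))) m I)
      (Nat.mul (enc (Nat.pow 16384 (I.length * I.length)) p I)
        (Nat.mul (enc (Nat.pow 16384 I.length) p I) (enc 16384 p I))))

def cols4 (I : List ℕ) : List (ℕ × ℕ × ℕ × ℕ) := I.product (I.product (I.product I))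

theorem row4_eq (I : List ℕ) (p m : ℕ → ℕ) :
    row4 I p m = Nat.ofDigits 16384 ((cols4 I).map (v4 p m)) := by
  unfold row4
  simp only [enc_eq, row3_eq]
  show (Nat.ofDigits (16384 ^ _) _) * _ + Nat.ofDigits (16384 ^ _) _ *
    (Nat.ofDigits (16384 ^ _) _ * (Nat.ofDigits (16384 ^ _) _ * _)) = _
  rw [ofDigits_tens, ← length_prod, ofDigits_tens, ← length_prod, ofDigits_tens,
    ofDigits_tens, ofDigits_map_add]
  rfl

theorem dg_lt (x c : ℕ) : dg x c < 7 := Nat.mod_lt _ (by norm_num)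

theorem dz_cast (x c : ℕ) : ((dz x c : ℤ) : ZMod 7) = (dg x c : ZMod 7) := by
  unfold dz
  split_ifs
  · simp
  · push_cast
    rw [show (7 : ZMod 7) = 0 by decide]; simp

theorem fx0_mem (sz : ℕ → ℕ) (x : ℕ) (cs : List ℕ) (h0 : 0 ∈ cs) : fx0 sz x cs ∈ cs := by
  have : fx0 sz x cs ∈ cs ∨ fx0 sz x cs = 0 := by
    clear h0
    induction cs with
    | nil => right; rfl
    | cons c cs ih =>
      have : fx0 sz x (c :: cs) = cond (Nat.beq (bp sz x c) 0) (fx0 sz x cs) c := rfl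
      rw [this]
      cases Nat.beq (bp sz x c) 0 with
      | true => rcases ih with h | h
                · left; exact List.mem_cons_of_mem _ h
                · right; exact h
      | false => left; exact List.mem_cons_self
  rcases this with h | h
  · exact h
  · rw [h]; exact h0

theorem mem_rowsP {sz : ℕ → ℕ} {cs : List ℕ} {F : (ℕ → ℕ) → (ℕ → ℕ) → ℕ} {x : ℕ} {tl : List ℕ}
    {z : ℕ} (h : z ∈ rowsP sz cs F x tl) : z ∈ tl ∨ ∃ y ∈ cs,
      z = F (dg x) (mN (fx0 sz x cs) y (bp sz x (fx0 sz x cs)) (bp sz x y)) := by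
  unfold rowsP at h
  rw [force_eq, force_eq] at h
  generalize fx0 sz x cs = x0 at *
  induction cs with
  | nil => left; exact h
  | cons c cs ih =>
    change z ∈ force (bp sz x c) (fun b1 => F (dg x) (mN x0 c (bp sz x x0) b1) :: (List.rec tl
      (fun y _ ih => force (bp sz x y) fun b1 =>
      F (dg x) (mN x0 y (bp sz x x0) b1) :: ih) cs)) at h
    rw [force_eq] at h
    rcases List.mem_cons.1 h with h | h
    · right; exact ⟨c, List.mem_cons_self, h⟩
    · rcases ih h with h | ⟨y, hy, h⟩
      · left; exact h
      · right; exact ⟨y, List.mem_cons_of_mem _ hy, h⟩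

theorem mem_rowsL {sz : ℕ → ℕ} {cs : List ℕ} {F : (ℕ → ℕ) → (ℕ → ℕ) → ℕ} {xs : List ℕ}
    {z : ℕ} (h : z ∈ rowsL sz cs F xs) : ∃ x ∈ xs, ∃ y ∈ cs,
      z = F (dg x) (mN (fx0 sz x cs) y (bp sz x (fx0 sz x cs)) (bp sz x y)) := by
  induction xs with
  | nil => exact absurd h (by change z ∉ []; simp)
  | cons x xs ih =>
    change z ∈ rowsP sz cs F x (rowsL sz cs F xs) at h
    rcases mem_rowsP h with h | ⟨y, hy, h⟩
    · obtain ⟨x', hx', h'⟩ := ih h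
      exact ⟨x', List.mem_cons_of_mem _ hx', h'⟩
    · exact ⟨x, List.mem_cons_self, y, hy, h⟩

/-- the polar form of the point with code `x`, evaluated at `m` -/
def polZ (sz : ℕ → ℕ) (cs : List ℕ) (x : ℕ) (m : ℕ → ℤ) : ℤ :=
  (cs.map fun c => (WT sz c : ℤ) * dz x (SG sz c) * m c).sum

theorem cert {γ : Type} (cols : List γ) (sz : ℕ → ℕ) (cs : List ℕ) (h0 : 0 ∈ cs) (hcs : cs.Nodup)
    (F : (ℕ → ℕ) → (ℕ → ℕ) → ℕ) (v : (ℕ → ℕ) → (ℕ → ℕ) → γ → ℕ) (vz : (ℕ → ℤ) → (ℕ → ℤ) → γ → ℤ)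
    (hF : ∀ p m, F p m = Nat.ofDigits 16384 (cols.map (v p m)))
    (hv : ∀ p m c, (∀ i, p i ≤ 6) → (∀ i, m i ≤ 13) → v p m c < 16384)
    (hvz : ∀ (p m : ℕ → ℕ) (p' m' : ℕ → ℤ) c, (∀ i, (p i : ZMod 7) = p' i) →
      (∀ i, (m i : ZMod 7) = m' i) → (v p m c : ZMod 7) = vz p' m' c)
    (xs : List ℕ) (k : ℕ) (hk : Nat.ble k (rankN cols.length (rowsL sz cs F xs)) = true) :
    RankGE ℂ k {g : Fin cols.length → ℂ | ∃ x ∈ xs, ∃ m : ℕ → ℤ, (∀ c, c ∉ cs → m c = 0) ∧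
      polZ sz cs x m = 0 ∧ g = fun j => (vz (dz x) m (cols.get j) : ℂ)} := by
  have : Fact (Nat.Prime 7) := ⟨by norm_num⟩
  let R : Set (Fin cols.length → ℤ) := {g | ∃ x ∈ xs, ∃ m : ℕ → ℤ, (∀ c, c ∉ cs → m c = 0) ∧
      polZ sz cs x m = 0 ∧ g = fun j => vz (dz x) m (cols.get j)}
  have h1 : RankGE (ZMod 7) k ((fun r (j : Fin cols.length) => ((r j : ℤ) : ZMod 7)) '' R) := by
    refine RankGE.le (rankN_ok _ (rowsL sz cs F xs) ?_) (Nat.le_of_ble_eq_true hk)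
    intro z hz
    obtain ⟨x, hx, y, hy, rfl⟩ := mem_rowsL hz
    have hx0 := fx0_mem sz x cs h0
    generalize fx0 sz x cs = x0 at *
    have hb : ∀ c, bp sz x c < 7 := fun c => Nat.mod_lt _ (by norm_num)
    have hbz : ∀ c, (bp sz x c : ZMod 7) = (((WT sz c : ℤ) * dz x (SG sz c) : ℤ) : ZMod 7) := by
      intro c
      push_cast
      rw [dz_cast]
      show ((((WT sz c) * (dg x (SG sz c))) % 7 : ℕ) : ZMod 7) = _
      rw [ZMod.natCast_mod]; push_cast; rfl
    have hcond : ∀ (a b : ℕ) (u : ℕ), cond (Nat.beq a b) u 0 = if a = b then u else 0 := by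
      intro a b u
      cases h : Nat.beq a b with
      | true => rw [if_pos (Nat.eq_of_beq_eq_true h)]; rfl
      | false => rw [if_neg (Nat.ne_of_beq_eq_false h)]; rfl
    have hm : ∀ c, mN x0 y (bp sz x x0) (bp sz x y) c = (if c = y then bp sz x x0 else 0) +
        (if c = x0 then 7 - bp sz x y else 0) := by
      intro c
      unfold mN
      rw [hcond, hcond]; rfl
    have hm13 : ∀ c, mN x0 y (bp sz x x0) (bp sz x y) c ≤ 13 := by
      intro c
      rw [hm]
      have := hb x0
      split_ifs <;> omega
    rw [hF]
    refine ⟨fun k => (cols.map (v (dg x) (mN x0 y (bp sz x x0) (bp sz x y)))).getD k 0,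
      ?_, ?_, ?_⟩
    · have := In_ofDigits (cols.map (v (dg x) (mN x0 y (bp sz x x0) (bp sz x y))))
      rw [List.length_map] at this
      exact this
    · intro j
      beta_reduce
      by_cases hj : j < cols.length
      · rw [List.getD_eq_getElem _ _ (by simpa using hj), List.getElem_map]
        exact hv _ _ _ (fun i => by have := dg_lt x i; omega) hm13
      · rw [List.getD_eq_default _ _ (by simpa using hj)]; norm_num
    · let m : ℕ → ℤ := fun c => (if c = y then (WT sz x0 : ℤ) * dz x (SG sz x0) else 0) -
        (if c = x0 then (WT sz y : ℤ) * dz x (SG sz y) else 0)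
      refine ⟨fun j => vz (dz x) m (cols.get j), ⟨x, hx, m, ?_, ?_, rfl⟩, ?_⟩
      · intro c hc
        have h1 : c ≠ y := by rintro rfl; exact hc hy
        have h2 : c ≠ x0 := by rintro rfl; exact hc hx0
        simp [m, h1, h2]
      · unfold polZ
        rw [← List.sum_toFinset _ hcs]
        simp only [m, mul_sub, mul_ite, mul_zero, Finset.sum_sub_distrib, Finset.sum_ite_eq',
          List.mem_toFinset, hy, hx0, if_true]
        ring
      · funext j
        have hj : (j : ℕ) < (cols.map (v (dg x) (mN x0 y (bp sz x x0) (bp sz x y)))).length := by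
          simp
        simp only [vec, List.getD_eq_getElem _ _ hj, List.getElem_map]
        refine (hvz _ _ _ _ _ (fun i => (dz_cast x i).symm) (fun i => ?_)).symm
        rw [hm]
        simp only [m]
        push_cast
        rw [sub_eq_add_neg]
        congr 1
        · split_ifs
          · rw [hbz]; push_cast; rfl
          · rfl
        · split_ifs
          · rw [Nat.cast_sub (hb y).le, hbz]
            push_cast
            have h7 : (7 : ZMod 7) = 0 := by exact_mod_cast ZMod.natCast_self 7
            rw [h7]; ring
          · simp
  refine (rank_lift R h1).mono ?_
  rintro _ ⟨g, ⟨x, hx, m, hm, hm', rfl⟩, rfl⟩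
  exact ⟨x, hx, m, hm, hm', rfl⟩

theorem v3_map {R R' : Type*} [CommSemiring R] [CommSemiring R'] (φ : R →+* R') {α : Type*}
    (p m : α → R) (c : α × α × α) : φ (v3 p m c) = v3 (fun i => φ (p i)) (fun i => φ (m i)) c := by
  simp [v3]

theorem v4_map {R R' : Type*} [CommSemiring R] [CommSemiring R'] (φ : R →+* R') {α : Type*}
    (p m : α → R) (c : α × α × α × α) :
    φ (v4 p m c) = v4 (fun i => φ (p i)) (fun i => φ (m i)) c := by
  simp [v4, v3_map]

theorem v3_le (p m : ℕ → ℕ) (c : ℕ × ℕ × ℕ) (hp : ∀ i, p i ≤ 6) (hm : ∀ i, m i ≤ 13) :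
    v3 p m c ≤ 1404 := by
  unfold v3
  have h1 := Nat.mul_le_mul (hp c.1) (Nat.mul_le_mul (hp c.2.1) (hm c.2.2))
  have h2 := Nat.mul_le_mul (hp c.1) (Nat.mul_le_mul (hm c.2.1) (hp c.2.2))
  have h3 := Nat.mul_le_mul (hm c.1) (Nat.mul_le_mul (hp c.2.1) (hp c.2.2))
  omega

theorem v4_le (p m : ℕ → ℕ) (c : ℕ × ℕ × ℕ × ℕ) (hp : ∀ i, p i ≤ 6) (hm : ∀ i, m i ≤ 13) :
    v4 p m c ≤ 11232 := by
  unfold v4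
  have h1 := Nat.mul_le_mul (hp c.1) (v3_le p m c.2 hp hm)
  have h3 := Nat.mul_le_mul (hm c.1) (Nat.mul_le_mul (hp c.2.1) (Nat.mul_le_mul (hp c.2.2.1) (hp c.2.2.2)))
  omega

theorem cert3 (bs : List Blk) (sz : ℕ → ℕ) (cs : List ℕ) (h0 : 0 ∈ cs) (hcs : cs.Nodup)
    (xs : List ℕ) (k : ℕ)
    (hk : Nat.ble k (rankN (cols3 bs).length (rowsL sz cs (row3s bs) xs)) = true) :
    RankGE ℂ k {g : Fin (cols3 bs).length → ℂ | ∃ x ∈ xs, ∃ m : ℕ → ℤ, (∀ c, c ∉ cs → m c = 0) ∧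
      polZ sz cs x m = 0 ∧ g = fun j => ((v3 (dz x) m ((cols3 bs).get j) : ℤ) : ℂ)} := by
  refine cert (cols3 bs) sz cs h0 hcs _ (fun p m => v3 p m) (fun p m => v3 p m) (row3s_eq bs)
    (fun p m c hp hm => (v3_le p m c hp hm).trans_lt (by norm_num)) ?_ xs k hk
  intro p m p' m' c hp hm
  have h1 := v3_map (Nat.castRingHom (ZMod 7)) p m c
  have h2 := v3_map (Int.castRingHom (ZMod 7)) p' m' c
  simp only [eq_natCast, eq_intCast] at h1 h2
  rw [h1, h2]
  simp only [hp, hm]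

theorem cert4 (I : List ℕ) (sz : ℕ → ℕ) (cs : List ℕ) (h0 : 0 ∈ cs) (hcs : cs.Nodup)
    (xs : List ℕ) (k : ℕ)
    (hk : Nat.ble k (rankN (cols4 I).length (rowsL sz cs (row4 I) xs)) = true) :
    RankGE ℂ k {g : Fin (cols4 I).length → ℂ | ∃ x ∈ xs, ∃ m : ℕ → ℤ, (∀ c, c ∉ cs → m c = 0) ∧
      polZ sz cs x m = 0 ∧ g = fun j => ((v4 (dz x) m ((cols4 I).get j) : ℤ) : ℂ)} := by
  refine cert (cols4 I) sz cs h0 hcs _ (fun p m => v4 p m) (fun p m => v4 p m) (row4_eq I)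
    (fun p m c hp hm => (v4_le p m c hp hm).trans_lt (by norm_num)) ?_ xs k hk
  intro p m p' m' c hp hm
  have h1 := v4_map (Nat.castRingHom (ZMod 7)) p m c
  have h2 := v4_map (Int.castRingHom (ZMod 7)) p' m' c
  simp only [eq_natCast, eq_intCast] at h1 h2
  rw [h1, h2]
  simp only [hp, hm]

end AH

set_option linter.unusedSectionVars false
namespace AH
open MvPolynomial

/-! Spaces split into small blocks -/

theorem sg_eq (k t : ℕ) : sg k t = if t % 2 = 1 then t - 1 else if t + 1 = k then t else t + 1 := by
  have hc : ∀ a b u v : ℕ, cond (Nat.beq a b) u v = if a = b then u else v := by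
    intro a b u v
    cases h : Nat.beq a b with
    | true => rw [if_pos (Nat.eq_of_beq_eq_true h)]; rfl
    | false => rw [if_neg (Nat.ne_of_beq_eq_false h)]; rfl
  unfold sg
  rw [hc, hc]
  rfl

theorem sg_lt {k t : ℕ} (h : t < k) : sg k t < k := by
  rw [sg_eq]; split_ifs <;> omega

theorem sg_sg {k t : ℕ} (h : t < k) : sg k (sg k t) = t := by
  rw [sg_eq k t]; split_ifs <;> rw [sg_eq] <;> split_ifs <;> omega

theorem wt_ne (k t : ℕ) : (wt k t : ℂ) ≠ 0 := by
  unfold wt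
  cases Nat.beq (sg k t) t <;> simp

theorem wt_sg {k t : ℕ} (h : t < k) : wt k (sg k t) = wt k t := by
  unfold wt
  rw [sg_sg h]
  have : Nat.beq t (sg k t) = Nat.beq (sg k t) t := by
    rw [Bool.eq_iff_iff]
    exact ⟨fun h => by rw [← Nat.eq_of_beq_eq_true h]; exact Nat.beq_refl _,
      fun h => by rw [Nat.eq_of_beq_eq_true h]; exact Nat.beq_refl _⟩
  rw [this]

section blk
variable {β : Type} [Fintype β] [DecidableEq β]

abbrev Ix (sz : β → ℕ) := Σ b, Fin (sz b)

variable (sz : β → ℕ)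

def sgI (i : Ix sz) : Ix sz := ⟨i.1, ⟨sg (sz i.1) i.2, sg_lt i.2.2⟩⟩

theorem sgI_sgI (i : Ix sz) : sgI sz (sgI sz i) = i := by
  obtain ⟨b, t, ht⟩ := i
  simp only [sgI, sg_sg ht]

noncomputable def blkL : (Ix sz → ℂ) →ₗ[ℂ] (Ix sz → ℂ) where
  toFun x := fun i => (wt (sz i.1) i.2 : ℂ) * x (sgI sz i)
  map_add' x y := by funext i; simp [mul_add]
  map_smul' c x := by funext i; simp; ring

noncomputable def blkB : BF (Ix sz) := LinearMap.BilinForm.comp (dotB (Ix sz)) (blkL sz) LinearMap.id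

theorem blkB_apply (x y : Ix sz → ℂ) :
    blkB sz x y = ∑ i, (wt (sz i.1) i.2 : ℂ) * x (sgI sz i) * y i := rfl

theorem blkB_symm (x y : Ix sz → ℂ) : blkB sz x y = blkB sz y x := by
  rw [blkB_apply, blkB_apply]
  refine Finset.sum_nbij' (sgI sz) (sgI sz) (by simp) (by simp) (by simp [sgI_sgI])
    (by simp [sgI_sgI]) ?_
  intro i _
  rw [sgI_sgI]
  have : wt (sz (sgI sz i).1) (sgI sz i).2 = wt (sz i.1) i.2 := wt_sg i.2.2
  rw [this]; ring

/-- vectors supported on a set of blocks -/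
def WS (S : Finset β) : Submodule ℂ (Ix sz → ℂ) where
  carrier := {x | ∀ i, i.1 ∉ S → x i = 0}
  add_mem' := by
    intro x y hx hy i hi
    simp [hx i hi, hy i hi]
  zero_mem' := by intro i _; rfl
  smul_mem' := by
    intro c x hx i hi
    simp [hx i hi]

theorem mem_WS {S : Finset β} {x : Ix sz → ℂ} : x ∈ WS sz S ↔ ∀ i, i.1 ∉ S → x i = 0 := Iff.rfl

theorem single_WS {S : Finset β} (i : Ix sz) (hi : i.1 ∈ S) : Pi.single i (1 : ℂ) ∈ WS sz S := by
  intro j hj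
  rw [Pi.single_eq_of_ne]
  rintro rfl
  exact hj hi

theorem blkB_single (x : Ix sz → ℂ) (i : Ix sz) :
    blkB sz x (Pi.single i 1) = (wt (sz i.1) i.2 : ℂ) * x (sgI sz i) := by
  rw [blkB_apply, Finset.sum_eq_single i]
  · simp
  · intro j _ hj
    rw [Pi.single_eq_of_ne hj, mul_zero]
  · simp

theorem WS_nd (S : Finset β) : NDW (blkB sz) (WS sz S) := by
  intro p hp h
  funext i
  by_cases hi : i.1 ∈ S
  · have := h _ (single_WS sz (sgI sz i) hi)
    rw [blkB_single, sgI_sgI] at this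
    rcases mul_eq_zero.1 this with h | h
    · exact absurd h (wt_ne _ _)
    · exact h
  · exact hp i hi

theorem WS_univ : WS sz Finset.univ = ⊤ := by
  ext x; simp [mem_WS]

theorem WS_mono {S T : Finset β} (h : S ⊆ T) : WS sz S ≤ WS sz T :=
  fun _ hx i hi => hx i fun h' => hi (h h')

theorem WS_finrank {S : Finset β} {b : β} (hb : b ∈ S) : sz b ≤ Module.finrank ℂ (WS sz S) := by
  let f : Fin (sz b) → WS sz S := fun t => ⟨Pi.single ⟨b, t⟩ 1, single_WS sz _ hb⟩
  have hf : LinearIndependent ℂ f := by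
    apply LinearIndependent.of_comp (WS sz S).subtype
    have := (Pi.basisFun ℂ (Ix sz)).linearIndependent.comp (fun t : Fin (sz b) => (⟨b, t⟩ : Ix sz))
      (by intro a c h; simpa using h)
    convert this using 1
    funext t
    simp [f]
  simpa using hf.fintype_card_le_finrank

/-! functionals -/

noncomputable def psi3 {ι : Type} (c : ι × ι × ι) : MvPolynomial ι ℂ →ₗ[ℂ] ℂ :=
  (lcoeff ℂ 0).comp (((pderiv c.1).toLinearMap.comp
    ((pderiv c.2.1).toLinearMap.comp (pderiv c.2.2).toLinearMap)))

theorem psi3_tan {ι : Type} [Fintype ι] [DecidableEq ι] (c : ι × ι × ι) (p m : ι → ℂ) :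
    psi3 c (lf p ^ (3 - 1) * lf m) = 2 * v3 p m c := by
  show coeff 0 (pderiv c.1 (pderiv c.2.1 (pderiv c.2.2 (lf p ^ 2 * lf m)))) = _
  rw [pderiv_pow_mul_lf]
  simp only [map_add, Derivation.map_smul, pderiv_pow_mul_lf, pderiv_pow_lf]
  simp [v3]
  ring

noncomputable def psi4 {ι : Type} (c : ι × ι × ι × ι) : MvPolynomial ι ℂ →ₗ[ℂ] ℂ :=
  (psi3 c.2).comp (pderiv c.1).toLinearMap

theorem psi4_tan {ι : Type} [Fintype ι] [DecidableEq ι] (c : ι × ι × ι × ι) (p m : ι → ℂ) :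
    psi4 c (lf p ^ (4 - 1) * lf m) = 6 * v4 p m c := by
  have h1 := psi3_tan c.2 p m
  have h2 := psi3_tan c.2 p p
  have h3 : lf p ^ 3 = lf p ^ (3 - 1) * lf p := by ring
  have h4 : psi4 c (lf p ^ (4 - 1) * lf m) = psi3 c.2 (pderiv c.1 (lf p ^ (4 - 1) * lf m)) := rfl
  rw [h4, show 4 - 1 = 3 by norm_num, pderiv_pow_mul_lf, map_add, map_smul, map_smul, h3, h2, h1]
  simp only [v4, v3, smul_eq_mul]
  push_cast
  ring

/-! cells -/
section cell
variable {k : ℕ} (bs : Fin k → β)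

/-- place a vector with `k` blocks of (at most) seven entries into the blocks `bs` -/
def lft (v : ℕ → ℂ) : Ix sz → ℂ := fun i => ∑ a : Fin k, if bs a = i.1 then v (7 * a + i.2) else 0

theorem lft_notin (v : ℕ → ℂ) (i : Ix sz) (hi : ∀ a, bs a ≠ i.1) : lft sz bs v i = 0 :=
  Finset.sum_eq_zero fun a _ => if_neg (hi a)

variable {bs}

theorem lft_bs (hbs : Function.Injective bs) (v : ℕ → ℂ) (a : Fin k) (t : Fin (sz (bs a))) : lft sz bs v ⟨bs a, t⟩ = v (7 * a + t) := by
  unfold lft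
  rw [Finset.sum_eq_single a]
  · simp
  · intro b _ hb
    rw [if_neg]
    exact fun h => hb (hbs h)
  · simp

theorem blkB_lft (hbs : Function.Injective bs) (p m : ℕ → ℂ) : blkB sz (lft sz bs p) (lft sz bs m) =
    ∑ a : Fin k, ∑ t : Fin (sz (bs a)), (wt (sz (bs a)) t : ℂ) * p (7 * a + sg (sz (bs a)) t) *
      m (7 * a + t) := by
  rw [blkB_apply, Fintype.sum_sigma]
  rw [← Finset.sum_subset (Finset.subset_univ (Finset.univ.image bs)), Finset.sum_image]
  · refine Finset.sum_congr rfl fun a _ => Finset.sum_congr rfl fun t _ => ?_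
    rw [lft_bs sz hbs]
    congr 2
    exact lft_bs sz hbs p a ⟨sg (sz (bs a)) t, sg_lt t.2⟩
  · intro a _ b _ h; exact hbs h
  · intro b _ hb
    refine Finset.sum_eq_zero fun t _ => ?_
    rw [lft_notin sz bs m ⟨b, t⟩, mul_zero]
    rintro a rfl
    exact hb (by simp)

end cell

/-- coordinates of a cell -/
def csL (k : ℕ) (szp : ℕ → ℕ) : List ℕ :=
  (List.range k).flatMap fun a => (List.range (szp a)).map fun t => 7 * a + t

theorem mem_csL {k : ℕ} {szp : ℕ → ℕ} {c : ℕ} : c ∈ csL k szp ↔ ∃ a < k, ∃ t < szp a, 7 * a + t = c := by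
  simp [csL]

theorem sum_csL (k : ℕ) (szp : ℕ → ℕ) (f : ℕ → ℤ) : ((csL k szp).map f).sum =
    ∑ a : Fin k, ∑ t : Fin (szp a), f (7 * a + t) := by
  have h1 : ∀ n (g : ℕ → ℤ), ((List.range n).map g).sum = ∑ i : Fin n, g i := by
    intro n g
    rw [← Finset.sum_range]
    induction n with
    | zero => simp
    | succ n ih => rw [List.range_succ, Finset.sum_range_succ, ← ih]; simp
  have h2 : ∀ a, ∑ t : Fin (szp a), f (7 * a + t) =
    ((List.range (szp a)).map fun t => f (7 * a + t)).sum := fun a => (h1 _ fun t => f (7 * a + t)).symm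
  rw [← h1 k (fun a => ∑ t : Fin (szp a), f (7 * a + t))]
  simp only [h2]
  unfold csL
  induction List.range k with
  | nil => rfl
  | cons a l ih =>
    rw [List.flatMap_cons, List.map_append, List.sum_append, ih, List.map_cons, List.sum_cons, List.map_map]
    rfl

theorem polZ_lft {k : ℕ} {bs : Fin k → β} (hbs : Function.Injective bs) (szp : ℕ → ℕ)
    (hsz : ∀ a : Fin k, szp a = sz (bs a)) (h7 : ∀ a : Fin k, szp a ≤ 7) (x : ℕ) (m : ℕ → ℤ) :
    blkB sz (lft sz bs fun c => (dz x c : ℂ)) (lft sz bs fun c => (m c : ℂ)) =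
      (polZ szp (csL k szp) x m : ℂ) := by
  rw [blkB_lft sz hbs]
  unfold polZ
  rw [sum_csL]
  push_cast
  refine Finset.sum_congr rfl fun a _ => ?_
  have hwt : ∀ t < szp a, (7 * (a:ℕ) + t) / 7 = a ∧ (7 * (a:ℕ) + t) % 7 = t := by
    intro t ht
    have := h7 a
    omega
  have : ∀ n, n = szp a → ∑ t : Fin n, (wt n t : ℂ) * (dz x (7 * a + sg n t) : ℂ) * (m (7 * a + t) : ℂ) =
      ∑ t : Fin (szp a), (WT szp (7 * a + t) : ℂ) * (dz x (SG szp (7 * a + t)) : ℂ) * (m (7 * a + t) : ℂ) := by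
    rintro n rfl
    refine Finset.sum_congr rfl fun t _ => ?_
    have h1 : WT szp (7 * a + t) = wt (szp a) t := by
      show wt (szp ((7 * (a:ℕ) + t) / 7)) ((7 * (a:ℕ) + t) % 7) = _
      rw [(hwt t t.2).1, (hwt t t.2).2]
    have h2 : SG szp (7 * a + t) = 7 * a + sg (szp a) t := by
      show 7 * ((7 * (a:ℕ) + t) / 7) + sg (szp ((7 * (a:ℕ) + t) / 7)) ((7 * (a:ℕ) + t) % 7) = _
      rw [(hwt t t.2).1, (hwt t t.2).2]
    rw [h1, h2]
  exact this _ (hsz a).symm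

theorem lft_WS {k : ℕ} (bs : Fin k → β) (v : ℕ → ℂ) : lft sz bs v ∈ WS sz (Finset.univ.image bs) := by
  intro i hi
  refine lft_notin sz bs v i fun a ha => hi ?_
  rw [← ha]; simp

theorem exists_toI {k : ℕ} {bs : Fin k → β} (hbs : Function.Injective bs) (szp : ℕ → ℕ)
    (hsz : ∀ a : Fin k, szp a = sz (bs a)) (h7 : ∀ a : Fin k, szp a ≤ 7) (c : ℕ) (hc : c ∈ csL k szp) :
    ∃ i : Ix sz, ∃ a : Fin k, (a : ℕ) = c / 7 ∧ i.1 = bs a ∧ ∀ v, lft sz bs v i = v c := by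
  obtain ⟨a, ha, t, ht, rfl⟩ := mem_csL.1 hc
  have h1 := h7 ⟨a, ha⟩
  have h2 := hsz ⟨a, ha⟩
  simp only at h1 h2
  refine ⟨⟨bs ⟨a, ha⟩, ⟨t, h2 ▸ ht⟩⟩, ⟨a, ha⟩, ?_, rfl, fun v => lft_bs sz hbs v ⟨a, ha⟩ _⟩
  simp only; omega

/-- the functionals belonging to a cell -/
noncomputable def Phi (S : Finset β) : MvPolynomial (Ix sz) ℂ →ₗ[ℂ] (Ix sz × Ix sz × Ix sz → ℂ) :=
  LinearMap.pi fun c => if ({c.1.1, c.2.1.1, c.2.2.1} : Finset β) = S then psi3 c else 0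

theorem Phi_apply (S : Finset β) (f : MvPolynomial (Ix sz) ℂ) (c : Ix sz × Ix sz × Ix sz) :
    Phi sz S f c = if ({c.1.1, c.2.1.1, c.2.2.1} : Finset β) = S then psi3 c f else 0 := by
  unfold Phi
  rw [LinearMap.pi_apply]
  split_ifs <;> rfl

theorem Phi_zero {S T : Finset β} (h : ¬ S ⊆ T) {p : Ix sz → ℂ} (hp : p ∈ WS sz T)
    {f : MvPolynomial (Ix sz) ℂ} (hf : f ∈ TanW (blkB sz) (WS sz T) 3 p) : Phi sz S f = 0 := by
  obtain ⟨m, hm, -, rfl⟩ := hf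
  funext c
  rw [Phi_apply]
  split_ifs with hc
  · rw [psi3_tan, Pi.zero_apply]
    have : c.1.1 ∉ T ∨ c.2.1.1 ∉ T ∨ c.2.2.1 ∉ T := by
      by_contra h'
      push Not at h'
      apply h
      rw [← hc]
      intro b hb
      simp only [Finset.mem_insert, Finset.mem_singleton] at hb
      rcases hb with rfl | rfl | rfl
      exacts [h'.1, h'.2.1, h'.2.2]
    rcases this with h | h | h <;> simp [v3, hp _ h, hm _ h]
  · rfl

theorem cell_rank {k : ℕ} {bs : Fin k → β} (hbs : Function.Injective bs) (szp : ℕ → ℕ)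
    (hsz : ∀ a : Fin k, szp a = sz (bs a)) (h7 : ∀ a : Fin k, szp a ≤ 7)
    (bl : List Blk) (h0 : 0 ∈ csL k szp) (hnd : (csL k szp).Nodup)
    (hbl : ∀ c ∈ cols3 bl, (c.1 ∈ csL k szp ∧ c.2.1 ∈ csL k szp ∧ c.2.2 ∈ csL k szp) ∧
      ∀ a < k, a = c.1 / 7 ∨ a = c.2.1 / 7 ∨ a = c.2.2 / 7)
    (xs : List ℕ) (K : ℕ)
    (hK : Nat.ble K (rankN (cols3 bl).length (rowsL szp (csL k szp) (row3s bl) xs)) = true) :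
    RankGE ℂ K (Phi sz (Finset.univ.image bs) '' ⋃ x ∈ xs,
      TanW (blkB sz) (WS sz (Finset.univ.image bs)) 3 (lft sz bs fun c => (dz x c : ℂ))) := by
  have hcert := cert3 bl szp (csL k szp) h0 hnd xs K hK
  choose toI ai h1 h2 h3 using exists_toI sz hbs szp hsz h7
  let g : (Ix sz × Ix sz × Ix sz → ℂ) →ₗ[ℂ] (Fin (cols3 bl).length → ℂ) :=
    LinearMap.pi fun j => (2⁻¹ : ℂ) • LinearMap.proj (toI _ (hbl _ ((cols3 bl).get_mem j)).1.1,
      toI _ (hbl _ ((cols3 bl).get_mem j)).1.2.1, toI _ (hbl _ ((cols3 bl).get_mem j)).1.2.2)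
  apply RankGE.of_map g
  refine hcert.mono ?_
  rintro _ ⟨x, hx, m, hm, hpol, rfl⟩
  refine ⟨_, ⟨lf (lft sz bs fun c => (dz x c : ℂ)) ^ (3 - 1) * lf (lft sz bs fun c => (m c : ℂ)), ?_, rfl⟩, ?_⟩
  · simp only [Set.mem_iUnion]
    refine ⟨x, hx, _, lft_WS sz bs _, ?_, rfl⟩
    rw [polZ_lft sz hbs szp hsz h7, hpol]; simp
  · funext j
    obtain ⟨⟨c1, c2, c3⟩, hk⟩ := hbl _ ((cols3 bl).get_mem j)
    show (2⁻¹ : ℂ) * Phi sz _ _ _ = _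
    rw [Phi_apply, if_pos, psi3_tan]
    · rw [inv_mul_cancel_left₀ (by norm_num)]
      simp only [v3, h3 _ c1, h3 _ c2, h3 _ c3]
      push_cast; rfl
    · simp only [h2 _ c1, h2 _ c2, h2 _ c3]
      ext b
      simp only [Finset.mem_insert, Finset.mem_singleton, Finset.mem_image, Finset.mem_univ, true_and]
      constructor
      · rintro (rfl | rfl | rfl) <;> exact ⟨_, rfl⟩
      · rintro ⟨a, rfl⟩
        rcases hk a a.2 with h | h | h
        · left; congr 1; exact Fin.ext (h.trans (h1 _ c1).symm)
        · right; left; congr 1; exact Fin.ext (h.trans (h1 _ c2).symm)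
        · right; right; congr 1; exact Fin.ext (h.trans (h1 _ c3).symm)

/-- adding up the cells -/
theorem cells_total {V A : Type} [AddCommGroup V] [Module ℂ V] [AddCommGroup A] [Module ℂ A]
    (𝒮 : Finset (Finset β)) (F : Finset β → Set V) (Φ : Finset β → V →ₗ[ℂ] A) (κ : Finset β → ℕ)
    (h0 : ∀ S T, ¬ S ⊆ T → ∀ f ∈ F T, Φ S f = 0)
    (h1 : ∀ S ∈ 𝒮, RankGE ℂ (κ S) (Φ S '' F S)) : RankGE ℂ (∑ S ∈ 𝒮, κ S) (⋃ S ∈ 𝒮, F S) := by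
  revert h1
  refine Finset.induction_on_max_value (motive := fun 𝒮 => (∀ S ∈ 𝒮, RankGE ℂ (κ S) (Φ S '' F S)) →
    RankGE ℂ (∑ S ∈ 𝒮, κ S) (⋃ S ∈ 𝒮, F S)) Finset.card 𝒮 ?_ ?_
  · intro _
    exact RankGE.zero _
  · intro S 𝒮 hS hmax ih h1
    rw [Finset.sum_insert hS, add_comm]
    refine RankGE.add (Φ S) (u := ⋃ T ∈ 𝒮, F T) ?_ ?_
      (ih fun T hT => h1 T (Finset.mem_insert_of_mem hT)) ?_
    · refine Set.Subset.trans ?_ Submodule.subset_span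
      exact Set.iUnion₂_subset fun T hT => Set.subset_iUnion₂_of_subset T (Finset.mem_insert_of_mem hT) le_rfl
    · intro f hf
      simp only [Set.mem_iUnion] at hf
      obtain ⟨T, hT, hf⟩ := hf
      refine h0 S T (fun hST => hS ?_) f hf
      rw [Finset.eq_of_subset_of_card_le hST (hmax T hT)]
      exact hT
    · refine (h1 S (Finset.mem_insert_self _ _)).mono (Set.image_mono ?_)
      exact Set.subset_iUnion₂_of_subset S (Finset.mem_insert_self _ _) le_rfl

end blk
end AH

set_option linter.unusedSectionVars false
namespace AH
open MvPolynomial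

theorem dz_of_dg {x y c d : ℕ} (h : dg x c = dg y d) : dz x c = dz y d := by
  unfold dz; rw [h]

theorem dz_zero {x c : ℕ} (h : dg x c = 0) : dz x c = 0 := by
  unfold dz; rw [h]; simp

theorem dg_eq (x c : ℕ) : dg x c = x / 10 ^ c % 10 % 7 := rfl

theorem dg_shift (x a b t : ℕ) (hx : x < 10 ^ 7) (ht : t < 7) :
    dg (x * 10 ^ (7 * a)) (7 * b + t) = if a = b then dg x t else 0 := by
  rw [dg_eq, dg_eq]
  split_ifs with h
  · subst h
    rw [pow_add, ← Nat.div_div_eq_div_mul, Nat.mul_div_cancel _ (by positivity)]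
  · rcases lt_or_gt_of_ne h with h | h
    · have : x * 10 ^ (7 * a) < 10 ^ (7 * b + t) := by
        calc x * 10 ^ (7 * a) < 10 ^ 7 * 10 ^ (7 * a) := by gcongr
          _ = 10 ^ (7 + 7 * a) := by rw [pow_add]
          _ ≤ _ := Nat.pow_le_pow_right (by norm_num) (by omega)
      rw [Nat.div_eq_of_lt this]
    · obtain ⟨r, hr⟩ : ∃ r, 7 * a = (7 * b + t) + (r + 1) := ⟨7 * a - (7 * b + t) - 1, by omega⟩
      rw [hr, pow_add 10 (7 * b + t), mul_left_comm, Nat.mul_div_cancel_left _ (by positivity), pow_succ,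
        ← mul_assoc, Nat.mul_mod_left]

section cells
variable {m : ℕ} (sz : Fin (m+1) → ℕ)

/-- index set of the generic points -/
abbrev QI := Σ q : {q : Fin (m+1) × Fin (m+1) // q.1 < q.2}, Fin (2 * sz q.1.2)

def QW (j : QI sz) : Submodule ℂ (Ix sz → ℂ) := WS sz {j.1.1.1, j.1.1.2}

/-- a fixed point in one block -/
def pt (b : Fin (m+1)) (x : ℕ) : Ix sz → ℂ := lft sz (fun _ : Fin 1 => b) fun c => (dz x c : ℂ)

def FS (PB : Fin (m+1) → List ℕ) (S : Finset (Fin (m+1))) (Q : QI sz → Ix sz → ℂ) :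
    Set (MvPolynomial (Ix sz) ℂ) :=
  (⋃ i : {i : Fin (m+1) × ℕ // i.1 ∈ S ∧ i.2 ∈ PB i.1}, TanW (blkB sz) (WS sz S) 3 (pt sz i.1.1 i.1.2)) ∪
  ⋃ j : {j : QI sz // j.1.1.1 ∈ S ∧ j.1.1.2 ∈ S}, TanW (blkB sz) (WS sz S) 3 (Q j.1)

def allx (k : ℕ) (PL : ℕ → List ℕ) (qd : ℕ → ℕ → List ℕ) : List ℕ :=
  ((List.range k).flatMap fun a => (PL a).map fun x => x * 10 ^ (7 * a)) ++
    (List.range k).flatMap fun b => (List.range b).flatMap fun a => qd a b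

/-- everything that has to be checked for a cell -/
def CellOK (k : ℕ) (szp : ℕ → ℕ) (PL : ℕ → List ℕ) (qd : ℕ → ℕ → List ℕ) (K : ℕ) : Prop :=
  (∀ b < k, ∀ a < b, (qd a b).length = 2 * szp b ∧ ∀ x ∈ qd a b,
    polZ szp (csL k szp) x (dz x) = 0 ∧ ∀ a' < k, a' = a ∨ a' = b ∨ ∀ t < 7, dg x (7 * a' + t) = 0) ∧
  ∃ bl : List Blk, (0 ∈ csL k szp ∧ (csL k szp).Nodup) ∧
    (∀ c ∈ cols3 bl, (c.1 ∈ csL k szp ∧ c.2.1 ∈ csL k szp ∧ c.2.2 ∈ csL k szp) ∧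
      ∀ a < k, a = c.1 / 7 ∨ a = c.2.1 / 7 ∨ a = c.2.2 / 7) ∧
    Nat.ble K (rankN (cols3 bl).length (rowsL szp (csL k szp) (row3s bl) (allx k PL qd))) = true

theorem lft_shift {k : ℕ} {bs : Fin k → Fin (m+1)} (hbs : Function.Injective bs) (h7 : ∀ b, sz b ≤ 7)
    (a : Fin k) (x : ℕ) (hx : x < 10 ^ 7) :
    lft sz bs (fun c => (dz (x * 10 ^ (7 * (a:ℕ))) c : ℂ)) = pt sz (bs a) x := by
  funext ⟨b, t⟩
  have ht : (t : ℕ) < 7 := lt_of_lt_of_le t.2 (h7 b)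
  have h1 : pt sz (bs a) x ⟨b, t⟩ = if bs a = b then (dz x t : ℂ) else 0 := by
    simp [pt, lft]
  rw [h1]
  by_cases hb : ∃ a', bs a' = b
  · obtain ⟨a', rfl⟩ := hb
    rw [lft_bs sz hbs]
    by_cases haa : a = a'
    · subst haa
      rw [if_pos rfl]
      congr 1
      apply dz_of_dg
      rw [dg_shift _ _ _ _ hx ht, if_pos rfl]
    · rw [if_neg fun h => haa (hbs h), dz_zero]
      · simp
      · rw [dg_shift _ _ _ _ hx ht, if_neg fun h => haa (Fin.ext h)]
  · push Not at hb
    rw [lft_notin sz bs _ _ hb, if_neg (hb a)]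

theorem cell_witness (h7 : ∀ b, sz b ≤ 7) {k : ℕ} {bs : Fin k → Fin (m+1)} (hbs : StrictMono bs)
    (szp : ℕ → ℕ) (hsz : ∀ a : Fin k, szp a = sz (bs a)) (PB : Fin (m+1) → List ℕ)
    (PL : ℕ → List ℕ) (hPL : ∀ a : Fin k, ∀ x ∈ PL a, x ∈ PB (bs a)) (hPB : ∀ b, ∀ x ∈ PB b, x < 10 ^ 7)
    (qd : ℕ → ℕ → List ℕ) (K : ℕ) (hOK : CellOK k szp PL qd K) :
    ∃ Q ∈ XW (blkB sz) (QW sz),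
      RankGE ℂ K (Phi sz (Finset.univ.image bs) '' FS sz PB (Finset.univ.image bs) Q) := by
  classical
  obtain ⟨hq, bl, ⟨h0, hnd⟩, hbl, hK⟩ := hOK
  have hinj := hbs.injective
  have h7' : ∀ a : Fin k, szp a ≤ 7 := fun a => by rw [hsz]; exact h7 _
  let Q : QI sz → Ix sz → ℂ := fun j => if h : ∃ a b : Fin k, bs a = j.1.1.1 ∧ bs b = j.1.1.2 then
    lft sz bs (fun c => (dz ((qd h.choose h.choose_spec.choose).getD j.2 0) c : ℂ)) else 0
  have hQ : ∀ (a b : Fin k) (hab : bs a < bs b) (u : Fin (2 * sz (bs b))),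
      Q ⟨⟨(bs a, bs b), hab⟩, u⟩ = lft sz bs (fun c => (dz ((qd a b).getD u 0) c : ℂ)) := by
    intro a b hab u
    have h : ∃ a' b' : Fin k, bs a' = bs a ∧ bs b' = bs b := ⟨a, b, rfl, rfl⟩
    have h1 : h.choose = a := hinj h.choose_spec.choose_spec.1
    have h2 : h.choose_spec.choose = b := hinj h.choose_spec.choose_spec.2
    have h3 : Q ⟨⟨(bs a, bs b), hab⟩, u⟩ =
      lft sz bs (fun c => (dz ((qd h.choose h.choose_spec.choose).getD u 0) c : ℂ)) := dif_pos h
    rw [h3, h2, h1]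
  refine ⟨Q, ?_, ?_⟩
  · rintro ⟨⟨⟨i, j⟩, hij⟩, u⟩
    by_cases h : ∃ a b : Fin k, bs a = i ∧ bs b = j
    · obtain ⟨a, b, rfl, rfl⟩ := h
      rw [hQ a b hij u]
      have hab : a < b := hbs.lt_iff_lt.1 hij
      obtain ⟨hl, hx⟩ := hq b b.2 a hab
      have hu : (u : ℕ) < (qd a b).length := by rw [hl, hsz]; exact u.2
      rw [List.getD_eq_getElem _ _ hu]
      obtain ⟨hx1, hx2⟩ := hx _ (List.getElem_mem hu)
      constructor
      · rintro ⟨b', t⟩ hb'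
        have ht : (t : ℕ) < 7 := lt_of_lt_of_le t.2 (h7 b')
        by_cases hbb : ∃ a', bs a' = b'
        · obtain ⟨a', rfl⟩ := hbb
          rw [lft_bs sz hinj]
          simp only [Finset.mem_insert, Finset.mem_singleton, not_or] at hb'
          rcases hx2 a' a'.2 with h | h | h
          · exact absurd (congrArg bs (Fin.ext h)) hb'.1
          · exact absurd (congrArg bs (Fin.ext h)) hb'.2
          · rw [dz_zero (h t ht)]; simp
        · push Not at hbb
          exact lft_notin sz bs _ _ hbb
      · rw [polZ_lft sz hinj szp hsz h7', hx1]; simp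
    · have h3 : Q ⟨⟨(i, j), hij⟩, u⟩ = 0 := dif_neg h
      rw [h3]
      exact ⟨Submodule.zero_mem _, by simp⟩
  · refine (cell_rank sz hinj szp hsz h7' bl h0 hnd hbl _ K hK).mono (Set.image_mono ?_)
    refine Set.iUnion₂_subset fun x hx => ?_
    rcases List.mem_append.1 hx with hx | hx
    · simp only [List.mem_flatMap, List.mem_range, List.mem_map] at hx
      obtain ⟨a, ha, y, hy, rfl⟩ := hx
      have hy' := hPL ⟨a, ha⟩ y hy
      rw [lft_shift sz hinj h7 ⟨a, ha⟩ y (hPB _ _ hy')]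
      refine Set.subset_union_of_subset_left ?_ _
      exact Set.subset_iUnion_of_subset ⟨(bs ⟨a, ha⟩, y), by simp, hy'⟩ le_rfl
    · simp only [List.mem_flatMap, List.mem_range] at hx
      obtain ⟨b, hb, a, hab, hx⟩ := hx
      obtain ⟨u, hu, rfl⟩ := List.getElem_of_mem hx
      have hl := (hq b hb a hab).1
      have hab' : bs ⟨a, hab.trans hb⟩ < bs ⟨b, hb⟩ := hbs hab
      have hu' : u < 2 * sz (bs ⟨b, hb⟩) := by rw [← hsz]; simp only; omega
      have := hQ _ _ hab' ⟨u, hu'⟩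
      simp only [List.getD_eq_getElem _ _ hu] at this
      rw [← this]
      refine Set.subset_union_of_subset_right ?_ _
      exact Set.subset_iUnion_of_subset ⟨⟨⟨(bs ⟨a, hab.trans hb⟩, bs ⟨b, hb⟩), hab'⟩, ⟨u, hu'⟩⟩, by simp, by simp⟩ le_rfl

theorem PGen.constS {ι J A : Type} [CommRing A] [Algebra ℂ A] [Fintype ι] (X : Set (J → ι → ℂ)) (S : Set A) :
    PGen X (fun _ => S) := by
  refine ⟨S, fun i _ => i.1, fun i c _ => PC.const _, fun p _ => ?_⟩
  rw [Subtype.range_coe_subtype]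
  rfl

theorem FS_open (PB : Fin (m+1) → List ℕ) (S : Finset (Fin (m+1))) (K : ℕ) :
    OpenC (XW (blkB sz) (QW sz)) (fun Q => RankGE ℂ K (Phi sz S '' FS sz PB S Q)) := by
  refine PGen.openC (PGen.map (PGen.union (PGen.constS _ _) (PGen.iUnion fun j => ?_)) _) K
  refine PGen.tan _ _ _ (WS_nd sz S) 3 (by norm_num) _ fun p hp => ?_
  refine WS_mono sz ?_ (hp j.1).1
  intro b hb
  simp only [Finset.mem_insert, Finset.mem_singleton] at hb
  rcases hb with rfl | rfl
  exacts [j.2.1, j.2.2]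

end cells
end AH

set_option linter.unusedSectionVars false
namespace AH
open MvPolynomial

def szE (e k a : ℕ) : ℕ := cond (Nat.beq (Nat.add a 1) k) e 6

theorem szE_eq (e k a : ℕ) : szE e k a = if a + 1 = k then e else 6 := by
  unfold szE
  cases h : Nat.beq (Nat.add a 1) k with
  | true => rw [if_pos (Nat.eq_of_beq_eq_true h)]; rfl
  | false => rw [if_neg (Nat.ne_of_beq_eq_false h)]; rfl

def ACell (PA : List ℕ) (k K : ℕ) : Prop :=
  ∃ PL qd, (∀ a, ∀ x ∈ PL a, x ∈ PA) ∧ CellOK k (fun _ => 6) PL qd K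

def ECell (e : ℕ) (PA PE : List ℕ) (k K : ℕ) : Prop :=
  ∃ PL qd, (∀ a < k, ∀ x ∈ PL a, x ∈ if a + 1 = k then PE else PA) ∧ CellOK k (szE e k) PL qd K

/-- the points in one block are isotropic -/
def IsoOK (e : ℕ) (P : List ℕ) : Prop :=
  ∀ x ∈ P, x < 10 ^ 7 ∧ polZ (fun _ => e) (csL 1 fun _ => e) x (dz x) = 0

theorem sum_pc {α : Type} [Fintype α] [DecidableEq α] (x : α) (f g : ℕ → ℕ) (k m : ℕ)
    (hm : Fintype.card α = m + 1) :
    ∑ S ∈ Finset.powersetCard (k+1) (Finset.univ : Finset α), (if x ∈ S then g S.card else f S.card) =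
      m.choose (k+1) * f (k+1) + m.choose k * g (k+1) := by
  have hu : (Finset.univ : Finset α) = insert x (Finset.univ.erase x) := by simp
  have hx : x ∉ Finset.univ.erase x := by simp
  have hc : (Finset.univ.erase x).card = m := by simp [Finset.card_erase_of_mem, hm]
  rw [hu, Finset.powersetCard_succ_insert hx, Finset.sum_union, Finset.sum_image]
  · congr 1
    · rw [Finset.sum_congr rfl (g := fun _ => f (k+1))]
      · simp [hc]
      · intro S hS
        obtain ⟨h1, h2⟩ := Finset.mem_powersetCard.1 hS
        rw [if_neg fun h => hx (h1 h), h2]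
    · rw [Finset.sum_congr rfl (g := fun _ => g (k+1))]
      · simp [hc]
      · intro S hS
        obtain ⟨h1, h2⟩ := Finset.mem_powersetCard.1 hS
        rw [if_pos (Finset.mem_insert_self _ _), Finset.card_insert_of_notMem fun h => hx (h1 h), h2]
  · intro S hS T hT h
    have h1 := (Finset.mem_powersetCard.1 (Finset.mem_coe.1 hS)).1
    have h2 := (Finset.mem_powersetCard.1 (Finset.mem_coe.1 hT)).1
    have := congrArg (fun U => Finset.erase U x) h
    simpa [Finset.erase_insert fun h => hx (h1 h), Finset.erase_insert fun h => hx (h2 h)] using this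
  · rw [Finset.disjoint_left]
    intro S hS hS'
    obtain ⟨T, -, rfl⟩ := Finset.mem_image.1 hS'
    exact hx ((Finset.mem_powersetCard.1 hS).1 (Finset.mem_insert_self _ _))

theorem card_QI (m e : ℕ) (sz : Fin (m+1) → ℕ) (hsz : ∀ b, sz b = if b = Fin.last m then e else 6) :
    Fintype.card (QI sz) = 12 * m.choose 2 + m * (2 * e) := by
  rw [Fintype.card_sigma]
  simp only [Fintype.card_fin]
  rw [← Finset.sum_subtype (Finset.univ.filter fun q : Fin (m+1) × Fin (m+1) => q.1 < q.2) (by simp)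
    (fun q => 2 * sz q.2), Finset.sum_filter, Fintype.sum_prod_type, Finset.sum_comm]
  have h : ∀ j : Fin (m+1), ∑ i : Fin (m+1), (if i < j then 2 * sz j else 0) = j * (2 * sz j) := by
    intro j
    rw [← Finset.sum_filter, Finset.sum_const, smul_eq_mul]
    congr 1
    rw [show (Finset.univ.filter fun i : Fin (m+1) => i < j) = Finset.Iio j by ext; simp, Fin.card_Iio]
  simp only [h]
  rw [Fin.sum_univ_castSucc]
  congr 1
  · have h2 : ∀ i : Fin m, sz i.castSucc = 6 := by
      intro i
      rw [hsz, if_neg (Fin.castSucc_lt_last i).ne]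
    simp only [h2, Fin.val_castSucc]
    rw [← Finset.sum_mul, ← Finset.sum_range (fun i => i), Finset.sum_range_id, Nat.choose_two_right]
    ring
  · rw [hsz, if_pos rfl]; simp

theorem block_good (m e : ℕ) (he : e ≤ 7) (PA PE : List ℕ) (hA : IsoOK 6 PA) (hE : IsoOK e PE)
    (κa κe : ℕ → ℕ) (h1a : ACell PA 1 (κa 1)) (h2a : ACell PA 2 (κa 2)) (h3a : ACell PA 3 (κa 3))
    (h1e : ECell e PA PE 1 (κe 1)) (h2e : ECell e PA PE 2 (κe 2)) (h3e : ECell e PA PE 3 (κe 3)) :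
    Good (dotB (Fin (6 * m + e))) 3 (m * PA.length + PE.length + (12 * m.choose 2 + m * (2 * e)))
      (m * κa 1 + κe 1 + (m.choose 2 * κa 2 + m * κe 2) + (m.choose 3 * κa 3 + m.choose 2 * κe 3)) := by
  let sz : Fin (m+1) → ℕ := fun b => if b = Fin.last m then e else 6
  have hsz : ∀ b, sz b = if b = Fin.last m then e else 6 := fun b => rfl
  have hszl : sz (Fin.last m) = e := if_pos rfl
  have hszc : ∀ b, b ≠ Fin.last m → sz b = 6 := fun b hb => if_neg hb
  clear_value sz
  have h7 : ∀ b, sz b ≤ 7 := by intro b; rw [hsz]; split_ifs <;> omega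
  let PB : Fin (m+1) → List ℕ := fun b => if b = Fin.last m then PE else PA
  have hPB : ∀ b, PB b = if b = Fin.last m then PE else PA := fun b => rfl
  have hPBl : PB (Fin.last m) = PE := if_pos rfl
  have hPBc : ∀ b, b ≠ Fin.last m → PB b = PA := fun b hb => if_neg hb
  clear_value PB
  have hiso : ∀ b, IsoOK (sz b) (PB b) := by
    intro b
    by_cases hb : b = Fin.last m
    · rw [hb, hszl, hPBl]; exact hE
    · rw [hszc b hb, hPBc b hb]; exact hA
  let κ : Finset (Fin (m+1)) → ℕ := fun S => if Fin.last m ∈ S then κe S.card else κa S.card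
  let 𝒮 : Finset (Finset (Fin (m+1))) := Finset.powersetCard 1 Finset.univ ∪
    Finset.powersetCard 2 Finset.univ ∪ Finset.powersetCard 3 Finset.univ
  have hsum : ∑ S ∈ 𝒮, κ S =
      m * κa 1 + κe 1 + (m.choose 2 * κa 2 + m * κe 2) + (m.choose 3 * κa 3 + m.choose 2 * κe 3) := by
    have hd : ∀ i j : ℕ, i ≠ j → Disjoint (Finset.powersetCard i (Finset.univ : Finset (Fin (m+1))))
        (Finset.powersetCard j Finset.univ) := by
      intro i j hij
      rw [Finset.disjoint_left]
      intro S h1 h2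
      exact hij ((Finset.mem_powersetCard.1 h1).2.symm.trans (Finset.mem_powersetCard.1 h2).2)
    rw [Finset.sum_union, Finset.sum_union (hd 1 2 (by norm_num))]
    · simp only [κ]
      rw [sum_pc (Fin.last m) κa κe 0 m (by simp), sum_pc (Fin.last m) κa κe 1 m (by simp),
        sum_pc (Fin.last m) κa κe 2 m (by simp)]
      simp
    · rw [Finset.disjoint_union_left]
      exact ⟨hd 1 3 (by norm_num), hd 2 3 (by norm_num)⟩
  have hcell : ∀ S ∈ 𝒮, ∃ Q ∈ XW (blkB sz) (QW sz), RankGE ℂ (κ S) (Phi sz S '' FS sz PB S Q) := by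
    intro S hS
    obtain ⟨k, hk, hkS, hak, hek⟩ : ∃ k, 1 ≤ k ∧ S.card = k ∧ ACell PA k (κa k) ∧ ECell e PA PE k (κe k) := by
      simp only [𝒮, Finset.mem_union, Finset.mem_powersetCard_univ] at hS
      rcases hS with (hS | hS) | hS
      · exact ⟨1, by norm_num, hS, h1a, h1e⟩
      · exact ⟨2, by norm_num, hS, h2a, h2e⟩
      · exact ⟨3, by norm_num, hS, h3a, h3e⟩
    have hmono : StrictMono (S.orderEmbOfFin hkS) := (S.orderEmbOfFin hkS).strictMono
    have himg : Finset.univ.image (S.orderEmbOfFin hkS) = S := by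
      apply Finset.coe_injective
      rw [Finset.coe_image, Finset.coe_univ, Set.image_univ, Finset.range_orderEmbOfFin]
    by_cases hl : Fin.last m ∈ S
    · obtain ⟨PL, qd, hPL, hOK⟩ := hek
      have hlast : ∀ a : Fin k, S.orderEmbOfFin hkS a = Fin.last m ↔ (a : ℕ) + 1 = k := by
        obtain ⟨a0, ha0⟩ : ∃ a0, S.orderEmbOfFin hkS a0 = Fin.last m := by
          have : Fin.last m ∈ Finset.univ.image (S.orderEmbOfFin hkS) := by rw [himg]; exact hl
          obtain ⟨a0, -, h⟩ := Finset.mem_image.1 this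
          exact ⟨a0, h⟩
        have hmax : ∀ a : Fin k, a ≤ a0 := by
          intro a
          rw [← hmono.le_iff_le, ha0]
          exact Fin.le_last _
        have h1 : (a0 : ℕ) + 1 = k := by
          have := hmax ⟨k - 1, by omega⟩
          rw [Fin.le_def] at this
          simp only at this
          have := a0.2
          omega
        intro a
        rw [← ha0, hmono.injective.eq_iff, Fin.ext_iff]
        omega
      have := cell_witness sz h7 hmono (szE e k) ?_ PB PL ?_ (fun b x hx => ((hiso b) x hx).1) qd _ hOK
      · rw [himg] at this
        simp only [κ, if_pos hl, hkS]
        exact this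
      · intro a
        rw [szE_eq, hsz]
        simp only [hlast]
      · intro a x hx
        have := hPL a a.2 x hx
        rw [hPB]
        simp only [hlast]
        exact this
    · obtain ⟨PL, qd, hPL, hOK⟩ := hak
      have hne : ∀ a, S.orderEmbOfFin hkS a ≠ Fin.last m := by
        intro a h
        exact hl (h ▸ S.orderEmbOfFin_mem hkS a)
      have := cell_witness sz h7 hmono (fun _ => 6) (fun a => (hszc _ (hne a)).symm) PB PL
        (fun a x hx => by rw [hPBc _ (hne a)]; exact hPL a x hx) (fun b x hx => ((hiso b) x hx).1) qd _ hOK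
      rw [himg] at this
      simp only [κ, if_neg hl, hkS]
      exact this
  obtain ⟨Q, hQ, hQr⟩ := exists_forall (K := {S // S ∈ 𝒮}) (blkB sz) (blkB_symm sz) (QW sz) (fun j => WS_nd sz _)
    (fun j => by
      refine le_trans ?_ (WS_finrank sz (b := j.1.1.1) (Finset.mem_insert_self _ _))
      rw [hszc _ (lt_of_lt_of_le j.1.2 (Fin.le_last _)).ne]; norm_num)
    (fun S => FS_open sz PB S.1 (κ S.1)) (fun S => hcell S.1 S.2)
  have htot := cells_total 𝒮 (fun S => FS sz PB S Q) (Phi sz) κ ?_ (fun S hS => hQr ⟨S, hS⟩)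
  · rw [hsum] at htot
    have hcard : Fintype.card ((Σ b, Fin (PB b).length) ⊕ QI sz) =
        m * PA.length + PE.length + (12 * m.choose 2 + m * (2 * e)) := by
      rw [Fintype.card_sum, card_QI m e sz hsz, Fintype.card_sigma, Fin.sum_univ_castSucc]
      congr 2
      · simp [hPBc _ (Fin.castSucc_lt_last _).ne]
      · simp [hPBl]
    refine Good.to_std (B := blkB sz) (blkB_symm sz) (by rw [← WS_univ]; exact WS_nd sz _) ?_
      (Good.of_fintype hcard (Sum.elim (fun i => pt sz i.1 ((PB i.1).get i.2)) Q) ?_ ?_)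
    · rw [Fintype.card_sigma, Fin.sum_univ_castSucc]
      simp [hszc _ (Fin.castSucc_lt_last _).ne, hszl, mul_comm]
    · rintro (⟨b, u⟩ | j)
      · have := (hiso b _ ((PB b).get_mem u)).2
        have h := polZ_lft sz (bs := fun _ : Fin 1 => b) (fun _ _ _ => Subsingleton.elim _ _) (fun _ => sz b)
          (fun _ => rfl) (fun _ => h7 b) ((PB b).get u) (dz ((PB b).get u))
        rw [this, Int.cast_zero] at h
        exact h
      · exact (hQ j).2
    · refine htot.mono (Set.iUnion₂_subset fun S hS => ?_)
      have hT : ∀ p, TanW (blkB sz) (WS sz S) 3 p ⊆ TanW (blkB sz) ⊤ 3 p := by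
        rintro p _ ⟨w, -, h1, rfl⟩
        exact ⟨w, trivial, h1, rfl⟩
      refine Set.union_subset (Set.iUnion_subset fun i => ?_) (Set.iUnion_subset fun j => ?_)
      · obtain ⟨u, hu⟩ := List.get_of_mem i.2.2
        refine (hT _).trans (Set.subset_iUnion_of_subset (Sum.inl ⟨i.1.1, u⟩) ?_)
        rw [Sum.elim_inl, hu]
      · exact (hT _).trans (Set.subset_iUnion_of_subset (Sum.inr j.1) le_rfl)
  · intro S T hST f hf
    rcases hf with hf | hf
    · obtain ⟨i, hf⟩ := Set.mem_iUnion.1 hf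
      refine Phi_zero sz hST ?_ hf
      refine WS_mono sz ?_ (lft_WS sz (fun _ : Fin 1 => i.1.1) _)
      intro b hb
      simp only [Finset.mem_image, Finset.mem_univ, true_and, exists_const] at hb
      rw [← hb]; exact i.2.1
    · obtain ⟨j, hf⟩ := Set.mem_iUnion.1 hf
      refine Phi_zero sz hST ?_ hf
      refine WS_mono sz ?_ (hQ j.1).1
      intro b hb
      simp only [Finset.mem_insert, Finset.mem_singleton] at hb
      rcases hb with rfl | rfl
      exacts [j.2.1, j.2.2]

end AH

set_option linter.unusedSectionVars false
namespace AH
open MvPolynomial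

theorem ACell.of_ECell {PA : List ℕ} {k K : ℕ} (h : ECell 6 PA PA k K) : ACell PA k K := by
  obtain ⟨PL, qd, h1, h2⟩ := h
  have hs : szE 6 k = fun _ => 6 := by
    funext a
    rw [szE_eq, ite_self]
  rw [hs] at h2
  refine ⟨fun a => if a < k then PL a else [], qd, ?_, ?_⟩
  · intro a x hx
    by_cases ha : a < k
    · beta_reduce at hx
      rw [if_pos ha] at hx
      have := h1 a ha x hx
      rwa [ite_self] at this
    · beta_reduce at hx
      rw [if_neg ha] at hx
      simp at hx
  · have : allx k (fun a => if a < k then PL a else []) qd = allx k PL qd := by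
      unfold allx
      congr 1
      simp only [List.flatMap]
      congr 1
      apply List.map_congr_left
      intro a ha
      rw [if_pos (List.mem_range.1 ha)]
    unfold CellOK at h2 ⊢
    rw [this]
    exact h2

def ZOK (x a b a' : ℕ) : Prop := a' = a ∨ a' = b ∨ ∀ t < 7, dg x (7 * a' + t) = 0

instance (x a b a' : ℕ) : Decidable (ZOK x a b a') := by
  unfold ZOK
  infer_instance

def QOK (sz : ℕ → ℕ) (cs : List ℕ) (k a b : ℕ) (l : List ℕ) : Prop :=
  l.length = 2 * sz b ∧ ∀ x ∈ l, polZ sz cs x (dz x) = 0 ∧ ∀ a' < k, ZOK x a b a'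

instance (sz : ℕ → ℕ) (cs : List ℕ) (k a b : ℕ) (l : List ℕ) : Decidable (QOK sz cs k a b l) := by
  unfold QOK
  infer_instance

theorem ECell.mk' (e k : ℕ) (PA PE : List ℕ) (PL : ℕ → List ℕ) (qd : ℕ → ℕ → List ℕ) (cs xs : List ℕ)
    (bl : List Blk) (K w : ℕ) (hPL : ∀ a < k, ∀ x ∈ PL a, x ∈ if a + 1 = k then PE else PA)
    (hcs : csL k (szE e k) = cs) (hxs : allx k PL qd = xs) (hw : (cols3 bl).length = w)
    (hq : ∀ b < k, ∀ a < b, QOK (szE e k) cs k a b (qd a b))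
    (hc : (0 ∈ cs ∧ cs.Nodup) ∧
      (∀ c ∈ cols3 bl, (c.1 ∈ cs ∧ c.2.1 ∈ cs ∧ c.2.2 ∈ cs) ∧
        ∀ a < k, a = c.1 / 7 ∨ a = c.2.1 / 7 ∨ a = c.2.2 / 7))
    (hr : Nat.ble K (rankN w (rowsL (szE e k) cs (row3s bl) xs)) = true) : ECell e PA PE k K := by
  subst hcs hxs hw
  exact ⟨PL, qd, hPL, hq, bl, hc.1, hc.2, hr⟩

def sel2 (l0 l1 : List ℕ) (a : ℕ) : List ℕ := cond (Nat.beq a 0) l0 l1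

def selq (l01 l02 l12 : List ℕ) (a b : ℕ) : List ℕ :=
  cond (Nat.beq b 1) l01 (cond (Nat.beq a 0) l02 l12)

set_option maxRecDepth 100000

def PA : List ℕ := [1, 10, 100, 1000, 10000, 100000, 660061, 161160, 661606, 6111]

def Q2 : List ℕ := [160110001, 110111616, 610116010, 660061610]

def P2C : List ℕ := [1, 10]

theorem iso2C : IsoOK 2 P2C := by
  unfold IsoOK
  decide +kernel

theorem cell2C1 : ECell 2 PA P2C 1 2 :=
  ECell.mk' 2 1 PA P2C (fun _ => P2C) (fun _ _ => []) [0, 1]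
    [1, 10]
    [([0, 1], [0, 1], [0, 1])] 2 8 (by decide +kernel) (by decide +kernel) (by decide +kernel) (by decide +kernel) (by decide +kernel)
    (by decide +kernel) (by decide +kernel)

theorem cell2C2 : ECell 2 PA P2C 2 60 :=
  ECell.mk' 2 2 PA P2C (sel2 PA P2C) (fun _ _ => Q2) [0, 1, 2, 3, 4, 5, 7, 8]
    [1, 10, 100, 1000, 10000, 100000, 660061, 161160, 661606, 6111, 10000000, 100000000, 160110001, 110111616, 610116010, 660061610]
    [([0, 1, 2, 3, 4, 5], [0, 1, 2, 3, 4, 5], [7, 8]), ([7, 8], [7, 8], [0, 1, 2, 3, 4, 5])] 60 96 (by decide +kernel) (by decide +kernel) (by decide +kernel) (by decide +kernel) (by decide +kernel)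
    (by decide +kernel) (by decide +kernel)

theorem cell23 (PA PE : List ℕ) : ECell 2 PA PE 3 72 :=
  ECell.mk' 2 3 PA PE (fun _ => []) (selq
    [660060010106, 600000100100, 1001000001006, 60000101000, 606100060100, 601000000010, 100060110061, 10600010060, 1060010100601, 1000000010160, 11160000610, 60600600060]
    [6000000000010000, 6100000000601066, 6000000000106060, 6000000000166066]
    [100610060000000, 606001000000000, 600001010000000, 6600010160000000]) [0, 1, 2, 3, 4, 5, 7, 8, 9, 10, 11, 12, 14, 15]
    [660060010106, 600000100100, 1001000001006, 60000101000, 606100060100, 601000000010, 100060110061, 10600010060, 1060010100601, 1000000010160, 11160000610, 60600600060, 6000000000010000, 6100000000601066, 6000000000106060, 6000000000166066, 100610060000000, 606001000000000, 600001010000000, 6600010160000000]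
    [([0, 1, 2, 3, 4, 5], [7, 8, 9, 10, 11, 12], [14, 15])] 72 72
    (by simp) (by decide +kernel) (by decide +kernel) (by decide +kernel) (by decide +kernel)
    (by decide +kernel) (by decide +kernel)

def Q3 : List ℕ := [1060610600, 160661666, 6010610101, 610061110, 1100616111, 6000160060]

def P3C : List ℕ := [1, 10, 616, 661]

theorem iso3C : IsoOK 3 P3C := by
  unfold IsoOK
  decide +kernel

theorem cell3C1 : ECell 3 PA P3C 1 7 :=
  ECell.mk' 3 1 PA P3C (fun _ => P3C) (fun _ _ => []) [0, 1, 2]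
    [1, 10, 616, 661]
    [([0, 1, 2], [0, 1, 2], [0, 1, 2])] 7 27 (by decide +kernel) (by decide +kernel) (by decide +kernel) (by decide +kernel) (by decide +kernel)
    (by decide +kernel) (by decide +kernel)

theorem cell3C2 : ECell 3 PA P3C 2 99 :=
  ECell.mk' 3 2 PA P3C (sel2 PA P3C) (fun _ _ => Q3) [0, 1, 2, 3, 4, 5, 7, 8, 9]
    [1, 10, 100, 1000, 10000, 100000, 660061, 161160, 661606, 6111, 10000000, 100000000, 6160000000, 6610000000, 1060610600, 160661666, 6010610101, 610061110, 1100616111, 6000160060]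
    [([0, 1, 2, 3, 4, 5], [0, 1, 2, 3, 4, 5], [7, 8, 9]), ([7, 8, 9], [7, 8, 9], [0, 1, 2, 3, 4, 5])] 99 162 (by decide +kernel) (by decide +kernel) (by decide +kernel) (by decide +kernel) (by decide +kernel)
    (by decide +kernel) (by decide +kernel)

def P3F : List ℕ := [1, 10, 616]

theorem iso3F : IsoOK 3 P3F := by
  unfold IsoOK
  decide +kernel

theorem cell3F1 : ECell 3 PA P3F 1 6 :=
  ECell.mk' 3 1 PA P3F (fun _ => P3F) (fun _ _ => []) [0, 1, 2]
    [1, 10, 616]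
    [([0, 1, 2], [0, 1, 2], [0, 1, 2])] 6 27 (by decide +kernel) (by decide +kernel) (by decide +kernel) (by decide +kernel) (by decide +kernel)
    (by decide +kernel) (by decide +kernel)

theorem cell3F2 : ECell 3 PA P3F 2 96 :=
  ECell.mk' 3 2 PA P3F (sel2 PA P3F) (fun _ _ => Q3) [0, 1, 2, 3, 4, 5, 7, 8, 9]
    [1, 10, 100, 1000, 10000, 100000, 660061, 161160, 661606, 6111, 10000000, 100000000, 6160000000, 1060610600, 160661666, 6010610101, 610061110, 1100616111, 6000160060]
    [([0, 1, 2, 3, 4, 5], [0, 1, 2, 3, 4, 5], [7, 8, 9]), ([7, 8, 9], [7, 8, 9], [0, 1, 2, 3, 4, 5])] 96 162 (by decide +kernel) (by decide +kernel) (by decide +kernel) (by decide +kernel) (by decide +kernel)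
    (by decide +kernel) (by decide +kernel)

theorem cell33 (PA PE : List ℕ) : ECell 3 PA PE 3 108 :=
  ECell.mk' 3 3 PA PE (fun _ => []) (selq
    [6060060000600, 1060600600, 6166000010060, 1100600601606, 610106606, 6000066001, 6006600000660, 10600600606, 61060006600, 606000010010, 600060010, 6660166060]
    [6000000000060000, 6000000000001010, 100000000011001, 10000000000061606, 6000000000101006, 6100000000660000]
    [16106000000000000, 1100116000000000, 61600100000000000, 11600060000000000, 1100016000000000, 66006061010000000]) [0, 1, 2, 3, 4, 5, 7, 8, 9, 10, 11, 12, 14, 15, 16]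
    [6060060000600, 1060600600, 6166000010060, 1100600601606, 610106606, 6000066001, 6006600000660, 10600600606, 61060006600, 606000010010, 600060010, 6660166060, 6000000000060000, 6000000000001010, 100000000011001, 10000000000061606, 6000000000101006, 6100000000660000, 16106000000000000, 1100116000000000, 61600100000000000, 11600060000000000, 1100016000000000, 66006061010000000]
    [([0, 1, 2, 3, 4, 5], [7, 8, 9, 10, 11, 12], [14, 15, 16])] 108 108
    (by simp) (by decide +kernel) (by decide +kernel) (by decide +kernel) (by decide +kernel)
    (by decide +kernel) (by decide +kernel)

def Q4 : List ℕ := [60600011010, 1100161101, 160600111, 11610000610, 60060001611, 66000600016, 6100116110, 1100600110]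

def P4C : List ℕ := [1, 10, 100, 1000, 1666, 6166]

theorem iso4C : IsoOK 4 P4C := by
  unfold IsoOK
  decide +kernel

theorem cell4C1 : ECell 4 PA P4C 1 16 :=
  ECell.mk' 4 1 PA P4C (fun _ => P4C) (fun _ _ => []) [0, 1, 2, 3]
    [1, 10, 100, 1000, 1666, 6166]
    [([0, 1, 2, 3], [0, 1, 2, 3], [0, 1, 2, 3])] 16 64 (by decide +kernel) (by decide +kernel) (by decide +kernel) (by decide +kernel) (by decide +kernel)
    (by decide +kernel) (by decide +kernel)

theorem cell4C2 : ECell 4 PA P4C 2 144 :=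
  ECell.mk' 4 2 PA P4C (sel2 PA P4C) (fun _ _ => Q4) [0, 1, 2, 3, 4, 5, 7, 8, 9, 10]
    [1, 10, 100, 1000, 10000, 100000, 660061, 161160, 661606, 6111, 10000000, 100000000, 1000000000, 10000000000, 16660000000, 61660000000, 60600011010, 1100161101, 160600111, 11610000610, 60060001611, 66000600016, 6100116110, 1100600110]
    [([0, 1, 2, 3, 4, 5], [0, 1, 2, 3, 4, 5], [7, 8, 9, 10]), ([7, 8, 9, 10], [7, 8, 9, 10], [0, 1, 2, 3, 4, 5])] 144 240 (by decide +kernel) (by decide +kernel) (by decide +kernel) (by decide +kernel) (by decide +kernel)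
    (by decide +kernel) (by decide +kernel)

def P4F : List ℕ := [1, 10, 100, 1000, 1666]

theorem iso4F : IsoOK 4 P4F := by
  unfold IsoOK
  decide +kernel

theorem cell4F1 : ECell 4 PA P4F 1 15 :=
  ECell.mk' 4 1 PA P4F (fun _ => P4F) (fun _ _ => []) [0, 1, 2, 3]
    [1, 10, 100, 1000, 1666]
    [([0, 1, 2, 3], [0, 1, 2, 3], [0, 1, 2, 3])] 15 64 (by decide +kernel) (by decide +kernel) (by decide +kernel) (by decide +kernel) (by decide +kernel)
    (by decide +kernel) (by decide +kernel)

theorem cell4F2 : ECell 4 PA P4F 2 142 :=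
  ECell.mk' 4 2 PA P4F (sel2 PA P4F) (fun _ _ => Q4) [0, 1, 2, 3, 4, 5, 7, 8, 9, 10]
    [1, 10, 100, 1000, 10000, 100000, 660061, 161160, 661606, 6111, 10000000, 100000000, 1000000000, 10000000000, 16660000000, 60600011010, 1100161101, 160600111, 11610000610, 60060001611, 66000600016, 6100116110, 1100600110]
    [([0, 1, 2, 3, 4, 5], [0, 1, 2, 3, 4, 5], [7, 8, 9, 10]), ([7, 8, 9, 10], [7, 8, 9, 10], [0, 1, 2, 3, 4, 5])] 142 240 (by decide +kernel) (by decide +kernel) (by decide +kernel) (by decide +kernel) (by decide +kernel)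
    (by decide +kernel) (by decide +kernel)

theorem cell43 (PA PE : List ℕ) : ECell 4 PA PE 3 144 :=
  ECell.mk' 4 3 PA PE (fun _ => []) (selq
    [1006600601000, 10000100000, 1010010100, 110100100000, 6010100000660, 1666060060001, 1001000000660, 106600000060, 16110061060, 6066000611001, 60100000660, 1060100006]
    [1600000000001101, 100000000000010101, 100000000000000600, 106000000000001006, 600600000000001006, 600000000016001, 600000000000061010, 66000000000600006]
    [661600160000000000, 60100100060000000, 1000610100000000, 6000006000000000, 60001000600000000, 100600600000000000, 116006100000000000, 660006006160000000]) [0, 1, 2, 3, 4, 5, 7, 8, 9, 10, 11, 12, 14, 15, 16, 17]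
    [1006600601000, 10000100000, 1010010100, 110100100000, 6010100000660, 1666060060001, 1001000000660, 106600000060, 16110061060, 6066000611001, 60100000660, 1060100006, 1600000000001101, 100000000000010101, 100000000000000600, 106000000000001006, 600600000000001006, 600000000016001, 600000000000061010, 66000000000600006, 661600160000000000, 60100100060000000, 1000610100000000, 6000006000000000, 60001000600000000, 100600600000000000, 116006100000000000, 660006006160000000]
    [([0, 1, 2, 3, 4, 5], [7, 8, 9, 10, 11, 12], [14, 15, 16, 17])] 144 144
    (by simp) (by decide +kernel) (by decide +kernel) (by decide +kernel) (by decide +kernel)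
    (by decide +kernel) (by decide +kernel)

def Q5 : List ℕ := [161010110161, 60100601001, 10160116166, 1110606106, 101610611066, 60010100600, 61100006610, 611010161610, 106610610011, 61660116110]

def P5C : List ℕ := [1, 10, 100, 1000, 6616, 66106, 66061, 10016]

theorem iso5C : IsoOK 5 P5C := by
  unfold IsoOK
  decide +kernel

theorem cell5C1 : ECell 5 PA P5C 1 30 :=
  ECell.mk' 5 1 PA P5C (fun _ => P5C) (fun _ _ => []) [0, 1, 2, 3, 4]
    [1, 10, 100, 1000, 6616, 66106, 66061, 10016]
    [([0, 1, 2, 3, 4], [0, 1, 2, 3, 4], [0, 1, 2, 3, 4])] 30 125 (by decide +kernel) (by decide +kernel) (by decide +kernel) (by decide +kernel) (by decide +kernel)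
    (by decide +kernel) (by decide +kernel)

theorem cell5C2 : ECell 5 PA P5C 2 195 :=
  ECell.mk' 5 2 PA P5C (sel2 PA P5C) (fun _ _ => Q5) [0, 1, 2, 3, 4, 5, 7, 8, 9, 10, 11]
    [1, 10, 100, 1000, 10000, 100000, 660061, 161160, 661606, 6111, 10000000, 100000000, 1000000000, 10000000000, 66160000000, 661060000000, 660610000000, 100160000000, 161010110161, 60100601001, 10160116166, 1110606106, 101610611066, 60010100600, 61100006610, 611010161610, 106610610011, 61660116110]
    [([0, 1, 2, 3, 4, 5], [0, 1, 2, 3, 4, 5], [7, 8, 9, 10, 11]), ([7, 8, 9, 10, 11], [7, 8, 9, 10, 11], [0, 1, 2, 3, 4, 5])] 195 330 (by decide +kernel) (by decide +kernel) (by decide +kernel) (by decide +kernel) (by decide +kernel)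
    (by decide +kernel) (by decide +kernel)

def P5F : List ℕ := [1, 10, 100, 1000, 6616, 66106, 66061]

theorem iso5F : IsoOK 5 P5F := by
  unfold IsoOK
  decide +kernel

theorem cell5F1 : ECell 5 PA P5F 1 28 :=
  ECell.mk' 5 1 PA P5F (fun _ => P5F) (fun _ _ => []) [0, 1, 2, 3, 4]
    [1, 10, 100, 1000, 6616, 66106, 66061]
    [([0, 1, 2, 3, 4], [0, 1, 2, 3, 4], [0, 1, 2, 3, 4])] 28 125 (by decide +kernel) (by decide +kernel) (by decide +kernel) (by decide +kernel) (by decide +kernel)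
    (by decide +kernel) (by decide +kernel)

theorem cell5F2 : ECell 5 PA P5F 2 192 :=
  ECell.mk' 5 2 PA P5F (sel2 PA P5F) (fun _ _ => Q5) [0, 1, 2, 3, 4, 5, 7, 8, 9, 10, 11]
    [1, 10, 100, 1000, 10000, 100000, 660061, 161160, 661606, 6111, 10000000, 100000000, 1000000000, 10000000000, 66160000000, 661060000000, 660610000000, 161010110161, 60100601001, 10160116166, 1110606106, 101610611066, 60010100600, 61100006610, 611010161610, 106610610011, 61660116110]
    [([0, 1, 2, 3, 4, 5], [0, 1, 2, 3, 4, 5], [7, 8, 9, 10, 11]), ([7, 8, 9, 10, 11], [7, 8, 9, 10, 11], [0, 1, 2, 3, 4, 5])] 192 330 (by decide +kernel) (by decide +kernel) (by decide +kernel) (by decide +kernel) (by decide +kernel)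
    (by decide +kernel) (by decide +kernel)

theorem cell53 (PA PE : List ℕ) : ECell 5 PA PE 3 180 :=
  ECell.mk' 5 3 PA PE (fun _ => []) (selq
    [1006000016000, 1060600100006, 10600060010, 600000000100, 6000060000, 1010000000110, 606000000010, 110010060000, 1106000611010, 106600600110, 1006060000100, 6060000000101]
    [1061600000000600000, 1000600000000011600, 606000000000606000, 100000000600060, 60600000000016010, 600100000000016001, 1010000000000600616, 1016100000000100600, 1606100000000101116, 1100600000000610006]
    [1006111000000000, 10006000010000000, 60001611060000000, 601000600600000000, 600000010010000000, 100100001010000000, 60100600600000000, 66006000000000000, 106000660600000000, 6600661010000000]) [0, 1, 2, 3, 4, 5, 7, 8, 9, 10, 11, 12, 14, 15, 16, 17, 18]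
    [1006000016000, 1060600100006, 10600060010, 600000000100, 6000060000, 1010000000110, 606000000010, 110010060000, 1106000611010, 106600600110, 1006060000100, 6060000000101, 1061600000000600000, 1000600000000011600, 606000000000606000, 100000000600060, 60600000000016010, 600100000000016001, 1010000000000600616, 1016100000000100600, 1606100000000101116, 1100600000000610006, 1006111000000000, 10006000010000000, 60001611060000000, 601000600600000000, 600000010010000000, 100100001010000000, 60100600600000000, 66006000000000000, 106000660600000000, 6600661010000000]
    [([0, 1, 2, 3, 4, 5], [7, 8, 9, 10, 11, 12], [14, 15, 16, 17, 18])] 180 180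
    (by simp) (by decide +kernel) (by decide +kernel) (by decide +kernel) (by decide +kernel)
    (by decide +kernel) (by decide +kernel)

def Q6 : List ℕ := [6616660601600, 1016060116661, 1010060016001, 6660010606061, 6000160611111, 1106160010660, 1111160011660, 660160116010, 1116010066616, 106060166601, 1166160601061, 6160060106011]

theorem iso6C : IsoOK 6 PA := by
  unfold IsoOK
  decide +kernel

theorem cell6C1 : ECell 6 PA PA 1 50 :=
  ECell.mk' 6 1 PA PA (fun _ => PA) (fun _ _ => []) [0, 1, 2, 3, 4, 5]
    [1, 10, 100, 1000, 10000, 100000, 660061, 161160, 661606, 6111]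
    [([0, 1, 2, 3, 4, 5], [0, 1, 2, 3, 4, 5], [0, 1, 2, 3, 4, 5])] 50 216 (by decide +kernel) (by decide +kernel) (by decide +kernel) (by decide +kernel) (by decide +kernel)
    (by decide +kernel) (by decide +kernel)

theorem cell6C2 : ECell 6 PA PA 2 252 :=
  ECell.mk' 6 2 PA PA (sel2 PA PA) (fun _ _ => Q6) [0, 1, 2, 3, 4, 5, 7, 8, 9, 10, 11, 12]
    [1, 10, 100, 1000, 10000, 100000, 660061, 161160, 661606, 6111, 10000000, 100000000, 1000000000, 10000000000, 100000000000, 1000000000000, 6600610000000, 1611600000000, 6616060000000, 61110000000, 6616660601600, 1016060116661, 1010060016001, 6660010606061, 6000160611111, 1106160010660, 1111160011660, 660160116010, 1116010066616, 106060166601, 1166160601061, 6160060106011]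
    [([0, 1, 2, 3, 4, 5], [0, 1, 2, 3, 4, 5], [7, 8, 9, 10, 11, 12]), ([7, 8, 9, 10, 11, 12], [7, 8, 9, 10, 11, 12], [0, 1, 2, 3, 4, 5])] 252 432 (by decide +kernel) (by decide +kernel) (by decide +kernel) (by decide +kernel) (by decide +kernel)
    (by decide +kernel) (by decide +kernel)

theorem cell63 (PA PE : List ℕ) : ECell 6 PA PE 3 216 :=
  ECell.mk' 6 3 PA PE (fun _ => []) (selq
    [1010060060001, 610000100001, 601000000001, 1000000101, 6010610000011, 660060100110, 160100100000, 1000100106006, 60166600, 610600010660, 610000016000, 1600000610]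
    [60000000000000006000, 60011000000000001000, 16600000000000660100, 1060000000000000010, 10100000000006000, 10100000000000000110, 60610100000000066601, 6000000000000600, 66000000000100100, 60010000000000600001, 1011000000000010000, 6006100000000110606]
    [60006000010000000, 1000006100110000000, 10000106010000000000, 1060606010100000000, 60106000060000000000, 600010010000000, 1006001006000000000, 6000600060100000000, 66160000010600000000, 61110000060600000000, 1000001611000000000, 601006001060000000]) [0, 1, 2, 3, 4, 5, 7, 8, 9, 10, 11, 12, 14, 15, 16, 17, 18, 19]
    [1010060060001, 610000100001, 601000000001, 1000000101, 6010610000011, 660060100110, 160100100000, 1000100106006, 60166600, 610600010660, 610000016000, 1600000610, 60000000000000006000, 60011000000000001000, 16600000000000660100, 1060000000000000010, 10100000000006000, 10100000000000000110, 60610100000000066601, 6000000000000600, 66000000000100100, 60010000000000600001, 1011000000000010000, 6006100000000110606, 60006000010000000, 1000006100110000000, 10000106010000000000, 1060606010100000000, 60106000060000000000, 600010010000000, 1006001006000000000, 6000600060100000000, 66160000010600000000, 61110000060600000000, 1000001611000000000, 601006001060000000]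
    [([0, 1, 2, 3, 4, 5], [7, 8, 9, 10, 11, 12], [14, 15, 16, 17, 18, 19])] 216 216
    (by simp) (by decide +kernel) (by decide +kernel) (by decide +kernel) (by decide +kernel)
    (by decide +kernel) (by decide +kernel)

def Q7 : List ℕ := [6100100010111, 11611060011600, 66161600660600, 60060010006, 60660060601016, 10001600616000, 10000000001600, 110000100060, 1110600160660, 611000101601, 6010060060100, 6006060600660, 10100610016000, 161110011010]

def P7C : List ℕ := [1, 10, 100, 1000, 10000, 100000, 6160106, 1060661, 1006110, 116100, 1060016, 166066, 1160000]

theorem iso7C : IsoOK 7 P7C := by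
  unfold IsoOK
  decide +kernel

theorem cell7C1 : ECell 7 PA P7C 1 77 :=
  ECell.mk' 7 1 PA P7C (fun _ => P7C) (fun _ _ => []) [0, 1, 2, 3, 4, 5, 6]
    [1, 10, 100, 1000, 10000, 100000, 6160106, 1060661, 1006110, 116100, 1060016, 166066, 1160000]
    [([0, 1, 2, 3, 4, 5, 6], [0, 1, 2, 3, 4, 5, 6], [0, 1, 2, 3, 4, 5, 6])] 77 343 (by decide +kernel) (by decide +kernel) (by decide +kernel) (by decide +kernel) (by decide +kernel)
    (by decide +kernel) (by decide +kernel)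

theorem cell7C2 : ECell 7 PA P7C 2 315 :=
  ECell.mk' 7 2 PA P7C (sel2 PA P7C) (fun _ _ => Q7) [0, 1, 2, 3, 4, 5, 7, 8, 9, 10, 11, 12, 13]
    [1, 10, 100, 1000, 10000, 100000, 660061, 161160, 661606, 6111, 10000000, 100000000, 1000000000, 10000000000, 100000000000, 1000000000000, 61601060000000, 10606610000000, 10061100000000, 1161000000000, 10600160000000, 1660660000000, 11600000000000, 6100100010111, 11611060011600, 66161600660600, 60060010006, 60660060601016, 10001600616000, 10000000001600, 110000100060, 1110600160660, 611000101601, 6010060060100, 6006060600660, 10100610016000, 161110011010]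
    [([0, 1, 2, 3, 4, 5], [0, 1, 2, 3, 4, 5], [7, 8, 9, 10, 11, 12, 13]), ([7, 8, 9, 10, 11, 12, 13], [7, 8, 9, 10, 11, 12, 13], [0, 1, 2, 3, 4, 5])] 315 546 (by decide +kernel) (by decide +kernel) (by decide +kernel) (by decide +kernel) (by decide +kernel)
    (by decide +kernel) (by decide +kernel)

def P7F : List ℕ := [1, 10, 100, 1000, 10000, 100000, 6160106, 1060661, 1006110, 116100, 1060016, 166066]

theorem iso7F : IsoOK 7 P7F := by
  unfold IsoOK
  decide +kernel

theorem cell7F1 : ECell 7 PA P7F 1 72 :=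
  ECell.mk' 7 1 PA P7F (fun _ => P7F) (fun _ _ => []) [0, 1, 2, 3, 4, 5, 6]
    [1, 10, 100, 1000, 10000, 100000, 6160106, 1060661, 1006110, 116100, 1060016, 166066]
    [([0, 1, 2, 3, 4, 5, 6], [0, 1, 2, 3, 4, 5, 6], [0, 1, 2, 3, 4, 5, 6])] 72 343 (by decide +kernel) (by decide +kernel) (by decide +kernel) (by decide +kernel) (by decide +kernel)
    (by decide +kernel) (by decide +kernel)

theorem cell7F2 : ECell 7 PA P7F 2 310 :=
  ECell.mk' 7 2 PA P7F (sel2 PA P7F) (fun _ _ => Q7) [0, 1, 2, 3, 4, 5, 7, 8, 9, 10, 11, 12, 13]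
    [1, 10, 100, 1000, 10000, 100000, 660061, 161160, 661606, 6111, 10000000, 100000000, 1000000000, 10000000000, 100000000000, 1000000000000, 61601060000000, 10606610000000, 10061100000000, 1161000000000, 10600160000000, 1660660000000, 6100100010111, 11611060011600, 66161600660600, 60060010006, 60660060601016, 10001600616000, 10000000001600, 110000100060, 1110600160660, 611000101601, 6010060060100, 6006060600660, 10100610016000, 161110011010]
    [([0, 1, 2, 3, 4, 5], [0, 1, 2, 3, 4, 5], [7, 8, 9, 10, 11, 12, 13]), ([7, 8, 9, 10, 11, 12, 13], [7, 8, 9, 10, 11, 12, 13], [0, 1, 2, 3, 4, 5])] 310 546 (by decide +kernel) (by decide +kernel) (by decide +kernel) (by decide +kernel) (by decide +kernel)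
    (by decide +kernel) (by decide +kernel)

theorem cell73 (PA PE : List ℕ) : ECell 7 PA PE 3 252 :=
  ECell.mk' 7 3 PA PE (fun _ => []) (selq
    [6000061000, 10000060, 16000010166, 61000016660, 10000000106, 11000101016, 66610001666, 60060600001, 101000010601, 116000006601, 6111060660616, 101010060106]
    [60061100000000001601, 10610600000000106600, 166600000000060601, 66006100000000616601, 100100000000000106106, 6001000000000010000, 60100000000000010100, 600000000066111, 600161000000000010006, 660010000000000600116, 10100100000000166610, 111600000000006001, 60600600000000000006, 1010600000000010600]
    [106101001001160000000, 61006606001000000000, 61000001001660000000, 10060600600000000000, 100000006160000000000, 116600100106000000000, 6660000661600000000, 610606601060000000, 10100606001600000000, 60060000160010000000, 10010006006010000000, 10010106106110000000, 10601000060000000, 61061100100000000000]) [0, 1, 2, 3, 4, 5, 7, 8, 9, 10, 11, 12, 14, 15, 16, 17, 18, 19, 20]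
    [6000061000, 10000060, 16000010166, 61000016660, 10000000106, 11000101016, 66610001666, 60060600001, 101000010601, 116000006601, 6111060660616, 101010060106, 60061100000000001601, 10610600000000106600, 166600000000060601, 66006100000000616601, 100100000000000106106, 6001000000000010000, 60100000000000010100, 600000000066111, 600161000000000010006, 660010000000000600116, 10100100000000166610, 111600000000006001, 60600600000000000006, 1010600000000010600, 106101001001160000000, 61006606001000000000, 61000001001660000000, 10060600600000000000, 100000006160000000000, 116600100106000000000, 6660000661600000000, 610606601060000000, 10100606001600000000, 60060000160010000000, 10010006006010000000, 10010106106110000000, 10601000060000000, 61061100100000000000]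
    [([0, 1, 2, 3, 4, 5], [7, 8, 9, 10, 11, 12], [14, 15, 16, 17, 18, 19, 20])] 252 252
    (by simp) (by decide +kernel) (by decide +kernel) (by decide +kernel) (by decide +kernel)
    (by decide +kernel) (by decide +kernel)

end AH

set_option linter.unusedSectionVars false
namespace AH
open MvPolynomial

theorem two_choose (m : ℕ) : (2 * m.choose 2 : ℤ) = m * (m - 1) := by
  induction m with
  | zero => simp
  | succ k ih =>
    rw [Nat.choose_succ_succ' k 1]
    push_cast
    rw [Nat.choose_one_right]
    linear_combination ih

theorem six_choose (m : ℕ) : (6 * m.choose 3 : ℤ) = m * (m - 1) * (m - 2) := by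
  induction m with
  | zero => simp
  | succ k ih =>
    rw [Nat.choose_succ_succ' k 2]
    push_cast
    linear_combination ih + 3 * two_choose k

theorem acell1 : ACell PA 1 50 := ACell.of_ECell cell6C1
theorem acell2 : ACell PA 2 252 := ACell.of_ECell cell6C2
theorem acell3 : ACell PA 3 216 := ACell.of_ECell (cell63 _ _)

def kap (a b c k : ℕ) : ℕ := if k = 1 then a else if k = 2 then b else c

theorem AHn3_block (m e s t : ℕ) (he : e + 1 ≤ 7) (PF PC : List ℕ) (hF : IsoOK (e+1) PF) (hC : IsoOK (e+1) PC)
    (hs : PF.length = s) (ht : PC.length = t) (hst : t ≤ s + 1) {f1 f2 f3 c1 c2 : ℕ}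
    (h1F : ECell (e+1) PA PF 1 f1) (h2F : ECell (e+1) PA PF 2 f2) (h3F : ECell (e+1) PA PF 3 f3)
    (h1C : ECell (e+1) PA PC 1 c1) (h2C : ECell (e+1) PA PC 2 c2) (h3C : ECell (e+1) PA PC 3 f3)
    (e1 : f1 = e * s) (e2 : f2 = 10 * (e+1) + 2 * (e+1) * (e+6) + 6 * s) (e3 : f3 = 36 * (e+1))
    (e4 : 6 * c1 = e * (e+1) * (e+5)) (e5 : c2 = 3 * (e+1)^2 + 24 * (e+1)) : AHn (6 * m + e) 3 := by
  have g0 := block_good m (e+1) he PA PF iso6C hF (kap 50 252 216) (kap f1 f2 f3)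
    acell1 acell2 acell3 h1F h2F h3F
  have g1 := block_good m (e+1) he PA PC iso6C hC (kap 50 252 216) (kap c1 c2 f3)
    acell1 acell2 acell3 h1C h2C h3C
  simp only [kap, if_true, show (2:ℕ) ≠ 1 by norm_num, show (3:ℕ) ≠ 1 by norm_num, show (3:ℕ) ≠ 2 by norm_num,
    if_false] at g0 g1
  have hPA : PA.length = 10 := rfl
  rw [hPA, hs] at g0
  rw [hPA, ht] at g1
  have A := two_choose m
  have B := six_choose m
  subst e1 e2 e3 e5
  refine AHn_of (by norm_num) (r0 := m * 10 + s + (12 * m.choose 2 + m * (2 * (e+1))))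
    (r1 := m * 10 + t + (12 * m.choose 2 + m * (2 * (e+1)))) ?_ ?_ (by omega)
  · have : (m * 10 + s + (12 * m.choose 2 + m * (2 * (e+1)))) * (6 * m + e) =
        m * 50 + e * s + (m.choose 2 * 252 + m * (10 * (e + 1) + 2 * (e + 1) * (e + 6) + 6 * s)) +
        (m.choose 3 * 216 + m.choose 2 * (36 * (e + 1))) := by
      zify
      linear_combination (6 * (6 * (m:ℤ) + e) - 126 - 18 * ((e:ℤ)+1)) * A - 36 * B
    rw [this]
    exact g0
  · have : hh (6 * m + e) 3 = m * 50 + c1 + (m.choose 2 * 252 + m * (3 * (e + 1) ^ 2 + 24 * (e + 1))) +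
        (m.choose 3 * 216 + m.choose 2 * (36 * (e + 1))) := by
      have h3 := hh_d3 (6 * m + e)
      zify at h3 e4 ⊢
      apply mul_left_cancel₀ (show (6:ℤ) ≠ 0 by norm_num)
      rw [h3]
      linear_combination (- 756 - 108 * ((e:ℤ)+1)) * A - 216 * B - e4
    rw [this]
    exact g1

theorem AHn3 (n : ℕ) (hn : 3 ≤ n) : AHn n 3 := by
  obtain ⟨m, e, he1, he6, rfl⟩ : ∃ m e, 1 ≤ e ∧ e ≤ 6 ∧ n = 6 * m + e :=
    ⟨(n - 1) / 6, (n - 1) % 6 + 1, by omega, by omega, by omega⟩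
  interval_cases e
  · exact AHn3_block m 1 2 2 (by norm_num) P2C P2C iso2C iso2C rfl rfl (by norm_num) cell2C1 cell2C2
      (cell23 _ _) cell2C1 cell2C2 (cell23 _ _) rfl rfl rfl rfl rfl
  · exact AHn3_block m 2 3 4 (by norm_num) P3F P3C iso3F iso3C rfl rfl (by norm_num) cell3F1 cell3F2
      (cell33 _ _) cell3C1 cell3C2 (cell33 _ _) rfl rfl rfl rfl rfl
  · exact AHn3_block m 3 5 6 (by norm_num) P4F P4C iso4F iso4C rfl rfl (by norm_num) cell4F1 cell4F2
      (cell43 _ _) cell4C1 cell4C2 (cell43 _ _) rfl rfl rfl rfl rfl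
  · exact AHn3_block m 4 7 8 (by norm_num) P5F P5C iso5F iso5C rfl rfl (by norm_num) cell5F1 cell5F2
      (cell53 _ _) cell5C1 cell5C2 (cell53 _ _) rfl rfl rfl rfl rfl
  · exact AHn3_block m 5 10 10 (by norm_num) PA PA iso6C iso6C rfl rfl (by norm_num) cell6C1 cell6C2
      (cell63 _ _) cell6C1 cell6C2 (cell63 _ _) rfl rfl rfl rfl rfl
  · exact AHn3_block m 6 12 13 (by norm_num) P7F P7C iso7F iso7C rfl rfl (by norm_num) cell7F1 cell7F2
      (cell73 _ _) cell7C1 cell7C2 (cell73 _ _) rfl rfl rfl rfl rfl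

end AH

set_option linter.unusedSectionVars false
namespace AH
open MvPolynomial

theorem good4 (e : ℕ) (he : e ≤ 7) (P cs : List ℕ) (hcs : csL 1 (fun _ => e) = cs) (hP : IsoOK e P)
    (h0 : 0 ∈ cs ∧ cs.Nodup) (K w : ℕ) (hw : (cols4 cs).length = w)
    (hr : Nat.ble K (rankN w (rowsL (fun _ => e) cs (row4 cs) P)) = true) :
    Good (dotB (Fin e)) 4 P.length K := by
  subst hw
  have hcert := cert4 cs (fun _ => e) cs h0.1 h0.2 P K hr
  let sz : Fin 1 → ℕ := fun _ => e
  have hbs : Function.Injective (id : Fin 1 → Fin 1) := Function.injective_id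
  refine Good.to_std (B := blkB sz) (blkB_symm sz) (by rw [← WS_univ]; exact WS_nd sz _) ?_
    (Good.of_fintype (J := Fin P.length) (Fintype.card_fin _)
      (fun j => lft sz id fun c => (dz (P.get j) c : ℂ)) ?_ ?_)
  · simp [sz]
  · intro j
    rw [polZ_lft sz hbs (fun _ => e) (fun _ => rfl) (fun _ => he), (hP _ (P.get_mem j)).2, Int.cast_zero]
  · have hI := exists_toI sz hbs (fun _ => e) (fun _ => rfl) (fun _ => he)
    rw [hcs] at hI
    choose toI ai h1 h2 h3 using hI
    have hc : ∀ c ∈ cols4 cs, c.1 ∈ cs ∧ c.2.1 ∈ cs ∧ c.2.2.1 ∈ cs ∧ c.2.2.2 ∈ cs := by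
      rintro ⟨a, b, c, d⟩ h
      have h1 := List.pair_mem_product.1 h
      have h2 := List.pair_mem_product.1 h1.2
      have h3 := List.pair_mem_product.1 h2.2
      exact ⟨h1.1, h2.1, h3.1, h3.2⟩
    let g : MvPolynomial (Ix sz) ℂ →ₗ[ℂ] (Fin (cols4 cs).length → ℂ) :=
      LinearMap.pi fun j => (6⁻¹ : ℂ) • psi4 (toI _ (hc _ ((cols4 cs).get_mem j)).1,
        toI _ (hc _ ((cols4 cs).get_mem j)).2.1, toI _ (hc _ ((cols4 cs).get_mem j)).2.2.1,
        toI _ (hc _ ((cols4 cs).get_mem j)).2.2.2)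
    apply RankGE.of_map g
    refine hcert.mono ?_
    rintro _ ⟨x, hx, m, hm, hpol, rfl⟩
    refine ⟨lf (lft sz id fun c => (dz x c : ℂ)) ^ (4 - 1) * lf (lft sz id fun c => (m c : ℂ)), ?_, ?_⟩
    · obtain ⟨j, rfl⟩ := List.get_of_mem hx
      simp only [Set.mem_iUnion]
      refine ⟨j, _, trivial, ?_, rfl⟩
      rw [polZ_lft sz hbs (fun _ => e) (fun _ => rfl) (fun _ => he), hcs, hpol, Int.cast_zero]
    · funext j
      obtain ⟨c1, c2, c3, c4⟩ := hc _ ((cols4 cs).get_mem j)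
      show (6⁻¹ : ℂ) * psi4 _ _ = _
      rw [psi4_tan, inv_mul_cancel_left₀ (by norm_num)]
      simp only [v4, v3, h3 _ c1, h3 _ c2, h3 _ c3, h3 _ c4]
      push_cast
      rfl

set_option maxRecDepth 100000

theorem good4_4F : Good (dotB (Fin 4)) 4 8 24 :=
  good4 4 (by norm_num) [1, 10, 100, 1000, 1611, 2656, 2612, 6661]
    [0, 1, 2, 3] (by decide +kernel) (by
      unfold IsoOK
      decide +kernel) (by decide +kernel) 24 256 (by decide +kernel) (by decide +kernel)

theorem good4_4C : Good (dotB (Fin 4)) 4 9 25 :=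
  good4 4 (by norm_num) [1, 10, 100, 1000, 1611, 2656, 2612, 6661, 202]
    [0, 1, 2, 3] (by decide +kernel) (by
      unfold IsoOK
      decide +kernel) (by decide +kernel) 25 256 (by decide +kernel) (by decide +kernel)

theorem good4_5F : Good (dotB (Fin 5)) 4 13 52 :=
  good4 5 (by norm_num) [1, 10, 100, 1000, 10661, 11660, 10016, 1161, 16160, 11606, 11061, 6111, 16101]
    [0, 1, 2, 3, 4] (by decide +kernel) (by
      unfold IsoOK
      decide +kernel) (by decide +kernel) 52 625 (by decide +kernel) (by decide +kernel)

theorem good4_5C : Good (dotB (Fin 5)) 4 14 55 :=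
  good4 5 (by norm_num) [1, 10, 100, 1000, 10661, 11660, 10016, 1161, 16160, 11606, 11061, 6111, 16101, 160]
    [0, 1, 2, 3, 4] (by decide +kernel) (by
      unfold IsoOK
      decide +kernel) (by decide +kernel) 55 625 (by decide +kernel) (by decide +kernel)

theorem good4_6C : Good (dotB (Fin 6)) 4 21 105 :=
  good4 6 (by norm_num) [1, 10, 100, 1000, 10000, 100000, 660016, 606616, 106060, 606001, 10101, 600601, 166600, 666100, 600660, 16001, 160111, 616606, 161011, 666061, 161110]
    [0, 1, 2, 3, 4, 5] (by decide +kernel) (by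
      unfold IsoOK
      decide +kernel) (by decide +kernel) 105 1296 (by decide +kernel) (by decide +kernel)

theorem AHn34 : AHn 3 4 := by
  have h := hh_d4 3
  exact AHn_of (by norm_num) (r0 := 8) (r1 := 9) good4_4F (by rw [show hh 3 4 = 25 by omega]; exact good4_4C)
    (by norm_num)

theorem AHn44 : AHn 4 4 := by
  have h := hh_d4 4
  exact AHn_of (by norm_num) (r0 := 13) (r1 := 14) good4_5F (by rw [show hh 4 4 = 55 by omega]; exact good4_5C)
    (by norm_num)

theorem AHn54 : AHn 5 4 := by
  have h := hh_d4 5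
  exact AHn_of (by norm_num) (r0 := 21) (r1 := 21) good4_6C (by rw [show hh 5 4 = 105 by omega]; exact good4_6C)
    (by norm_num)

theorem AH_main (n d : ℕ) (hn : 1 ≤ n) (hd : 3 ≤ d) : AHn n d := AHn_all AHn3 AHn34 AHn44 AHn54 n d hn hd

end AH

set_option linter.unusedSectionVars false
namespace AH
open MvPolynomial

theorem finrank_biUnion_le {V J : Type} [AddCommGroup V] [Module ℂ V] (F : J → Set V) (n : ℕ)
    (hf : ∀ j, FiniteDimensional ℂ (Submodule.span ℂ (F j)))
    (hn : ∀ j, Module.finrank ℂ (Submodule.span ℂ (F j)) ≤ n) (s : Finset J) :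
    FiniteDimensional ℂ (Submodule.span ℂ (⋃ j ∈ s, F j)) ∧
      Module.finrank ℂ (Submodule.span ℂ (⋃ j ∈ s, F j)) ≤ s.card * n := by
  classical
  induction s using Finset.induction_on with
  | empty =>
    have h0 : (⋃ j ∈ (∅ : Finset J), F j) = ∅ := by simp
    rw [h0, Submodule.span_empty]
    exact ⟨inferInstance, by simp⟩
  | insert a s ha ih =>
    obtain ⟨ih1, ih2⟩ := ih
    have := hf a
    rw [Finset.set_biUnion_insert, Submodule.span_union, Finset.card_insert_of_notMem ha]
    refine ⟨inferInstance, (Submodule.finrank_add_le_finrank_add_finrank _ _).trans ?_⟩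
    have := hn a
    rw [add_mul, one_mul]
    omega

/-- a nonzero isotropic vector -/
theorem exists_iso_vec (n : ℕ) (hn : 1 ≤ n) : ∃ v : Fin (n+1) → ℂ, v ≠ 0 ∧ dotB (Fin (n+1)) v v = 0 := by
  obtain ⟨k, rfl⟩ : ∃ k, n = k + 1 := ⟨n - 1, by omega⟩
  refine ⟨Fin.cons 1 (Fin.cons Complex.I 0), fun h => ?_, ?_⟩
  · have := congrFun h 0
    simp at this
  · rw [dotB_apply, Fin.sum_univ_succ, Fin.sum_univ_succ]
    simp

theorem AH_final (n d r : ℕ) (hn : 1 ≤ n) (hd : 3 ≤ d) :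
    ∃ p : Fin r → (Fin (n + 1) → ℂ), (∀ j, p j ≠ 0) ∧ (∀ j, dotB (Fin (n+1)) (p j) (p j) = 0) ∧
      Module.finrank ℂ (Submodule.span ℂ (⋃ j, TanW (dotB (Fin (n+1))) ⊤ d (p j))) = min (r * n) (hh n d) := by
  classical
  obtain ⟨p, hp, hr⟩ := AH_main n d hn hd r
  obtain ⟨v, hv, hvv⟩ := exists_iso_vec n hn
  let q : Fin r → (Fin (n+1) → ℂ) := fun j => if p j = 0 then v else p j
  have hq : ∀ j, dotB (Fin (n+1)) (q j) (q j) = 0 := by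
    intro j
    by_cases h : p j = 0
    · simp only [q, if_pos h, hvv]
    · simp only [q, if_neg h, hp j]
  have hT : ∀ j, FiniteDimensional ℂ (Submodule.span ℂ (TanW (dotB (Fin (n+1))) ⊤ d (q j))) :=
    fun j => span_TanW_fin _ d _
  have hle := finrank_biUnion_le (fun j => TanW (dotB (Fin (n+1))) ⊤ d (q j)) n hT
    (fun j => finrank_span_TanW (by simp) _ dotB_nd (by omega) _) Finset.univ
  have hU : (⋃ j ∈ (Finset.univ : Finset (Fin r)), TanW (dotB (Fin (n+1))) ⊤ d (q j)) =
      ⋃ j, TanW (dotB (Fin (n+1))) ⊤ d (q j) := by simp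
  rw [hU, Finset.card_univ, Fintype.card_fin] at hle
  have hf := hle.1
  refine ⟨q, ?_, hq, le_antisymm (le_min hle.2 ?_) ?_⟩
  · intro j
    by_cases h : p j = 0
    · simp only [q, if_pos h]; exact hv
    · simp only [q, if_neg h]; exact h
  · have := Harm_fin n d
    refine le_trans (Submodule.finrank_mono (Submodule.span_le.2 (Set.iUnion_subset fun j => ?_))) (finrank_Harm n d)
    exact TanW_Harm (by omega) _ _ (hq j)
  · have h2 : RankGE ℂ (min (r * n) (hh n d))
        (Submodule.span ℂ (⋃ j, TanW (dotB (Fin (n+1))) ⊤ d (q j)) : Set (MvPolynomial (Fin (n+1)) ℂ)) := by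
      refine hr.mono (Set.iUnion_subset fun j => ?_)
      by_cases h : p j = 0
      · rw [h]
        refine (TanW_zero _ (by omega) _).trans ?_
        rintro _ rfl
        exact Submodule.zero_mem _
      · have hqj : q j = p j := if_neg h
        rw [← hqj]
        exact (Set.subset_iUnion (fun j => TanW (dotB (Fin (n+1))) ⊤ d (q j)) j).trans Submodule.subset_span
    exact h2.le_finrank _ subset_rfl

end AH

/-- Analogue of the Alexander–Hirschowitz theorem for `d ≥ 3` (via Terracini):
there are `r` nonzero isotropic linear forms for which the span of the tangent
spaces `ℓⱼ^{d−1}·(ℓⱼ)^⊥` has the expected dimension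
`min (r·n) (C(n+d,n) − C(n+d−2,n))`. -/
theorem stmt18 (n d r : ℕ) (hn : 1 ≤ n) (hd : 3 ≤ d) (hr : 1 ≤ r) :
    ∃ ℓ : Fin r → (Fin (n + 1) → ℂ),
      (∀ j, ℓ j ≠ 0) ∧ (∀ j, Isotropic (ℓ j)) ∧
      Module.finrank ℂ ↥(Submodule.span ℂ
        {p : MvPolynomial (Fin (n + 1)) ℂ |
          ∃ (j : Fin r) (m : Fin (n + 1) → ℂ),
            (∑ i, ℓ j i * m i = 0) ∧ p = (lin (ℓ j)) ^ (d - 1) * lin m}) =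
      min (r * n) ((n + d).choose n - (n + d - 2).choose n) := by
  obtain ⟨p, h1, h2, h3⟩ := AH.AH_final n d r hn hd
  refine ⟨p, h1, fun j => ?_, ?_⟩
  · have := h2 j
    rw [AH.dotB_apply] at this
    unfold Isotropic
    rw [← this]
    exact Finset.sum_congr rfl fun i _ => pow_two _
  · have hc := AH.hh_choose n (d - 2)
    rw [show d - 2 + 2 = d by omega, show n + (d - 2) = n + d - 2 by omega,
      show n + d - 2 + 2 = n + d by omega] at hc
    have hh : (n + d).choose n - (n + d - 2).choose n = AH.hh n d := by omega
    rw [hh, ← h3]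
    have hset : {f : MvPolynomial (Fin (n + 1)) ℂ | ∃ (j : Fin r) (m : Fin (n + 1) → ℂ),
        (∑ i, p j i * m i = 0) ∧ f = (lin (p j)) ^ (d - 1) * lin m} =
        ⋃ j, AH.TanW (AH.dotB (Fin (n+1))) ⊤ d (p j) := by
      ext f
      rw [Set.mem_iUnion]
      constructor
      · rintro ⟨j, m, hm, rfl⟩
        exact ⟨j, m, trivial, hm, rfl⟩
      · rintro ⟨j, m, -, hm, rfl⟩
        exact ⟨j, m, hm, rfl⟩
    rw [hset]
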